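/- arXiv:math/0006021 — 5 statements merged into one kernel-verified Lean document; each statement's English description precedes it below -/
import Mathlib

section
/- Let n ≥ 2 and let C₁,…,C_{p+1} ⊂ GL(n,ℂ) be conjugacy classes. If there exists an irreducible (p+1)-tuple of matrices M_j ∈ C_j with M₁M₂⋯M_{p+1} = I, then (α_n): d(C₁) + … + d(C_{p+1}) ≥ 2n² − 2, and (β_n): for every index j one has Σ_{i≠j} r(C_i) ≥ n. -/
open Matrix BigOperators

/-- A tuple of `n × n` matrices is irreducible if no subspace of `ℂⁿ` other than `⊥` and `⊤`
is invariant under all of them. -/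
def IrreducibleTuple {q n : ℕ} (M : Fin q → Matrix (Fin n) (Fin n) ℂ) : Prop :=
  ∀ V : Submodule ℂ (Fin n → ℂ),
    (∀ j, V.map (Matrix.mulVecLin (M j)) ≤ V) → V = ⊥ ∨ V = ⊤

/-- The dimension of the conjugacy class of `A` : `n² - dim (centralizer of A)`. -/
noncomputable def classDim {n : ℕ} (A : Matrix (Fin n) (Fin n) ℂ) : ℕ :=
  n ^ 2 - Module.finrank ℂ
    (LinearMap.ker (LinearMap.mulLeft ℂ A - LinearMap.mulRight ℂ A))

/-- `r(A) = min over λ of rank (A - λ·I)`; a conjugation invariant. -/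
noncomputable def minRank {n : ℕ} (A : Matrix (Fin n) (Fin n) ℂ) : ℕ :=
  sInf (Set.range fun lam : ℂ => (A - lam • (1 : Matrix (Fin n) (Fin n) ℂ)).rank)

/-- Prefix products of a sequence of endomorphisms. -/
noncomputable def prefixProd {R : Type*} [Monoid R] (A : ℕ → R) (k : ℕ) : R :=
  ((List.range k).map A).prod

lemma prefixProd_zero {R : Type*} [Monoid R] (A : ℕ → R) : prefixProd A 0 = 1 := by
  simp [prefixProd]

lemma prefixProd_succ {R : Type*} [Monoid R] (A : ℕ → R) (k : ℕ) :
    prefixProd A (k + 1) = prefixProd A k * A k := by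
  simp [prefixProd, List.range_succ]

lemma prefixProd_telescope {R : Type*} [Ring R] (A : ℕ → R) (k : ℕ) :
    ∑ i ∈ Finset.range k, prefixProd A i * (A i - 1) = prefixProd A k - 1 := by
  induction k with
  | zero => simp [prefixProd_zero]
  | succ k ih => rw [Finset.sum_range_succ, ih, prefixProd_succ, mul_sub]; simp

/-- Scott's lemma. -/
lemma scott {V : Type*} [AddCommGroup V] [Module ℂ V] [FiniteDimensional ℂ V]
    (A : ℕ → Module.End ℂ V) (q : ℕ) (hA : prefixProd A q = 1)
    (K R : Submodule ℂ V)
    (hK : ∀ v, (∀ i < q, A i v = v) → v ∈ K)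
    (hR : ∀ S : Submodule ℂ V, (∀ i < q, ∀ v, A i v - v ∈ S) → R ≤ S) :
    Module.finrank ℂ V + Module.finrank ℂ R ≤
      ∑ i ∈ Finset.range q, Module.finrank ℂ (LinearMap.range (A i - 1)) + Module.finrank ℂ K := by
  let W := (i : Fin q) → LinearMap.range (A i - 1)
  let φ : V →ₗ[ℂ] W := LinearMap.pi fun i => (A i - 1).rangeRestrict
  let ψ : W →ₗ[ℂ] V := ∑ i : Fin q,
    (prefixProd A i) ∘ₗ (LinearMap.range (A i - 1)).subtype ∘ₗ LinearMap.proj i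
  have hψ : ∀ w, ψ w = ∑ i : Fin q, prefixProd A i (w i : V) := by
    intro w; simp only [ψ, LinearMap.sum_apply]; rfl
  have hφψ : LinearMap.range φ ≤ LinearMap.ker ψ := by
    rintro _ ⟨v, rfl⟩
    rw [LinearMap.mem_ker, hψ]
    have h := congrArg (fun f : Module.End ℂ V => f v) (prefixProd_telescope A q)
    simp only [hA, sub_self, LinearMap.sum_apply, LinearMap.zero_apply] at h
    rw [← Fin.sum_univ_eq_sum_range (fun i => (prefixProd A i * (A i - 1)) v)] at h
    exact h
  have hkerφ : LinearMap.ker φ ≤ K := by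
    intro v hv
    apply hK
    intro i hi
    have := congrArg (fun w : W => ((w ⟨i, hi⟩ : LinearMap.range (A i - 1)) : V))
      (LinearMap.mem_ker.1 hv)
    exact sub_eq_zero.1 this
  have hterm : ∀ i < q, ∀ v, prefixProd A i (A i v - v) ∈ LinearMap.range ψ := by
    intro i hi v
    refine ⟨Pi.single ⟨i, hi⟩ ((A i - 1).rangeRestrict v), ?_⟩
    rw [hψ, Finset.sum_eq_single ⟨i, hi⟩]
    · simp
    · intro b _ hb
      simp [Pi.single_eq_of_ne hb]
    · simp
  have hRψ : R ≤ LinearMap.range ψ := by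
    apply hR
    intro i hi v
    have h := congrArg (fun f : Module.End ℂ V => f (A i v - v)) (prefixProd_telescope A i)
    have h2 : A i v - v = prefixProd A i (A i v - v) -
        (∑ k ∈ Finset.range i, prefixProd A k * (A k - 1)) (A i v - v) := by
      rw [h]; simp
    rw [h2]
    apply Submodule.sub_mem _ (hterm i hi v)
    rw [LinearMap.sum_apply]
    apply Submodule.sum_mem
    intro k hk
    exact hterm k ((Finset.mem_range.1 hk).trans hi) _
  have e1 := LinearMap.finrank_range_add_finrank_ker φ
  have e2 := LinearMap.finrank_range_add_finrank_ker ψ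
  have e3 : Module.finrank ℂ W =
      ∑ i ∈ Finset.range q, Module.finrank ℂ (LinearMap.range (A i - 1)) := by
    rw [← Fin.sum_univ_eq_sum_range (fun i => Module.finrank ℂ (LinearMap.range (A i - 1)))]
    exact Module.finrank_pi_fintype ℂ
  have i1 := Submodule.finrank_mono hφψ
  have i2 := Submodule.finrank_mono hkerφ
  have i3 := Submodule.finrank_mono hRψ
  omega

/-- Extension of a finite tuple by `1`. -/
noncomputable def extTuple {q n : ℕ} (M : Fin q → Matrix (Fin n) (Fin n) ℂ) (k : ℕ) :
    Matrix (Fin n) (Fin n) ℂ := if h : k < q then M ⟨k, h⟩ else 1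

lemma extTuple_coe {q n : ℕ} (M : Fin q → Matrix (Fin n) (Fin n) ℂ) (i : Fin q) :
    extTuple M i = M i := by simp [extTuple]

lemma prefixProd_extTuple {q n : ℕ} (M : Fin q → Matrix (Fin n) (Fin n) ℂ) :
    prefixProd (extTuple M) q = (List.ofFn M).prod := by
  have : List.ofFn M = List.ofFn (fun i : Fin q => extTuple M i) := by
    congr 1; funext i; rw [extTuple_coe]
  rw [this, prefixProd, List.ofFn_eq_map, ← List.map_coe_finRange_eq_range, List.map_map]
  rfl

lemma inv_of_irr {q n : ℕ} {M : Fin q → Matrix (Fin n) (Fin n) ℂ} (hirr : IrreducibleTuple M)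
    (V : Submodule ℂ (Fin n → ℂ)) (h : ∀ j, ∀ v ∈ V, M j *ᵥ v ∈ V) : V = ⊥ ∨ V = ⊤ := by
  apply hirr
  rintro j _ ⟨v, hv, rfl⟩
  exact h j v hv

/-- Schur's lemma. -/
lemma schur {q n : ℕ} (hn : 2 ≤ n) {M : Fin q → Matrix (Fin n) (Fin n) ℂ}
    (hirr : IrreducibleTuple M) (Y : Matrix (Fin n) (Fin n) ℂ) (hY : ∀ j, M j * Y = Y * M j) :
    ∃ c : ℂ, Y = c • 1 := by
  have : Nonempty (Fin n) := ⟨⟨0, by omega⟩⟩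
  obtain ⟨c, hc⟩ := Module.End.exists_eigenvalue (Matrix.toLin' Y)
  refine ⟨c, ?_⟩
  have h := inv_of_irr hirr (Module.End.eigenspace (Matrix.toLin' Y) c) (by
    intro j v hv
    rw [Module.End.mem_eigenspace_iff, Matrix.toLin'_apply] at hv ⊢
    rw [Matrix.mulVec_mulVec, ← hY, ← Matrix.mulVec_mulVec, hv, Matrix.mulVec_smul])
  rcases h with h | h
  · exact absurd h hc
  · apply Matrix.toLin'.injective
    ext1 i
    ext1
    have : (LinearMap.single ℂ (fun _ => ℂ) i 1 : Fin n → ℂ) ∈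
      Module.End.eigenspace (Matrix.toLin' Y) c := h ▸ Submodule.mem_top
    rw [Module.End.mem_eigenspace_iff] at this
    simpa using this

lemma not_all_scalar {q n : ℕ} (hn : 2 ≤ n) {M : Fin q → Matrix (Fin n) (Fin n) ℂ}
    (hirr : IrreducibleTuple M) (c : Fin q → ℂ) (h : ∀ j v, M j *ᵥ v = c j • v) : False := by
  let v : Fin n → ℂ := Pi.single ⟨0, by omega⟩ 1
  have hv : v ≠ 0 := by simp [v]
  rcases inv_of_irr hirr (Submodule.span ℂ {v}) (by
    intro j w hw; rw [h]; exact Submodule.smul_mem _ _ hw) with h1 | h1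
  · exact hv (Submodule.span_singleton_eq_bot.1 h1)
  · have := finrank_span_singleton (K := ℂ) hv
    rw [h1, finrank_top] at this
    simp at this
    omega

lemma exists_trace (n : ℕ) (f : Module.Dual ℂ (Matrix (Fin n) (Fin n) ℂ)) :
    ∃ Y : Matrix (Fin n) (Fin n) ℂ, ∀ X, f X = (Y * X).trace := by
  refine ⟨Matrix.of fun i j => f (Matrix.single j i 1), fun X => ?_⟩
  conv_lhs => rw [Matrix.matrix_eq_sum_single X]
  simp only [map_sum, Matrix.trace, Matrix.diag, Matrix.mul_apply, Matrix.of_apply]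
  rw [Finset.sum_comm]
  refine Finset.sum_congr rfl fun i _ => Finset.sum_congr rfl fun j _ => ?_
  have : Matrix.single j i (X j i) = X j i • Matrix.single j i (1 : ℂ) := by simp
  rw [this, map_smul, smul_eq_mul, mul_comm]

/-- Conjugation. -/
noncomputable def conjEnd {n : ℕ} (A : Matrix (Fin n) (Fin n) ℂ) :
    Module.End ℂ (Matrix (Fin n) (Fin n) ℂ) :=
  LinearMap.mulLeft ℂ A ∘ₗ LinearMap.mulRight ℂ A⁻¹

lemma conjEnd_apply {n : ℕ} (A X : Matrix (Fin n) (Fin n) ℂ) :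
    conjEnd A X = A * (X * A⁻¹) := rfl

lemma prefixProd_conj {n : ℕ} (M : ℕ → Matrix (Fin n) (Fin n) ℂ)
    (hM : ∀ i, IsUnit (M i)) (k : ℕ) (X : Matrix (Fin n) (Fin n) ℂ) :
    prefixProd (fun i => conjEnd (M i)) k X * prefixProd M k = prefixProd M k * X := by
  induction k generalizing X with
  | zero => simp [prefixProd_zero]
  | succ k ih =>
    have hd : IsUnit (M k).det := (Matrix.isUnit_iff_isUnit_det _).1 (hM k)
    rw [prefixProd_succ, prefixProd_succ, Module.End.mul_apply, ← mul_assoc, ih, conjEnd_apply]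
    simp only [mul_assoc]
    rw [Matrix.nonsing_inv_mul _ hd, mul_one]

lemma rank_conj {n : ℕ} (A : Matrix (Fin n) (Fin n) ℂ) (hA : IsUnit A) :
    Module.finrank ℂ (LinearMap.range (conjEnd A - 1)) ≤ classDim A := by
  have hd : IsUnit A.det := (Matrix.isUnit_iff_isUnit_det _).1 hA
  have e := LinearMap.finrank_range_add_finrank_ker (conjEnd A - 1)
  have hk : LinearMap.ker (LinearMap.mulLeft ℂ A - LinearMap.mulRight ℂ A) ≤
      LinearMap.ker (conjEnd A - 1) := by
    intro X hX
    rw [LinearMap.mem_ker] at hX ⊢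
    simp only [LinearMap.sub_apply, LinearMap.mulLeft_apply, LinearMap.mulRight_apply,
      sub_eq_zero] at hX
    rw [LinearMap.sub_apply, conjEnd_apply, ← mul_assoc, hX, mul_assoc,
      Matrix.mul_nonsing_inv _ hd]
    simp
  have h := Submodule.finrank_mono hk
  have e2 : Module.finrank ℂ (Matrix (Fin n) (Fin n) ℂ) = n ^ 2 := by
    simp [Module.finrank_matrix, sq]
  unfold classDim
  omega

lemma extTuple_unit {q n : ℕ} (M : Fin q → Matrix (Fin n) (Fin n) ℂ)
    (hunit : ∀ j, IsUnit (M j)) (i : ℕ) : IsUnit (extTuple M i) := by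
  unfold extTuple
  split_ifs
  · exact hunit _
  · exact isUnit_one

lemma alpha (n p : ℕ) (hn : 2 ≤ n)
    (M : Fin (p + 1) → Matrix (Fin n) (Fin n) ℂ)
    (hunit : ∀ j, IsUnit (M j))
    (hirr : IrreducibleTuple M)
    (hprod : (List.ofFn M).prod = 1) :
    2 * n ^ 2 - 2 ≤ ∑ j, classDim (M j) := by
  have hE := extTuple_unit M hunit
  have e2 : Module.finrank ℂ (Matrix (Fin n) (Fin n) ℂ) = n ^ 2 := by
    simp [Module.finrank_matrix, sq]
  have key := scott (fun i => conjEnd (extTuple M i)) (p + 1)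
    (by
      ext1 X
      have := prefixProd_conj (extTuple M) hE (p + 1) X
      rw [prefixProd_extTuple, hprod, one_mul, mul_one] at this
      exact this)
    (Submodule.span ℂ {1}) (LinearMap.ker (Matrix.traceLinearMap (Fin n) ℂ ℂ))
    (by
      intro Y hY
      obtain ⟨c, rfl⟩ := schur hn hirr Y (by
        intro j
        have h := hY j j.2
        have hd : IsUnit (M j).det := (Matrix.isUnit_iff_isUnit_det _).1 (hunit j)
        simp only [extTuple_coe, conjEnd_apply] at h
        conv_rhs => rw [← h]
        simp only [mul_assoc]
        rw [Matrix.nonsing_inv_mul _ hd, mul_one])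
      exact Submodule.smul_mem _ _ (Submodule.mem_span_singleton_self _))
    (by
      intro S hS X hX
      by_contra hXS
      obtain ⟨f, hfX, hfS⟩ := Submodule.exists_le_ker_of_notMem hXS
      obtain ⟨Y, hY⟩ := exists_trace n f
      obtain ⟨c, rfl⟩ := schur hn hirr Y (by
        intro j
        have hd : IsUnit (M j).det := (Matrix.isUnit_iff_isUnit_det _).1 (hunit j)
        apply Matrix.ext_iff_trace_mul_right.2
        intro Z
        have h := hfS (hS j j.2 (Z * M j))
        simp only [extTuple_coe, conjEnd_apply] at h
        rw [mul_assoc Z, Matrix.mul_nonsing_inv _ hd, mul_one, LinearMap.mem_ker, map_sub,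
          sub_eq_zero, hY, hY] at h
        rw [mul_assoc Y, h, mul_assoc, Matrix.trace_mul_comm, mul_assoc])
      apply hfX
      rw [LinearMap.mem_ker, Matrix.traceLinearMap_apply] at hX
      rw [hY, smul_mul_assoc, one_mul, Matrix.trace_smul, hX, smul_zero])
  have h1 : Module.finrank ℂ (Submodule.span ℂ {(1 : Matrix (Fin n) (Fin n) ℂ)}) ≤ 1 := by
    simpa using finrank_span_le_card (R := ℂ) ({(1 : Matrix (Fin n) (Fin n) ℂ)} : Set _)
  have h2 := LinearMap.finrank_range_add_finrank_ker (Matrix.traceLinearMap (Fin n) ℂ ℂ)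
  have h3 := Submodule.finrank_le (LinearMap.range (Matrix.traceLinearMap (Fin n) ℂ ℂ))
  rw [Module.finrank_self] at h3
  have h4 : ∑ i ∈ Finset.range (p + 1),
      Module.finrank ℂ (LinearMap.range (conjEnd (extTuple M i) - 1)) ≤ ∑ j, classDim (M j) := by
    rw [← Fin.sum_univ_eq_sum_range
      (fun i => Module.finrank ℂ (LinearMap.range (conjEnd (extTuple M i) - 1)))]
    apply Finset.sum_le_sum
    intro i _
    rw [extTuple_coe]
    exact rank_conj _ (hunit i)
  rw [e2] at key h2
  omega

lemma exists_minRank {n : ℕ} (A : Matrix (Fin n) (Fin n) ℂ) :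
    ∃ c : ℂ, (A - c • (1 : Matrix (Fin n) (Fin n) ℂ)).rank = minRank A :=
  Nat.sInf_mem (Set.range_nonempty
    (fun lam : ℂ => (A - lam • (1 : Matrix (Fin n) (Fin n) ℂ)).rank))

lemma prefixProd_smul {n : ℕ} (c : ℕ → ℂ) (M : ℕ → Matrix (Fin n) (Fin n) ℂ) (k : ℕ) :
    prefixProd (fun i => Matrix.toLinAlgEquiv' (c i • M i)) k =
      Matrix.toLinAlgEquiv' ((∏ i ∈ Finset.range k, c i) • prefixProd M k) := by
  induction k with
  | zero => simp [prefixProd_zero]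
  | succ k ih =>
    rw [prefixProd_succ, prefixProd_succ, ih, ← map_mul, Finset.prod_range_succ,
      smul_mul_smul_comm]

lemma beta (n p : ℕ) (hn : 2 ≤ n)
    (M : Fin (p + 1) → Matrix (Fin n) (Fin n) ℂ)
    (hunit : ∀ j, IsUnit (M j))
    (hirr : IrreducibleTuple M)
    (hprod : (List.ofFn M).prod = 1) (j : Fin (p + 1)) :
    n ≤ ∑ i ∈ Finset.univ.erase j, minRank (M i) := by
  choose c hc using fun i => exists_minRank (M i)
  by_cases h0 : ∃ i ∈ Finset.univ.erase j, c i = 0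
  · obtain ⟨i, hi, hi0⟩ := h0
    have h := hc i
    rw [hi0, zero_smul, sub_zero, Matrix.rank_of_isUnit _ (hunit i), Fintype.card_fin] at h
    calc n = minRank (M i) := h
      _ ≤ _ := Finset.single_le_sum (f := fun i => minRank (M i)) (fun _ _ => Nat.zero_le _) hi
  push Not at h0
  let P : ℂ := ∏ i ∈ Finset.univ.erase j, (c i)⁻¹
  have hP : P ≠ 0 := Finset.prod_ne_zero_iff.2 fun i hi => inv_ne_zero (h0 i hi)
  let d : Fin (p + 1) → ℂ := fun i => if i = j then P⁻¹ else (c i)⁻¹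
  have hd0 : ∀ i, d i ≠ 0 := by
    intro i
    by_cases h : i = j
    · simp [d, h, hP]
    · simp only [d, h, if_false]
      exact inv_ne_zero (h0 i (by simp [h]))
  have hdprod : ∏ i, d i = 1 := by
    rw [← Finset.mul_prod_erase _ _ (Finset.mem_univ j)]
    have : ∏ i ∈ Finset.univ.erase j, d i = P :=
      Finset.prod_congr rfl fun i hi => by simp [d, Finset.ne_of_mem_erase hi]
    rw [this]; simp [d, hP]
  let d' : ℕ → ℂ := fun k => if h : k < p + 1 then d ⟨k, h⟩ else 1
  have hd' : ∀ i : Fin (p + 1), d' i = d i := by intro i; simp only [d', i.2, dif_pos]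
  have hA : ∀ (i : Fin (p + 1)) v,
      Matrix.toLinAlgEquiv' (d' i • extTuple M i) v = d i • (M i *ᵥ v) := by
    intro i v
    rw [hd', extTuple_coe, Matrix.toLinAlgEquiv'_apply, Matrix.smul_mulVec]
  have hMv : ∀ (i : Fin (p + 1)) (v : Fin n → ℂ), M i *ᵥ v = (d i)⁻¹ • (d i • (M i *ᵥ v)) := by
    intro i v; rw [smul_smul, inv_mul_cancel₀ (hd0 i), one_smul]
  have key := scott (fun i => Matrix.toLinAlgEquiv' (d' i • extTuple M i)) (p + 1)
    (by
      rw [prefixProd_smul, prefixProd_extTuple, hprod,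
        ← Fin.prod_univ_eq_prod_range d']
      simp only [hd', hdprod, one_smul, map_one])
    ⊥ ⊤
    (by
      let K : Submodule ℂ (Fin n → ℂ) :=
        { carrier := {v | ∀ i, d i • (M i *ᵥ v) = v}
          add_mem' := by
            intro a b ha hb i
            rw [Matrix.mulVec_add, smul_add, ha i, hb i]
          zero_mem' := by intro i; simp
          smul_mem' := by
            intro t a ha i
            rw [Matrix.mulVec_smul, smul_comm, ha i] }
      intro v hv
      have hvK : v ∈ K := fun i => by rw [← hA]; exact hv i i.2
      rcases inv_of_irr hirr K (by
        intro i w hw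
        rw [hMv, hw i]; exact Submodule.smul_mem _ _ hw) with h | h
      · exact h ▸ hvK
      · exfalso
        refine not_all_scalar hn hirr (fun i => (d i)⁻¹) ?_
        intro i w
        have hw : w ∈ K := h ▸ Submodule.mem_top
        rw [hMv, hw i])
    (by
      intro S hS
      have hS' : ∀ i w, d i • (M i *ᵥ w) - w ∈ S := fun i w => by
        rw [← hA]; exact hS i i.2 w
      rcases inv_of_irr hirr S (by
        intro i w hw
        rw [hMv]
        apply Submodule.smul_mem
        have := Submodule.add_mem _ (hS' i w) hw
        rwa [sub_add_cancel] at this) with h | h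
      · exfalso
        refine not_all_scalar hn hirr (fun i => (d i)⁻¹) ?_
        intro i w
        have := hS' i w
        rw [h, Submodule.mem_bot, sub_eq_zero] at this
        rw [hMv, this]
      · rw [h])
  rw [← Fin.sum_univ_eq_sum_range (fun i => Module.finrank ℂ
    (LinearMap.range (Matrix.toLinAlgEquiv' (d' i • extTuple M i) - 1))), finrank_top, finrank_bot,
    ← Finset.add_sum_erase _ _ (Finset.mem_univ j)] at key
  have h1 : Module.finrank ℂ (LinearMap.range
      (Matrix.toLinAlgEquiv' (d' j • extTuple M j) - 1)) ≤ n := by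
    refine (Submodule.finrank_le (LinearMap.range
      (Matrix.toLinAlgEquiv' (d' j • extTuple M j) - 1))).trans (le_of_eq ?_)
    simp
  have h2 : ∑ i ∈ Finset.univ.erase j, Module.finrank ℂ (LinearMap.range
      (Matrix.toLinAlgEquiv' (d' i • extTuple M i) - 1)) ≤
      ∑ i ∈ Finset.univ.erase j, minRank (M i) := by
    apply Finset.sum_le_sum
    intro i hi
    have hci := h0 i hi
    have hdi : d i = (c i)⁻¹ := by simp [d, Finset.ne_of_mem_erase hi]
    rw [← hc i, Matrix.rank]
    apply Submodule.finrank_mono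
    rintro _ ⟨v, rfl⟩
    refine ⟨(c i)⁻¹ • v, ?_⟩
    rw [LinearMap.sub_apply, hA, hdi, Matrix.mulVecLin_apply, Matrix.sub_mulVec,
      Matrix.mulVec_smul, Matrix.smul_mulVec, Matrix.one_mulVec, smul_smul,
      mul_inv_cancel₀ hci, one_smul]
    rfl
  have h3 : Module.finrank ℂ (Fin n → ℂ) = n := by simp
  rw [h3] at key
  omega

/-- Simpson's necessary conditions. If the `(p+1)`-tuple `M j` of invertible
matrices is irreducible and `M 1 ⋯ M (p+1) = I`, then the dimensions `d(C_j)` of their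
conjugacy classes satisfy `(α_n)` and the quantities `r(C_j)` satisfy `(β_n)`. -/
theorem stmt0 (n p : ℕ) (hn : 2 ≤ n)
    (M : Fin (p + 1) → Matrix (Fin n) (Fin n) ℂ)
    (hunit : ∀ j, IsUnit (M j))
    (hirr : IrreducibleTuple M)
    (hprod : (List.ofFn M).prod = 1) :
    2 * n ^ 2 - 2 ≤ ∑ j, classDim (M j) ∧
    ∀ j, n ≤ ∑ i ∈ Finset.univ.erase j, minRank (M i) := by
  exact ⟨alpha n p hn M hunit hirr hprod, beta n p hn M hunit hirr hprod⟩
end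

section
/- Let c₁,…,c_{p+1} ⊂ gl(n,ℂ) be conjugacy classes whose eigenvalues are generic and which satisfy r(c₁) + … + r(c_{p+1}) ≥ 2n. Then there exists an irreducible (p+1)-tuple of matrices A_j ∈ c_j with A₁ + A₂ + … + A_{p+1} = 0. -/
open Matrix BigOperators

/-- `B` lies in the conjugacy class of `A` (conjugation by an invertible matrix). -/
def MatConj {n : ℕ} (A B : Matrix (Fin n) (Fin n) ℂ) : Prop :=
  ∃ S : (Matrix (Fin n) (Fin n) ℂ)ˣ, B = S.val * A * (S⁻¹).val

/-- Genericity of the eigenvalues (= roots of the characteristic polynomials, with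
multiplicity): no sums of sub-multisets of equal cardinality `κ`, `1 ≤ κ ≤ n-1`, equal `0`. -/
def GenericAddRoots {q n : ℕ} (M : Fin q → Matrix (Fin n) (Fin n) ℂ) : Prop :=
  ∀ κ : ℕ, 1 ≤ κ → κ ≤ n - 1 →
    ∀ Φ : Fin q → Multiset ℂ,
      (∀ j, Φ j ≤ (M j).charpoly.roots ∧ Multiset.card (Φ j) = κ) →
      (∑ j, (Φ j).sum) ≠ 0

open KaehlerDifferential TensorProduct in
lemma exists_derivation_of_trBasis {ι : Type} (x : ι → ℂ) (hx : IsTranscendenceBasis ℚ x)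
    (v : ι → ℂ) : ∃ δ : Derivation ℚ ℂ ℂ, ∀ i, δ (x i) = v i := by
  classical
  let alg : Algebra (MvPolynomial ι ℚ) ℂ := (MvPolynomial.aeval x).toRingHom.toAlgebra
  have hmap : ∀ q, algebraMap (MvPolynomial ι ℚ) ℂ q = MvPolynomial.aeval x q := fun q => rfl
  have tow : IsScalarTower ℚ (MvPolynomial ι ℚ) ℂ :=
    IsScalarTower.of_algebraMap_eq (fun r => by simp [hmap])
  have hinj : Function.Injective (algebraMap (MvPolynomial ι ℚ) ℂ) := hx.1
  have : FaithfulSMul (MvPolynomial ι ℚ) ℂ := (faithfulSMul_iff_algebraMap_injective _ _).2 hinj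
  let := FractionRing.liftAlgebra (MvPolynomial ι ℚ) ℂ
  have halg : Algebra.IsAlgebraic (MvPolynomial ι ℚ) ℂ := by
    have h1 := hx.isAlgebraic
    constructor
    intro z
    refine IsAlgebraic.of_ringHom_of_comp_eq (R := MvPolynomial ι ℚ)
      (S := Algebra.adjoin ℚ (Set.range x)) (g := RingHom.id ℂ)
      (f := hx.1.aevalEquiv.toAlgHom.toRingHom) (a := z) (h1.isAlgebraic z) ?_ ?_ ?_
    · exact hx.1.aevalEquiv.surjective
    · exact Function.injective_id
    · ext <;> simp [hmap]
  have : Algebra.IsAlgebraic (FractionRing (MvPolynomial ι ℚ)) ℂ :=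
    (IsFractionRing.comap_isAlgebraic_iff (A := MvPolynomial ι ℚ)).1 halg
  have : Algebra.FormallyEtale (FractionRing (MvPolynomial ι ℚ)) ℂ :=
    Algebra.FormallyEtale.of_isSeparable _ _
  have : Algebra.FormallyEtale (MvPolynomial ι ℚ) (FractionRing (MvPolynomial ι ℚ)) :=
    Algebra.FormallyEtale.of_isLocalization (nonZeroDivisors _)
  have : Algebra.FormallyEtale (MvPolynomial ι ℚ) ℂ :=
    Algebra.FormallyEtale.comp _ (FractionRing (MvPolynomial ι ℚ)) _
  let d0 : Derivation ℚ (MvPolynomial ι ℚ) ℂ := MvPolynomial.mkDerivation ℚ v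
  let l0 : Ω[MvPolynomial ι ℚ⁄ℚ] →ₗ[MvPolynomial ι ℚ] ℂ := d0.liftKaehlerDifferential
  let l1 : (ℂ ⊗[MvPolynomial ι ℚ] Ω[MvPolynomial ι ℚ⁄ℚ]) →ₗ[ℂ] ℂ :=
    LinearMap.liftBaseChange ℂ l0
  let l2 : Ω[ℂ⁄ℚ] →ₗ[ℂ] ℂ :=
    l1 ∘ₗ (tensorKaehlerEquivOfFormallyEtale ℚ (MvPolynomial ι ℚ) ℂ).symm.toLinearMap
  refine ⟨l2.compDer (D ℚ ℂ), fun i => ?_⟩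
  have : x i = algebraMap (MvPolynomial ι ℚ) ℂ (MvPolynomial.X i) := by simp [hmap]
  change l2 (D ℚ ℂ (x i)) = v i
  rw [this]
  simp only [l2, LinearMap.comp_apply, LinearEquiv.coe_coe]
  rw [tensorKaehlerEquivOfFormallyEtale_symm_D_algebraMap]
  simp [l1, l0, d0]

/-- Enough algebraically independent complex numbers, with derivations taking arbitrary values. -/
lemma exists_generic_numbers (J : Type) [Finite J] :
    ∃ x : J → ℂ, AlgebraicIndependent ℚ x ∧
      ∀ v : J → ℂ, ∃ δ : Derivation ℚ ℂ ℂ, ∀ i, δ (x i) = v i := by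
  classical
  obtain ⟨s, hs⟩ := exists_isTranscendenceBasis ℚ ℂ
  have hc : Infinite s := by
    have h := IsAlgClosed.cardinal_eq_cardinal_transcendence_basis_of_aleph0_lt' _ hs
      (by simp) (by simpa using Cardinal.aleph0_lt_continuum)
    rw [Cardinal.infinite_iff, ← h]
    simpa using Cardinal.aleph0_lt_continuum.le
  let f : J ↪ s := ((Finite.equivFin J).toEmbedding.trans Fin.valEmbedding).trans (Infinite.natEmbedding s)
  refine ⟨fun j => (f j : ℂ), hs.1.comp f f.injective, fun v => ?_⟩
  obtain ⟨δ, hδ⟩ := exists_derivation_of_trBasis (fun i : s => (i : ℂ)) hs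
    (fun i => if h : ∃ j, f j = i then v h.choose else 0)
  refine ⟨δ, fun j => ?_⟩
  rw [hδ]
  have h : ∃ k, f k = f j := ⟨j, rfl⟩
  rw [dif_pos h, f.injective h.choose_spec]

lemma exists_generic_matrices (q n : ℕ) :
    ∃ g : Fin q → (Matrix (Fin n) (Fin n) ℂ)ˣ,
      ∀ G : Fin q → Matrix (Fin n) (Fin n) ℂ, ∃ δ : Derivation ℚ ℂ ℂ,
        ∀ j, ((g j).val).map δ = G j := by
  classical
  obtain ⟨x, hx, hd⟩ := exists_generic_numbers (Fin q × Fin n × Fin n)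
  let M : Fin q → Matrix (Fin n) (Fin n) ℂ := fun j => Matrix.of fun a b => x (j, a, b)
  have hM : ∀ j, IsUnit (M j) := by
    intro j
    rw [Matrix.isUnit_iff_isUnit_det, isUnit_iff_ne_zero]
    have hj : AlgebraicIndependent ℚ (fun ab : Fin n × Fin n => x (j, ab)) :=
      hx.comp (fun ab => (j, ab)) (fun a b h => by simpa using h)
    have h0 := Matrix.det_mvPolynomialX_ne_zero (Fin n) ℚ
    intro h1
    apply h0
    apply hj
    rw [map_zero, AlgHom.map_det]
    rw [← h1]
    congr 1
    ext a b
    simp [M]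
  refine ⟨fun j => (hM j).unit, fun G => ?_⟩
  obtain ⟨δ, hδ⟩ := hd (fun i => G i.1 i.2.1 i.2.2)
  refine ⟨δ, fun j => ?_⟩
  ext a b
  simp [M, hδ]

/-- Block upper triangular matrices with respect to the grading `t`. -/
def pp {n : ℕ} (t : Fin n → ℕ) : Submodule ℂ (Matrix (Fin n) (Fin n) ℂ) where
  carrier := {X | ∀ a b, t b < t a → X a b = 0}
  zero_mem' := fun _ _ _ => rfl
  add_mem' := fun {X Y} hX hY a b h => by simp [hX a b h, hY a b h]
  smul_mem' := fun c X hX a b h => by simp [hX a b h]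

/-- Block strictly upper triangular matrices with respect to the grading `t`. -/
def uu {n : ℕ} (t : Fin n → ℕ) : Submodule ℂ (Matrix (Fin n) (Fin n) ℂ) where
  carrier := {X | ∀ a b, t b ≤ t a → X a b = 0}
  zero_mem' := fun _ _ _ => rfl
  add_mem' := fun {X Y} hX hY a b h => by simp [hX a b h, hY a b h]
  smul_mem' := fun c X hX a b h => by simp [hX a b h]

lemma adapted_basis {n : ℕ} (F : ℕ → Submodule ℂ (Fin n → ℂ)) (hF : Monotone F)
    (h0 : F 0 = ⊥) (m : ℕ) (hm : F m = ⊤) :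
    ∃ (b : Module.Basis (Fin n) ℂ (Fin n → ℂ)) (t : Fin n → ℕ),
      ∀ i x, x ∈ F i ↔ ∀ a, i ≤ t a → b.repr x a = 0 := by
  classical
  have step : ∀ i (s : Set (Fin n → ℂ)), ∃ s' : Set (Fin n → ℂ),
      (LinearIndepOn ℂ id s ∧ Submodule.span ℂ s = F i) →
      (LinearIndepOn ℂ id s' ∧ Submodule.span ℂ s' = F (i+1)) ∧ s ⊆ s' := by
    intro i s
    by_cases hs : LinearIndepOn ℂ id s ∧ Submodule.span ℂ s = F i
    · obtain ⟨s', h1, h2, h3, h4⟩ := exists_linearIndepOn_id_extension (K := ℂ) (s := s)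
        (t := (F (i+1) : Set (Fin n → ℂ))) hs.1 (by
          intro x hx
          exact hF (Nat.le_succ i) (hs.2 ▸ Submodule.subset_span hx))
      refine ⟨s', fun _ => ⟨⟨h4, le_antisymm (Submodule.span_le.2 h1) h3⟩, h2⟩⟩
    · exact ⟨∅, fun h => absurd h hs⟩
  choose f hf using step
  let B : ℕ → Set (Fin n → ℂ) := fun i => Nat.rec ∅ (fun i s => f i s) i
  have hB : ∀ i, LinearIndepOn ℂ id (B i) ∧ Submodule.span ℂ (B i) = F i := by
    intro i
    induction i with
    | zero => exact ⟨linearIndepOn_empty _ _, by simp [B, h0]⟩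
    | succ i ih => exact (hf i (B i) ih).1
  have hBs : ∀ i, B i ⊆ B (i+1) := fun i => (hf i (B i) (hB i)).2
  have hBm : Monotone B := monotone_nat_of_le_succ hBs
  have hli : LinearIndependent ℂ (Subtype.val : {v // v ∈ B m} → (Fin n → ℂ)) := (hB m).1
  let b0 : Module.Basis {v // v ∈ B m} ℂ (Fin n → ℂ) := Module.Basis.mk (v := Subtype.val) hli (by
    rw [Subtype.range_val, (hB m).2, hm])
  have hb0 : ∀ v, b0 v = v.1 := fun v => by simp [b0]
  let e : {v // v ∈ B m} ≃ Fin n := b0.indexEquiv (Pi.basisFun ℂ (Fin n))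
  let b := b0.reindex e
  let t : Fin n → ℕ := fun a => sInf {i | b a ∈ B (i+1)}
  have hbm : ∀ a, b a ∈ B m := fun a => by
    simp only [b, Module.Basis.reindex_apply, hb0]
    exact (e.symm a).2
  have hpos : ∀ a, ∃ k, m = k + 1 := fun a => by
    cases hmm : m with
    | zero => have := hbm a; rw [hmm] at this; simp [B] at this
    | succ k => exact ⟨k, rfl⟩
  have ht : ∀ a i, b a ∈ B i ↔ t a < i := by
    intro a i
    constructor
    · intro h
      cases i with
      | zero => simp [B] at h
      | succ i => exact Nat.lt_succ_of_le (Nat.sInf_le h)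
    · intro h
      obtain ⟨k, hk⟩ := hpos a
      have hne : {i | b a ∈ B (i+1)}.Nonempty := ⟨k, by
        have := hbm a; rw [hk] at this; exact this⟩
      exact hBm h (Nat.sInf_mem hne)
  refine ⟨b, t, fun i x => ?_⟩
  by_cases him : i ≤ m
  · have himg : b '' {a | t a < i} = B i := by
      ext v
      constructor
      · rintro ⟨a, ha, rfl⟩
        exact (ht a i).2 ha
      · intro hv
        refine ⟨e ⟨v, hBm him hv⟩, ?_, ?_⟩
        · rw [Set.mem_ofPred_eq, ← ht]
          simpa [b, hb0] using hv
        · simp [b, hb0]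
    rw [← (hB i).2, ← himg, Module.Basis.mem_span_image]
    constructor
    · intro h a ha
      by_contra hne
      have := h (Finsupp.mem_support_iff.2 hne)
      simp only [Set.mem_ofPred_eq] at this
      omega
    · intro h a ha
      by_contra hne
      exact (Finsupp.mem_support_iff.1 ha) (h a (by simpa using hne))
  · have : F i = ⊤ := top_unique (hm ▸ hF (le_of_not_ge him))
    simp only [this, Submodule.mem_top, true_iff]
    intro a ha
    have := (ht a m).1 (hbm a)
    omega

lemma normal_form_flag {n : ℕ} (Y : Matrix (Fin n) (Fin n) ℂ) :
    ∃ (F : ℕ → Submodule ℂ (Fin n → ℂ)) (ξ : ℕ → ℂ) (m : ℕ), Monotone F ∧ F 0 = ⊥ ∧ F m = ⊤ ∧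
      ∀ i x, x ∈ F (i+1) ↔ Y *ᵥ x - ξ i • x ∈ F i := by
  classical
  let l := Y.charpoly.roots.toList
  let ξ : ℕ → ℂ := fun k => l.getD k 0
  let P : ℕ → Polynomial ℂ := fun i => ∏ k ∈ Finset.range i, (Polynomial.X - Polynomial.C (ξ k))
  let f : Module.End ℂ (Fin n → ℂ) := Matrix.toLin' Y
  have hPn : P l.length = Y.charpoly := by
    have h1 : (Y.charpoly.roots.map (fun a => Polynomial.X - Polynomial.C a)).prod = Y.charpoly := by
      refine Polynomial.prod_multiset_X_sub_C_of_monic_of_roots_card_eq (Matrix.charpoly_monic Y) ?_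
      exact (IsAlgClosed.card_roots_eq_natDegree)
    rw [← h1]
    have h2 : Y.charpoly.roots = (l : Multiset ℂ) := by simp [l]
    rw [h2, Multiset.map_coe, Multiset.prod_coe]
    simp only [P]
    rw [← Fin.prod_univ_eq_prod_range (fun k => Polynomial.X - Polynomial.C (ξ k)) l.length]
    rw [← Fin.prod_univ_getElem]
    simp [ξ]
    refine Fintype.prod_equiv (finCongr (by simp)) _ _ ?_
    intro i
    simp
  have hfx : ∀ x, f x = Y *ᵥ x := fun x => by simp [f]
  refine ⟨fun i => LinearMap.ker (Polynomial.aeval f (P i)), ξ, l.length, ?_, ?_, ?_, ?_⟩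
  · refine monotone_nat_of_le_succ (fun i => ?_)
    intro x hx
    simp only [LinearMap.mem_ker] at hx ⊢
    simp only [P] at hx ⊢
    rw [Finset.prod_range_succ, mul_comm, map_mul, Module.End.mul_apply, hx, map_zero]
  · simp only [P, Finset.prod_range_zero, map_one]
    exact LinearMap.ker_eq_bot.2 Function.injective_id
  · change LinearMap.ker (Polynomial.aeval f (P l.length)) = ⊤
    rw [hPn, LinearMap.ker_eq_top]
    have := Matrix.aeval_self_charpoly Y
    have h2 : Polynomial.aeval f Y.charpoly = Matrix.toLinAlgEquiv' (Polynomial.aeval Y Y.charpoly) := by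
      rw [← Polynomial.aeval_algHom_apply]
      rfl
    rw [h2, this, map_zero]
  · intro i x
    simp only [LinearMap.mem_ker]
    simp only [P]
    rw [Finset.prod_range_succ, map_mul, Module.End.mul_apply]
    simp [hfx]

lemma finrank_coord {n : ℕ} (s : Fin n → Prop) [DecidablePred s] (W : Submodule ℂ (Fin n → ℂ))
    (hW : ∀ x, x ∈ W ↔ ∀ a, ¬ s a → x a = 0) :
    Module.finrank ℂ W = Fintype.card {a // s a} := by
  let e : W ≃ₗ[ℂ] ({a // s a} → ℂ) :=
    { toFun := fun x a => x.1 a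
      map_add' := fun x y => rfl
      map_smul' := fun c x => rfl
      invFun := fun y => ⟨fun a => if h : s a then y ⟨a, h⟩ else 0, (hW _).2 (fun a ha => by simp [ha])⟩
      left_inv := fun x => by
        ext a
        by_cases h : s a
        · simp [h]
        · simp [h, (hW x.1).1 x.2 a h]
      right_inv := fun y => by
        ext a
        simp [a.2] }
  rw [e.finrank_eq]
  simp

lemma normal_form {n : ℕ} (Y : Matrix (Fin n) (Fin n) ℂ) :
    ∃ (S : (Matrix (Fin n) (Fin n) ℂ)ˣ) (t : Fin n → ℕ) (ξ : ℕ → ℂ) (N : Matrix (Fin n) (Fin n) ℂ),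
      N = S.val * Y * (S⁻¹).val ∧ N - diagonal (fun a => ξ (t a)) ∈ uu t ∧
      (∀ Z, N * Z - Z * N ∈ uu t → Z ∈ pp t) ∧
      ∀ k, Fintype.card {a // t a = k} + minRank Y ≤ n := by
  classical
  obtain ⟨F, ξ, m, hmono, h0, hm, hF⟩ := normal_form_flag Y
  obtain ⟨b, t, hb⟩ := adapted_basis F hmono h0 m hm
  let c := Pi.basisFun ℂ (Fin n)
  let S : (Matrix (Fin n) (Fin n) ℂ)ˣ := ⟨b.toMatrix c, c.toMatrix b, by simp, by simp⟩
  let N := LinearMap.toMatrix b b (Matrix.toLin' Y)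
  have hN : N = S.val * Y * (S⁻¹).val := by
    change _ = b.toMatrix c * Y * c.toMatrix b
    have := basis_toMatrix_mul_linearMap_toMatrix_mul_basis_toMatrix b c b c (Matrix.toLin' Y)
    simp only [N]
    rw [← this]
    congr 2
    rw [LinearMap.toMatrix_eq_toMatrix', LinearMap.toMatrix'_toLin']
  have hNr : ∀ v : Fin n → ℂ, N *ᵥ (b.repr v) = b.repr (Y *ᵥ v) := by
    intro v
    simpa using LinearMap.toMatrix_mulVec_repr b b (Matrix.toLin' Y) v
  -- the key property in coordinates
  have key : ∀ i (x : Fin n → ℂ), (∀ a, i + 1 ≤ t a → x a = 0) ↔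
      (∀ a, i ≤ t a → (N *ᵥ x) a - ξ i * x a = 0) := by
    intro i x
    obtain ⟨v, rfl⟩ : ∃ v, x = b.repr v := ⟨b.equivFun.symm x, by
      rw [← Module.Basis.equivFun_apply, LinearEquiv.apply_symm_apply]⟩
    rw [← hb, hF, hb, hNr]
    simp
  refine ⟨S, t, ξ, N, hN, ?_, ?_, ?_⟩
  · intro a d hda
    have h1 := (key (t d) (Pi.single d 1)).1 (fun a ha => by
      rw [Pi.single_apply, if_neg]
      rintro rfl
      omega) a hda
    simp only [Matrix.mulVec_single_one, Matrix.col_apply] at h1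
    rw [Matrix.sub_apply, ← h1]
    by_cases had : a = d
    · subst had; simp
    · simp [had]
  · intro Z hZ
    -- Z preserves all the coordinate subspaces
    have hpres : ∀ i (x : Fin n → ℂ), (∀ a, i ≤ t a → x a = 0) →
        ∀ a, i ≤ t a → (Z *ᵥ x) a = 0 := by
      intro i
      induction i with
      | zero =>
        intro x hx a ha
        have : x = 0 := by ext a; exact hx a (Nat.zero_le _)
        simp [this]
      | succ i ih =>
        intro x hx
        rw [key]
        have hx' := (key i x).1 hx
        intro a ha
        have h1 := ih (N *ᵥ x - ξ i • x) (fun a ha => by simpa using hx' a ha) a ha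
        have h2 : ((N * Z - Z * N) *ᵥ x) a = 0 := by
          simp only [Matrix.mulVec, dotProduct]
          refine Finset.sum_eq_zero (fun d _ => ?_)
          by_cases hd : i + 1 ≤ t d
          · rw [hx d hd, mul_zero]
          · rw [hZ a d (by omega), zero_mul]
        rw [Matrix.sub_mulVec, ← Matrix.mulVec_mulVec, ← Matrix.mulVec_mulVec] at h2
        rw [Matrix.mulVec_sub, Matrix.mulVec_smul] at h1
        simp only [Pi.sub_apply, Pi.smul_apply, smul_eq_mul] at h1 h2
        linear_combination h2 + h1
    intro a d hda
    have := hpres (t d + 1) (Pi.single d 1) (fun a ha => by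
      rw [Pi.single_apply, if_neg]
      rintro rfl
      omega) a (by omega)
    simpa [Matrix.mulVec_single_one, Matrix.col_apply] using this
  · intro k
    have hd : ∀ i, Module.finrank ℂ (F i) = Fintype.card {a // t a < i} := by
      intro i
      rw [← finrank_coord (fun a => t a < i) ((F i).map b.equivFun.toLinearMap) ?_]
      · exact (LinearEquiv.finrank_map_eq b.equivFun (F i)).symm
      · intro x
        rw [Submodule.mem_map_equiv, hb]
        simp only [← Module.Basis.equivFun_apply, LinearEquiv.apply_symm_apply, not_lt]
    let g : (Fin n → ℂ) →ₗ[ℂ] (Fin n → ℂ) := (Y - ξ k • (1 : Matrix (Fin n) (Fin n) ℂ)).mulVecLin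
    have hg : F (k+1) = (F k).comap g := by
      ext x
      rw [hF]
      simp [g, Matrix.sub_mulVec, Matrix.smul_mulVec]
    have h1 : Module.finrank ℂ (F (k+1)) ≤ Module.finrank ℂ (F k) + Module.finrank ℂ (LinearMap.ker g) := by
      rw [hg]
      let g' := g.domRestrict ((F k).comap g)
      have hr := LinearMap.finrank_range_add_finrank_ker g'
      have e1 : Module.finrank ℂ (LinearMap.range g') ≤ Module.finrank ℂ (F k) := by
        apply Submodule.finrank_mono
        rintro _ ⟨x, rfl⟩
        exact x.2
      have e2 : Module.finrank ℂ (LinearMap.ker g') ≤ Module.finrank ℂ (LinearMap.ker g) := by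
        have : (LinearMap.ker g').map ((F k).comap g).subtype ≤ LinearMap.ker g := by
          rintro _ ⟨x, hx, rfl⟩
          exact hx
        rw [← Submodule.finrank_map_subtype_eq]
        exact Submodule.finrank_mono this
      omega
    have h2 : (Y - ξ k • (1 : Matrix (Fin n) (Fin n) ℂ)).rank + Module.finrank ℂ (LinearMap.ker g) = n := by
      have := LinearMap.finrank_range_add_finrank_ker g
      simpa [Matrix.rank] using this
    have h3 : minRank Y ≤ (Y - ξ k • (1 : Matrix (Fin n) (Fin n) ℂ)).rank :=
      Nat.sInf_le ⟨ξ k, rfl⟩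
    have h4 : Fintype.card {a // t a < k + 1} = Fintype.card {a // t a < k} + Fintype.card {a // t a = k} := by
      simp only [Fintype.card_subtype]
      rw [← Finset.card_union_of_disjoint]
      · congr 1
        ext a
        simp
        omega
      · rw [Finset.disjoint_left]
        intro a
        simp
        omega
    rw [hd, hd] at h1
    omega

section parab
variable {n : ℕ} {t : Fin n → ℕ}

lemma pp_mul {X Y : Matrix (Fin n) (Fin n) ℂ} (hX : X ∈ pp t) (hY : Y ∈ pp t) : X * Y ∈ pp t := by
  intro a b h
  rw [Matrix.mul_apply]
  refine Finset.sum_eq_zero fun c _ => ?_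
  by_cases hc : t c < t a
  · rw [hX a c hc, zero_mul]
  · rw [hY c b (by omega), mul_zero]

lemma pp_mul_uu {X Y : Matrix (Fin n) (Fin n) ℂ} (hX : X ∈ pp t) (hY : Y ∈ uu t) : X * Y ∈ uu t := by
  intro a b h
  rw [Matrix.mul_apply]
  refine Finset.sum_eq_zero fun c _ => ?_
  by_cases hc : t c < t a
  · rw [hX a c hc, zero_mul]
  · rw [hY c b (by omega), mul_zero]

lemma uu_mul_pp {X Y : Matrix (Fin n) (Fin n) ℂ} (hX : X ∈ uu t) (hY : Y ∈ pp t) : X * Y ∈ uu t := by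
  intro a b h
  rw [Matrix.mul_apply]
  refine Finset.sum_eq_zero fun c _ => ?_
  by_cases hc : t c ≤ t a
  · rw [hX a c hc, zero_mul]
  · rw [hY c b (by omega), mul_zero]

lemma uu_le_pp : uu t ≤ pp t := fun _ hX a b h => hX a b h.le

lemma diagonal_mem_pp (d : Fin n → ℂ) : diagonal d ∈ pp t := by
  intro a b h
  apply diagonal_apply_ne
  rintro rfl
  omega

lemma one_mem_pp : (1 : Matrix (Fin n) (Fin n) ℂ) ∈ pp t := by
  rw [← diagonal_one]; exact diagonal_mem_pp _

lemma trace_uu {X : Matrix (Fin n) (Fin n) ℂ} (hX : X ∈ uu t) : X.trace = 0 :=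
  Finset.sum_eq_zero fun a _ => hX a a le_rfl

lemma sum_fiber (t : Fin n → ℕ) (f : Fin n → ℂ) :
    ∑ a, f a = ∑ k ∈ Finset.univ.image t, ∑ a : {a // t a = k}, f a := by
  rw [← Finset.sum_fiberwise_of_maps_to (s := Finset.univ) (t := Finset.univ.image t) (g := t)
    (fun a _ => Finset.mem_image_of_mem _ (Finset.mem_univ a))]
  refine Finset.sum_congr rfl fun k _ => ?_
  rw [Finset.sum_subtype (Finset.univ.filter fun a => t a = k) (p := fun a => t a = k)]
  simp

lemma block_mul {X Y : Matrix (Fin n) (Fin n) ℂ} (hX : X ∈ pp t) (hY : Y ∈ pp t) (k : ℕ) :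
    (X * Y).toSquareBlock t k = X.toSquareBlock t k * Y.toSquareBlock t k := by
  ext a b
  simp only [Matrix.toSquareBlock_def, Matrix.mul_apply, Matrix.of_apply]
  rw [← Finset.sum_filter_of_ne (p := fun c => t c = k)]
  · rw [Finset.sum_subtype (Finset.univ.filter fun c => t c = k) (p := fun c => t c = k) (by simp)]
  · intro c _ hne
    have ha := a.2
    have hb := b.2
    by_contra hc
    apply hne
    rcases lt_or_gt_of_ne hc with h | h
    · rw [hX a c (by omega), zero_mul]
    · rw [hY c b (by omega), mul_zero]
end parab

lemma idem_trace {ι : Type*} [Fintype ι] [DecidableEq ι] (M : Matrix ι ι ℂ) (h : M * M = M) :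
    ∃ r : ℕ, M.trace = r := by
  let f : Module.End ℂ (ι → ℂ) := Matrix.toLin' M
  have hf : f ∘ₗ f = f := by
    simp only [f]; rw [← Matrix.toLin'_mul, h]
  have hp : LinearMap.IsProj (LinearMap.range f) f :=
    ⟨fun x => ⟨x, rfl⟩, by rintro _ ⟨y, rfl⟩; exact LinearMap.congr_fun hf y⟩
  refine ⟨Module.finrank ℂ (LinearMap.range f), ?_⟩
  rw [← hp.trace]
  simp [f, Matrix.trace_toLin'_eq]

lemma idem_trace_zero {n : ℕ} (M : Matrix (Fin n) (Fin n) ℂ) (h : M * M = M) (h0 : M.trace = 0) :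
    M = 0 := by
  have hf : IsIdempotentElem (Matrix.toLin' M) := by
    unfold IsIdempotentElem
    rw [Module.End.mul_eq_comp, ← Matrix.toLin'_mul, h]
  have := LinearMap.IsIdempotentElem.eq_zero_of_trace_eq_zero hf (by simpa [Matrix.trace_toLin'_eq] using h0)
  simpa using this

/-- Off-diagonal elements of `pp t` with respect to the idempotent `e`. -/
def OO {n : ℕ} (t : Fin n → ℕ) (e : Matrix (Fin n) (Fin n) ℂ) :
    Submodule ℂ (Matrix (Fin n) (Fin n) ℂ) where
  carrier := {x | x ∈ pp t ∧ e * x + x * e = x}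
  zero_mem' := ⟨zero_mem _, by simp⟩
  add_mem' := fun {x y} hx hy => ⟨add_mem hx.1 hy.1, by
    rw [mul_add, add_mul, add_add_add_comm, hx.2, hy.2]⟩
  smul_mem' := fun c x hx => ⟨Submodule.smul_mem _ c hx.1, by
    rw [mul_smul_comm, smul_mul_assoc, ← smul_add, hx.2]⟩

lemma finrank_OO {n : ℕ} (t : Fin n → ℕ) (e : Matrix (Fin n) (Fin n) ℂ) (he : e * e = e)
    (hep : e ∈ pp t) :
    (Module.finrank ℂ (OO t e) : ℂ) =
      ∑ a, ∑ b, if t a ≤ t b then (e a a * (1 - e b b) + (1 - e a a) * e b b) else 0 := by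
  classical
  let mask : Matrix (Fin n) (Fin n) ℂ →ₗ[ℂ] Matrix (Fin n) (Fin n) ℂ :=
    { toFun := fun x => Matrix.of fun a b => if t a ≤ t b then x a b else 0
      map_add' := fun x y => by ext a b; by_cases h : t a ≤ t b <;> simp [h]
      map_smul' := fun c x => by ext a b; by_cases h : t a ≤ t b <;> simp [h] }
  let off : Matrix (Fin n) (Fin n) ℂ →ₗ[ℂ] Matrix (Fin n) (Fin n) ℂ :=
    { toFun := fun x => e * x * (1 - e) + (1 - e) * x * e
      map_add' := fun x y => by noncomm_ring
      map_smul' := fun c x => by simp [mul_smul_comm, smul_mul_assoc, smul_add] }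
  have he1 : (1 - e) ∈ pp t := sub_mem one_mem_pp hep
  have hp : LinearMap.IsProj (OO t e) (off ∘ₗ mask) := by
    constructor
    · intro x
      have hm : mask x ∈ pp t := fun a b h => by
        simp [mask, not_le.2 h]
      refine ⟨add_mem (pp_mul (pp_mul hep hm) he1) (pp_mul (pp_mul he1 hm) hep), ?_⟩
      change e * (e * mask x * (1 - e) + (1 - e) * mask x * e) +
        (e * mask x * (1 - e) + (1 - e) * mask x * e) * e =
        e * mask x * (1 - e) + (1 - e) * mask x * e
      have h1 : e * (1 - e) = 0 := by rw [mul_sub, he, mul_one, sub_self]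
      have h2 : (1 - e) * e = 0 := by rw [sub_mul, he, one_mul, sub_self]
      have e1 : e * (e * mask x * (1 - e) + (1 - e) * mask x * e) = e * mask x * (1 - e) := by
        rw [mul_add, ← mul_assoc, ← mul_assoc, he, ← mul_assoc e ((1 - e) * mask x), ← mul_assoc e (1 - e), h1]
        simp
      have e2 : (e * mask x * (1 - e) + (1 - e) * mask x * e) * e = (1 - e) * mask x * e := by
        rw [add_mul, mul_assoc _ (1 - e) e, h2, mul_assoc _ e e, he]
        simp
      rw [e1, e2]
    · intro x hx
      have hm : mask x = x := by
        ext a b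
        by_cases h : t a ≤ t b
        · simp [mask, h]
        · simp [mask, h, hx.1 a b (not_le.1 h)]
      change e * mask x * (1 - e) + (1 - e) * mask x * e = x
      rw [hm]
      have h3 : e * x * e = 0 := by
        have := congrArg (fun z => e * z) hx.2
        simp only [mul_add, ← mul_assoc, he] at this
        simpa using this
      calc e * x * (1 - e) + (1 - e) * x * e = e * x + x * e - e * x * e - e * x * e := by noncomm_ring
        _ = x := by rw [h3, hx.2]; simp
  rw [← hp.trace, LinearMap.trace_eq_matrix_trace ℂ (Matrix.stdBasis ℂ (Fin n) (Fin n)), Matrix.trace,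
    Fintype.sum_prod_type]
  refine Finset.sum_congr rfl fun a _ => Finset.sum_congr rfl fun b _ => ?_
  rw [Matrix.diag_apply, LinearMap.toMatrix_apply, Matrix.stdBasis_eq_single]
  have hrep : ∀ M : Matrix (Fin n) (Fin n) ℂ, (Matrix.stdBasis ℂ (Fin n) (Fin n)).repr M (a, b) = M a b := by
    intro M; rfl
  rw [hrep]
  have hmask : mask (Matrix.single a b 1) = if t a ≤ t b then Matrix.single a b 1 else 0 := by
    ext c d
    by_cases h : t a ≤ t b
    · rw [if_pos h]
      by_cases hcd : a = c ∧ b = d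
      · obtain ⟨rfl, rfl⟩ := hcd
        simp [mask, h]
      · simp [mask, Matrix.single_apply, hcd]
    · rw [if_neg h]
      by_cases hcd : a = c ∧ b = d
      · obtain ⟨rfl, rfl⟩ := hcd
        simp [mask, h]
      · simp [mask, Matrix.single_apply, hcd]
  rw [LinearMap.comp_apply, hmask]
  by_cases h : t a ≤ t b
  · rw [if_pos h, if_pos h]
    change (e * Matrix.single a b (1:ℂ) * (1 - e) + (1 - e) * Matrix.single a b (1:ℂ) * e : Matrix (Fin n) (Fin n) ℂ) a b = _
    simp [Matrix.mul_apply, Matrix.single_apply, Matrix.sub_apply, ite_and]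
  · rw [if_neg h, if_neg h]
    simp

lemma finrank_OO2 {n : ℕ} (t : Fin n → ℕ) (e : Matrix (Fin n) (Fin n) ℂ) (he : e * e = e)
    (hep : e ∈ pp t) :
    (Module.finrank ℂ (OO t e) : ℂ) =
      (∑ a, e a a) * (∑ a, (1 - e a a)) + ∑ k ∈ Finset.univ.image t,
        (∑ a : {a // t a = k}, e a a) * (∑ a : {a // t a = k}, (1 - e a a)) := by
  have h := finrank_OO t e he hep
  set x : Fin n → ℂ := fun a => e a a with hx
  have h' : (Module.finrank ℂ (OO t e) : ℂ) =
      ∑ a, ∑ b, if t b ≤ t a then (x b * (1 - x a) + (1 - x b) * x a) else 0 := by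
    rw [h, Finset.sum_comm]
  have e1 : (∑ a, ∑ b, (x a * (1 - x b) + (1 - x a) * x b)) = 2 * ((∑ a, x a) * (∑ a, (1 - x a))) := by
    simp only [Finset.sum_add_distrib, ← Finset.sum_mul_sum]
    ring
  have e2 : (∑ a, ∑ b, if t a = t b then (x a * (1 - x b) + (1 - x a) * x b) else 0) =
      2 * ∑ k ∈ Finset.univ.image t,
        (∑ a : {a // t a = k}, x a) * (∑ a : {a // t a = k}, (1 - x a)) := by
    rw [sum_fiber t, Finset.mul_sum]
    refine Finset.sum_congr rfl fun k _ => ?_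
    have : ∀ a : {a // t a = k}, (∑ b, if t a = t b then (x a * (1 - x b) + (1 - x a) * x b) else 0) =
        ∑ b : {a // t a = k}, (x a * (1 - x b) + (1 - x a) * x b) := by
      intro a
      rw [← Finset.sum_filter, Finset.sum_subtype (Finset.univ.filter fun c => t a = t c) (p := fun c => t c = k)]
      intro c
      have := a.2
      simp only [Finset.mem_filter, Finset.mem_univ, true_and]
      omega
    simp only [this, Finset.sum_add_distrib, ← Finset.sum_mul_sum]
    ring
  have key : 2 * (Module.finrank ℂ (OO t e) : ℂ) = 
      (∑ a, ∑ b, (x a * (1 - x b) + (1 - x a) * x b)) +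
      (∑ a, ∑ b, if t a = t b then (x a * (1 - x b) + (1 - x a) * x b) else 0) := by
    rw [two_mul]
    nth_rw 1 [h]
    rw [h']
    simp only [← Finset.sum_add_distrib]
    refine Finset.sum_congr rfl fun a _ => Finset.sum_congr rfl fun b _ => ?_
    rcases lt_trichotomy (t a) (t b) with h | h | h
    · rw [if_pos h.le, if_neg (by omega), if_neg (by omega)]
    · rw [if_pos h.le, if_pos h.ge, if_pos h]; ring
    · rw [if_neg (by omega), if_pos h.le, if_neg (by omega)]; ring
  rw [e1, e2, ← mul_add] at key
  exact mul_left_cancel₀ two_ne_zero key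

lemma finrank_OO3 {n : ℕ} (t : Fin n → ℕ) (e : Matrix (Fin n) (Fin n) ℂ) (he : e * e = e)
    (hep : e ∈ pp t) : ∃ A B : ℕ → ℕ, (∀ k, A k + B k = Fintype.card {a // t a = k}) ∧
      (∀ k, (e.toSquareBlock t k).trace = A k) ∧
      e.trace = (∑ k ∈ Finset.univ.image t, A k : ℕ) ∧
      (∑ k ∈ Finset.univ.image t, A k) + (∑ k ∈ Finset.univ.image t, B k) = n ∧
      Module.finrank ℂ (OO t e) = (∑ k ∈ Finset.univ.image t, A k) * (∑ k ∈ Finset.univ.image t, B k)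
        + ∑ k ∈ Finset.univ.image t, A k * B k := by
  have he1 : (1 - e) ∈ pp t := sub_mem one_mem_pp hep
  have hee : (1 - e) * (1 - e) = 1 - e := by
    rw [mul_sub, sub_mul, sub_mul, he]; simp
  have hA : ∀ k, ∃ r : ℕ, (e.toSquareBlock t k).trace = r := fun k =>
    idem_trace _ (by rw [← block_mul hep hep, he])
  have hB : ∀ k, ∃ r : ℕ, ((1 - e).toSquareBlock t k).trace = r := fun k =>
    idem_trace _ (by rw [← block_mul he1 he1, hee])
  choose A hA using hA
  choose B hB using hB
  have hA' : ∀ k, ∑ a : {a // t a = k}, e a a = A k := fun k => by rw [← hA]; rfl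
  have hB' : ∀ k, ∑ a : {a // t a = k}, (1 - e a a) = B k := fun k => by
    rw [← hB]; simp [Matrix.trace, Matrix.toSquareBlock_def]
  have hAB : ∀ k, A k + B k = Fintype.card {a // t a = k} := by
    intro k
    have : ((A k + B k : ℕ) : ℂ) = (Fintype.card {a // t a = k} : ℕ) := by
      push_cast
      rw [← hA', ← hB', ← Finset.sum_add_distrib]
      simp
    exact_mod_cast this
  have hsA : (∑ a, e a a) = (∑ k ∈ Finset.univ.image t, A k : ℕ) := by
    rw [sum_fiber t]; push_cast
    exact Finset.sum_congr rfl fun k _ => hA' k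
  have hsB : (∑ a, (1 - e a a)) = (∑ k ∈ Finset.univ.image t, B k : ℕ) := by
    rw [sum_fiber t]; push_cast
    exact Finset.sum_congr rfl fun k _ => hB' k
  refine ⟨A, B, hAB, hA, hsA, ?_, ?_⟩
  · have : ((∑ k ∈ Finset.univ.image t, A k + ∑ k ∈ Finset.univ.image t, B k : ℕ) : ℂ) = n := by
      rw [Nat.cast_add, ← hsA, ← hsB, ← Finset.sum_add_distrib]
      simp
    exact_mod_cast this
  · have := finrank_OO2 t e he hep
    rw [hsA, hsB] at this
    simp only [hA', hB'] at this
    exact_mod_cast this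

lemma map_derivation_mul {n : ℕ} (δ : Derivation ℚ ℂ ℂ) (A B : Matrix (Fin n) (Fin n) ℂ) :
    (A * B).map δ = A.map δ * B + A * B.map δ := by
  ext a b
  simp only [Matrix.map_apply, Matrix.mul_apply, Matrix.add_apply, map_sum, Derivation.leibniz,
    ← Finset.sum_add_distrib, smul_eq_mul]
  refine Finset.sum_congr rfl fun c _ => by ring

lemma idem_off {R : Type*} [Ring R] {e w : R} (he : e * e = e) (hw : e * w + w * e = w) :
    e * w * e = 0 := by
  have := congrArg (fun z => e * z) hw
  simp only [mul_add, ← mul_assoc, he] at this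
  simpa using this

lemma count_ineq {q n : ℕ} (t : Fin q → Fin n → ℕ) (g : Fin q → (Matrix (Fin n) (Fin n) ℂ)ˣ)
    (hg : ∀ G : Fin q → Matrix (Fin n) (Fin n) ℂ, ∃ δ : Derivation ℚ ℂ ℂ, ∀ j, ((g j).val).map δ = G j)
    (e : Matrix (Fin n) (Fin n) ℂ) (he : e * e = e)
    (hp : ∀ j, ((g j)⁻¹).val * e * (g j).val ∈ pp (t j)) :
    ∑ j, Module.finrank ℂ (OO (fun _ => 0) (((g j)⁻¹).val * e * (g j).val)) ≤
      Module.finrank ℂ (OO (fun _ => 0) e) +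
        ∑ j, Module.finrank ℂ (OO (t j) (((g j)⁻¹).val * e * (g j).val)) := by
  set f : Fin q → Matrix (Fin n) (Fin n) ℂ := fun j => ((g j)⁻¹).val * e * (g j).val with hf
  have hgi : ∀ j, (g j).val * ((g j)⁻¹).val = 1 := fun j => (g j).mul_inv
  have hig : ∀ j, ((g j)⁻¹).val * (g j).val = 1 := fun j => (g j).inv_mul
  have hff : ∀ j, f j * f j = f j := by
    intro j
    calc f j * f j = ((g j)⁻¹).val * e * ((g j).val * ((g j)⁻¹).val) * e * (g j).val := by
          simp only [hf, mul_assoc]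
      _ = ((g j)⁻¹).val * (e * e) * (g j).val := by rw [hgi]; simp only [mul_one, mul_assoc]
      _ = f j := by rw [he]
  have hegf : ∀ j, e * (g j).val = (g j).val * f j := by
    intro j
    calc e * (g j).val = ((g j).val * ((g j)⁻¹).val) * e * (g j).val := by rw [hgi, one_mul]
      _ = _ := by simp only [hf, mul_assoc]
  let F : ((OO (fun _ => 0) e) × (∀ j, OO (t j) (f j))) →ₗ[ℂ] (∀ j, OO (fun _ => 0) (f j)) :=
    { toFun := fun x j => ⟨(x.2 j).1 - ((g j)⁻¹).val * x.1.1 * (g j).val, by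
        refine sub_mem ⟨fun a b h => (lt_irrefl _ h).elim, (x.2 j).2.2⟩
          ⟨fun a b h => (lt_irrefl _ h).elim, ?_⟩
        calc f j * (((g j)⁻¹).val * x.1.1 * (g j).val) + (((g j)⁻¹).val * x.1.1 * (g j).val) * f j
            = ((g j)⁻¹).val * e * ((g j).val * ((g j)⁻¹).val) * x.1.1 * (g j).val +
              ((g j)⁻¹).val * x.1.1 * ((g j).val * ((g j)⁻¹).val) * e * (g j).val := by
              simp only [hf, mul_assoc]
          _ = ((g j)⁻¹).val * (e * x.1.1 + x.1.1 * e) * (g j).val := by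
              rw [hgi]; simp only [mul_one, mul_add, add_mul, mul_assoc]
          _ = _ := by rw [x.1.2.2]⟩
      map_add' := fun x y => by
        funext j; apply Subtype.ext
        simp only [Prod.fst_add, Prod.snd_add, Pi.add_apply, Submodule.coe_add]
        noncomm_ring
      map_smul' := fun c x => by
        funext j; apply Subtype.ext
        simp [smul_sub] }
  have hF : Function.Surjective F := by
    intro w
    obtain ⟨δ, hδ⟩ := hg (fun j => (g j).val * (f j * (w j).1 - (w j).1 * f j))
    have hidem : ∀ x : Matrix (Fin n) (Fin n) ℂ, x * x = x → x * x.map δ + x.map δ * x = x.map δ := by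
      intro x hx
      have := map_derivation_mul δ x x
      rw [hx] at this
      rw [add_comm]; exact this.symm
    refine ⟨⟨⟨e.map δ, fun a b h => (lt_irrefl _ h).elim, hidem e he⟩, fun j =>
      ⟨(f j).map δ, fun a b h => (congrArg δ (hp j a b h)).trans (map_zero δ), hidem _ (hff j)⟩⟩, ?_⟩
    funext j
    apply Subtype.ext
    change (f j).map δ - ((g j)⁻¹).val * e.map δ * (g j).val = (w j).1
    have h1 := congrArg (fun x : Matrix (Fin n) (Fin n) ℂ => ((g j)⁻¹).val * x.map δ) (hegf j)
    simp only [map_derivation_mul, hδ] at h1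
    have hw := (w j).2.2
    have h0 := idem_off (hff j) hw
    have hl : ((g j)⁻¹).val * (e.map δ * (g j).val + e * ((g j).val * (f j * (w j).1 - (w j).1 * f j)))
        = ((g j)⁻¹).val * e.map δ * (g j).val + f j * (f j * (w j).1 - (w j).1 * f j) := by
      simp only [hf, mul_add, mul_assoc]
    have hr : ((g j)⁻¹).val * ((g j).val * (f j * (w j).1 - (w j).1 * f j) * f j + (g j).val * (f j).map δ)
        = (f j * (w j).1 - (w j).1 * f j) * f j + (f j).map δ := by
      have hc : ∀ M : Matrix (Fin n) (Fin n) ℂ, ((g j)⁻¹).val * ((g j).val * M) = M := fun M => by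
        rw [← mul_assoc, hig, one_mul]
      rw [mul_add, mul_assoc (g j).val, hc, hc]
    rw [hl, hr] at h1
    have h2 : f j * (f j * (w j).1 - (w j).1 * f j) - (f j * (w j).1 - (w j).1 * f j) * f j = (w j).1 := by
      rw [mul_sub, sub_mul, ← mul_assoc, hff, ← mul_assoc, h0, mul_assoc (w j).1, hff]
      rw [sub_zero, zero_sub, sub_neg_eq_add, hw]
    rw [← h2]
    rw [sub_eq_sub_iff_add_eq_add]
    rw [add_comm, ← h1, add_comm]
  have := LinearMap.finrank_le_finrank_of_surjective hF
  rw [Module.finrank_prod, Module.finrank_pi_fintype, Module.finrank_pi_fintype] at this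
  exact this

lemma arith_eq {q n κ μ : ℕ} (hn : κ + μ = n) (s : Fin q → Finset ℕ) (r : Fin q → ℕ)
    (A B : Fin q → ℕ → ℕ) (hA : ∀ j, ∑ k ∈ s j, A j k = κ) (hB : ∀ j, ∑ k ∈ s j, B j k = μ)
    (hr : 2 * n ≤ ∑ j, r j) (hc : ∀ j k, A j k + B j k + r j ≤ n)
    (hineq : ∑ _j : Fin q, 2 * (κ * μ) ≤ 2 * (κ * μ) + ∑ j, (κ * μ + ∑ k ∈ s j, A j k * B j k)) :
    ∀ j, ∀ k ∈ s j, μ * A j k = κ * B j k := by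
  have hA' : ∀ j, ∑ k ∈ s j, (A j k : ℤ) = κ := fun j => by rw [← hA j]; push_cast; rfl
  have hB' : ∀ j, ∑ k ∈ s j, (B j k : ℤ) = μ := fun j => by rw [← hB j]; push_cast; rfl
  have hr' : 2 * (n : ℤ) ≤ ∑ j, (r j : ℤ) := by exact_mod_cast hr
  have hc' : ∀ j k, (A j k : ℤ) + B j k + r j ≤ n := fun j k => by exact_mod_cast hc j k
  have hn' : (κ : ℤ) + μ = n := by exact_mod_cast hn
  have hi : (q : ℤ) * (κ * μ) ≤ 2 * (κ * μ) + ∑ j, ∑ k ∈ s j, (A j k : ℤ) * B j k := by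
    have : (∑ _j : Fin q, 2 * (κ * μ) : ℤ) ≤ 2 * (κ * μ) + ∑ j, (κ * μ + ∑ k ∈ s j, (A j k : ℤ) * B j k) := by
      exact_mod_cast hineq
    simp only [Finset.sum_const, Finset.sum_add_distrib, Finset.card_univ, Fintype.card_fin, nsmul_eq_mul] at this
    linarith
  let D : Fin q → ℕ → ℤ := fun j k => ((n : ℤ) - r j - (A j k + B j k)) * ((μ : ℤ) ^ 2 * A j k + (κ : ℤ) ^ 2 * B j k)
    + ((μ : ℤ) * A j k - κ * B j k) ^ 2
  have hD0 : ∀ j k, 0 ≤ ((n : ℤ) - r j - (A j k + B j k)) * ((μ : ℤ) ^ 2 * A j k + (κ : ℤ) ^ 2 * B j k) := by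
    intro j k
    apply mul_nonneg
    · linarith [hc' j k]
    · positivity
  have hD : ∀ j k, 0 ≤ D j k := fun j k => add_nonneg (hD0 j k) (sq_nonneg _)
  have hDe : ∀ j k, D j k = ((n : ℤ) - r j) * ((μ : ℤ) ^ 2 * A j k + (κ : ℤ) ^ 2 * B j k) - (n : ℤ) ^ 2 * (A j k * B j k) := by
    intro j k
    simp only [D]
    rw [← hn']; ring
  have hs : ∀ j, ∑ k ∈ s j, D j k = ((n : ℤ) - r j) * (κ * μ * n) - (n : ℤ) ^ 2 * ∑ k ∈ s j, (A j k : ℤ) * B j k := by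
    intro j
    simp only [hDe, Finset.sum_sub_distrib, ← Finset.mul_sum, Finset.sum_add_distrib, hA', hB']
    rw [← hn']; ring
  have htot : ∑ j, ∑ k ∈ s j, D j k ≤ 0 := by
    simp only [hs, Finset.sum_sub_distrib, ← Finset.mul_sum, ← Finset.sum_mul, Finset.sum_const,
      Finset.card_univ, Fintype.card_fin, nsmul_eq_mul]
    have h1 : (0 : ℤ) ≤ κ * μ * n := by positivity
    have h2 : (0 : ℤ) ≤ (n : ℤ) ^ 2 := by positivity
    nlinarith [mul_le_mul_of_nonneg_right hr' h1, mul_le_mul_of_nonneg_left hi h2]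
  have hz := (Finset.sum_eq_zero_iff_of_nonneg (fun j _ => Finset.sum_nonneg fun k _ => hD j k)).1
    (le_antisymm htot (Finset.sum_nonneg fun j _ => Finset.sum_nonneg fun k _ => hD j k))
  intro j k hk
  have h3 := (Finset.sum_eq_zero_iff_of_nonneg (fun k _ => hD j k)).1 (hz j (Finset.mem_univ _)) k hk
  have h4 : ((μ : ℤ) * A j k - κ * B j k) ^ 2 = 0 := by
    have := hD0 j k
    simp only [D] at h3
    nlinarith [sq_nonneg ((μ : ℤ) * A j k - κ * B j k)]
  have h5 := pow_eq_zero_iff (two_ne_zero) |>.1 h4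
  have : (μ : ℤ) * A j k = κ * B j k := by linarith
  exact_mod_cast this

lemma no_idempotent {q n : ℕ} (t : Fin q → Fin n → ℕ) (g : Fin q → (Matrix (Fin n) (Fin n) ℂ)ˣ)
    (hg : ∀ G : Fin q → Matrix (Fin n) (Fin n) ℂ, ∃ δ : Derivation ℚ ℂ ℂ, ∀ j, ((g j).val).map δ = G j)
    (ξ : Fin q → ℕ → ℂ) (r : Fin q → ℕ)
    (hcard : ∀ j k, Fintype.card {a // t j a = k} + r j ≤ n) (hr : 2 * n ≤ ∑ j, r j)
    (htr : ∑ j, ∑ a, ξ j (t j a) = 0)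
    (hgen : ∀ κ, 1 ≤ κ → κ ≤ n - 1 → ∀ A : Fin q → ℕ → ℕ,
      (∀ j k, A j k ≤ Fintype.card {a // t j a = k}) →
      (∀ j, ∑ k ∈ Finset.univ.image (t j), A j k = κ) →
      ∑ j, ∑ k ∈ Finset.univ.image (t j), A j k * ξ j k ≠ 0)
    (e : Matrix (Fin n) (Fin n) ℂ) (he : e * e = e)
    (hp : ∀ j, ((g j)⁻¹).val * e * (g j).val ∈ pp (t j)) : e = 0 ∨ e = 1 := by
  rcases Nat.eq_zero_or_pos n with hn0 | hn0
  · subst hn0; left; exact Subsingleton.elim _ _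
  have hee : (1 - e) * (1 - e) = 1 - e := by
    rw [mul_sub, sub_mul, sub_mul, he]; simp
  obtain ⟨κ, hκ⟩ := idem_trace e he
  obtain ⟨μ, hμ⟩ := idem_trace _ hee
  have hκμ : κ + μ = n := by
    have : ((κ + μ : ℕ) : ℂ) = n := by
      push_cast; rw [← hκ, ← hμ, Matrix.trace_sub]; simp
    exact_mod_cast this
  by_contra hcon
  push Not at hcon
  have hκ0 : κ ≠ 0 := by
    rintro rfl
    exact hcon.1 (idem_trace_zero e he (by simpa using hκ))
  have hμ0 : μ ≠ 0 := by
    rintro rfl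
    exact hcon.2 (sub_eq_zero.1 (idem_trace_zero _ hee (by simpa using hμ))).symm
  have hfe : ∀ f : Matrix (Fin n) (Fin n) ℂ, f * f = f → f.trace = κ →
      Module.finrank ℂ (OO (fun _ => 0) f) = 2 * (κ * μ) := by
    intro f hf htf
    obtain ⟨A, B, h1, h2, h3, h4, h5⟩ := finrank_OO3 (fun _ => 0) f hf (fun a b h => (lt_irrefl _ h).elim)
    have : Nonempty (Fin n) := ⟨⟨0, hn0⟩⟩
    have him : Finset.univ.image (fun _ : Fin n => 0) = {0} := by
      rw [Finset.image_const Finset.univ_nonempty]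
    rw [him] at h3 h4 h5
    simp only [Finset.sum_singleton] at h3 h4 h5
    have hA : A 0 = κ := by rw [htf] at h3; exact_mod_cast h3.symm
    have hB : B 0 = μ := by omega
    rw [h5, hA, hB]; ring
  have hgi : ∀ j, (g j).val * ((g j)⁻¹).val = 1 := fun j => (g j).mul_inv
  have hff : ∀ j, (((g j)⁻¹).val * e * (g j).val) * (((g j)⁻¹).val * e * (g j).val) = ((g j)⁻¹).val * e * (g j).val := by
    intro j
    calc _ = ((g j)⁻¹).val * e * ((g j).val * ((g j)⁻¹).val) * e * (g j).val := by
          simp only [mul_assoc]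
      _ = ((g j)⁻¹).val * (e * e) * (g j).val := by rw [hgi]; simp only [mul_one, mul_assoc]
      _ = _ := by rw [he]
  have hft : ∀ j, (((g j)⁻¹).val * e * (g j).val).trace = κ := by
    intro j
    rw [Matrix.trace_mul_comm, ← mul_assoc, hgi, one_mul, hκ]
  have hci := count_ineq t g hg e he hp
  rw [hfe e he hκ] at hci
  simp only [hfe _ (hff _) (hft _)] at hci
  choose A B h1 h2 h3 h4 h5 using fun j => finrank_OO3 (t j) _ (hff j) (hp j)
  have hA : ∀ j, ∑ k ∈ Finset.univ.image (t j), A j k = κ := by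
    intro j
    have := h3 j
    rw [hft] at this
    exact_mod_cast this.symm
  have hB : ∀ j, ∑ k ∈ Finset.univ.image (t j), B j k = μ := by
    intro j
    have := h4 j
    rw [hA] at this
    omega
  simp only [h5, hA, hB] at hci
  have heq := arith_eq hκμ (fun j => Finset.univ.image (t j)) r A B hA hB hr
    (fun j k => by rw [h1]; exact hcard j k) hci
  refine hgen κ (by omega) (by omega) A (fun j k => by rw [← h1]; omega) hA ?_
  have hn : (n : ℂ) ≠ 0 := by exact_mod_cast hn0.ne'
  apply mul_left_cancel₀ hn
  rw [mul_zero, Finset.mul_sum]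
  have : ∀ j, (n : ℂ) * ∑ k ∈ Finset.univ.image (t j), (A j k : ℂ) * ξ j k = κ * ∑ a, ξ j (t j a) := by
    intro j
    rw [sum_fiber (t j), Finset.mul_sum, Finset.mul_sum]
    refine Finset.sum_congr rfl fun k hk => ?_
    have h6 : ∑ a : {a // t j a = k}, ξ j (t j a) = (Fintype.card {a // t j a = k} : ℂ) * ξ j k := by
      rw [Finset.sum_congr rfl (fun a _ => by rw [a.2])]
      simp
    rw [h6, ← h1 j k, ← mul_assoc, ← mul_assoc]
    congr 1
    have h7 : n * A j k = κ * (A j k + B j k) := by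
      rw [mul_add, ← heq j k hk, ← hκμ]; ring
    exact_mod_cast h7
  simp only [this]
  rw [← Finset.mul_sum, htr, mul_zero]

lemma scalar_add_nilpotent {n : ℕ} (f : Matrix (Fin n) (Fin n) ℂ)
    (h : ∀ p : Polynomial ℂ, Polynomial.aeval f p * Polynomial.aeval f p = Polynomial.aeval f p →
      Polynomial.aeval f p = 0 ∨ Polynomial.aeval f p = 1) :
    ∃ c : ℂ, IsNilpotent (f - c • (1 : Matrix (Fin n) (Fin n) ℂ)) := by
  open Polynomial in
  rcases Nat.eq_zero_or_pos n with hn0 | hn0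
  · subst hn0; exact ⟨0, 1, Subsingleton.elim _ _⟩
  have hne : Nonempty (Fin n) := ⟨⟨0, hn0⟩⟩
  obtain ⟨c, hc⟩ := IsAlgClosed.exists_root f.charpoly (by
    rw [Matrix.charpoly_degree_eq_dim]; simp; omega)
  have hch0 : f.charpoly ≠ 0 := (Matrix.charpoly_monic f).ne_zero
  obtain ⟨q, hq, hnd⟩ := Polynomial.exists_eq_pow_rootMultiplicity_mul_and_not_dvd f.charpoly hch0 c
  set m := f.charpoly.rootMultiplicity c with hm
  have hm0 : m ≠ 0 := by
    rw [hm]; exact ((Polynomial.rootMultiplicity_pos hch0).2 hc).ne'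
  have hcop : IsCoprime ((X - C c) ^ m) q := by
    apply IsCoprime.pow_left
    exact ((Polynomial.irreducible_X_sub_C c).coprime_iff_not_dvd).2 hnd
  obtain ⟨u, v, huv⟩ := hcop
  have hCH := Matrix.aeval_self_charpoly f
  have hsum : aeval f (u * (X - C c) ^ m) + aeval f (v * q) = 1 := by
    rw [← map_add, huv, map_one]
  have hprod : aeval f (v * q) * aeval f (u * (X - C c) ^ m) = 0 := by
    rw [← map_mul, show v * q * (u * (X - C c) ^ m) = (v * u) * ((X - C c) ^ m * q) by ring, ← hq,
      map_mul, hCH, mul_zero]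
  have hfc : aeval f (X - C c) = f - c • (1 : Matrix (Fin n) (Fin n) ℂ) := by
    rw [map_sub, aeval_X, aeval_C, Algebra.algebraMap_eq_smul_one]
  refine ⟨c, m, ?_⟩
  rcases h (v * q) (by
    have := congrArg (fun z => aeval f (v * q) * z) hsum
    simp only [mul_add, hprod, zero_add, mul_one] at this
    exact this) with h0 | h1
  · exfalso
    rw [h0, add_zero] at hsum
    obtain ⟨k, hk⟩ := Nat.exists_eq_succ_of_ne_zero hm0
    rw [hk, pow_succ, ← mul_assoc, map_mul, hfc] at hsum
    have hd := congrArg Matrix.det hsum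
    rw [Matrix.det_mul, Matrix.det_one] at hd
    have hdet : (f - c • (1 : Matrix (Fin n) (Fin n) ℂ)).det = 0 := by
      have h2 : f.charpoly.eval c = 0 := hc
      rw [Matrix.eval_charpoly] at h2
      rw [← neg_sub, Matrix.det_neg]
      have : (Matrix.scalar (Fin n)) c = c • (1 : Matrix (Fin n) (Fin n) ℂ) := by
        rw [Matrix.smul_one_eq_diagonal]; rfl
      rw [← this, h2, mul_zero]
    rw [hdet, mul_zero] at hd
    exact zero_ne_one hd
  · have h3 : (f - c • (1 : Matrix (Fin n) (Fin n) ℂ)) ^ m * aeval f q = 0 := by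
      rw [← hfc, ← map_pow, ← map_mul, ← hq, hCH]
    calc (f - c • (1 : Matrix (Fin n) (Fin n) ℂ)) ^ m
        = (f - c • (1 : Matrix (Fin n) (Fin n) ℂ)) ^ m * aeval f (v * q) := by rw [h1, mul_one]
      _ = (f - c • (1 : Matrix (Fin n) (Fin n) ℂ)) ^ m * aeval f q * aeval f v := by
          rw [mul_comm v q, map_mul, mul_assoc]
      _ = 0 := by rw [h3, zero_mul]

lemma block_one {n : ℕ} (t : Fin n → ℕ) (k : ℕ) :
    (1 : Matrix (Fin n) (Fin n) ℂ).toSquareBlock t k = 1 := by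
  ext a b
  simp [Matrix.toSquareBlock_def, Matrix.one_apply, Subtype.ext_iff]

lemma pp_pow {n : ℕ} {t : Fin n → ℕ} {X : Matrix (Fin n) (Fin n) ℂ} (hX : X ∈ pp t) (m : ℕ) :
    X ^ m ∈ pp t := by
  induction m with
  | zero => rw [pow_zero]; exact one_mem_pp
  | succ m ih => rw [pow_succ]; exact pp_mul ih hX

lemma block_pow {n : ℕ} {t : Fin n → ℕ} {X : Matrix (Fin n) (Fin n) ℂ} (hX : X ∈ pp t) (k m : ℕ) :
    (X ^ m).toSquareBlock t k = (X.toSquareBlock t k) ^ m := by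
  induction m with
  | zero => rw [pow_zero, pow_zero, block_one]
  | succ m ih => rw [pow_succ, pow_succ, block_mul (pp_pow hX m) hX, ih]

lemma nilp_block_trace {n : ℕ} (t : Fin n → ℕ) (ξ : ℕ → ℂ) (f : Matrix (Fin n) (Fin n) ℂ)
    (hf : f ∈ pp t) (c : ℂ) (hc : IsNilpotent (f - c • (1 : Matrix (Fin n) (Fin n) ℂ))) :
    ∑ a, f a a * ξ (t a) = c * ∑ a, ξ (t a) := by
  have hν : f - c • (1 : Matrix (Fin n) (Fin n) ℂ) ∈ pp t :=
    sub_mem hf (Submodule.smul_mem _ _ one_mem_pp)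
  obtain ⟨m, hm⟩ := hc
  rw [sum_fiber t, sum_fiber t, Finset.mul_sum]
  refine Finset.sum_congr rfl fun k _ => ?_
  have h1 : IsNilpotent ((f - c • (1 : Matrix (Fin n) (Fin n) ℂ)).toSquareBlock t k) :=
    ⟨m, by rw [← block_pow hν, hm]; rfl⟩
  have h2 := (Matrix.isNilpotent_trace_of_isNilpotent h1).eq_zero
  have h3 : ∑ a : {a // t a = k}, (f a a - c) = 0 := by
    rw [← h2]
    simp [Matrix.trace, Matrix.toSquareBlock_def]
  calc ∑ a : {a // t a = k}, f a a * ξ (t a) = ∑ a : {a // t a = k}, ((f a a - c) * ξ k + c * ξ (t a)) := by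
        refine Finset.sum_congr rfl fun a _ => ?_
        rw [a.2]; ring
    _ = _ := by rw [Finset.sum_add_distrib, ← Finset.sum_mul, h3, zero_mul, zero_add, Finset.mul_sum]

lemma exists_trace_form {n : ℕ} (φ : Matrix (Fin n) (Fin n) ℂ →ₗ[ℂ] ℂ) :
    ∃ f : Matrix (Fin n) (Fin n) ℂ, ∀ x, φ x = (f * x).trace := by
  refine ⟨Matrix.of fun b a => φ (Matrix.single a b 1), fun x => ?_⟩
  conv_lhs => rw [Matrix.matrix_eq_sum_single x]
  simp only [map_sum, Matrix.trace, Matrix.diag_apply, Matrix.mul_apply, Matrix.of_apply]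
  rw [Finset.sum_comm]
  refine Finset.sum_congr rfl fun a _ => Finset.sum_congr rfl fun b _ => ?_
  rw [show Matrix.single b a (x b a) = x b a • Matrix.single b a (1 : ℂ) by simp, map_smul, smul_eq_mul, mul_comm]

lemma mem_pp_of_trace {n : ℕ} {t : Fin n → ℕ} {Z : Matrix (Fin n) (Fin n) ℂ}
    (h : ∀ u ∈ uu t, (Z * u).trace = 0) : Z ∈ pp t := by
  intro a b hab
  have := h (Matrix.single b a 1) (fun c d hcd => by
    rw [Matrix.single_apply, if_neg]
    rintro ⟨rfl, rfl⟩; omega)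
  rw [Matrix.trace_mul_single] at this
  simpa using this

lemma linear_step {q n : ℕ} (t : Fin q → Fin n → ℕ) (g : Fin q → (Matrix (Fin n) (Fin n) ℂ)ˣ)
    (ξ : Fin q → ℕ → ℂ) (N : Fin q → Matrix (Fin n) (Fin n) ℂ)
    (hN : ∀ j, N j - diagonal (fun a => ξ j (t j a)) ∈ uu (t j))
    (htr : ∑ j, ∑ a, ξ j (t j a) = 0)
    (hid : ∀ e : Matrix (Fin n) (Fin n) ℂ, e * e = e →
      (∀ j, ((g j)⁻¹).val * e * (g j).val ∈ pp (t j)) → e = 0 ∨ e = 1) :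
    ∃ u : Fin q → Matrix (Fin n) (Fin n) ℂ, (∀ j, u j ∈ uu (t j)) ∧
      ∑ j, (g j).val * (N j + u j) * ((g j)⁻¹).val = 0 := by
  have hgi : ∀ j, (g j).val * ((g j)⁻¹).val = 1 := fun j => (g j).mul_inv
  have hig : ∀ j, ((g j)⁻¹).val * (g j).val = 1 := fun j => (g j).inv_mul
  let L : (∀ j, uu (t j)) →ₗ[ℂ] Matrix (Fin n) (Fin n) ℂ :=
    { toFun := fun u => ∑ j, (g j).val * (u j).1 * ((g j)⁻¹).val
      map_add' := fun u v => by
        simp [mul_add, add_mul, Finset.sum_add_distrib]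
      map_smul' := fun c u => by
        simp [Finset.smul_sum] }
  set M : Matrix (Fin n) (Fin n) ℂ := ∑ j, (g j).val * N j * ((g j)⁻¹).val with hM
  suffices hmem : M ∈ LinearMap.range L by
    obtain ⟨u, hu⟩ := hmem
    refine ⟨fun j => -(u j).1, fun j => neg_mem (u j).2, ?_⟩
    simp only [mul_add, add_mul, Finset.sum_add_distrib, mul_neg, neg_mul, Finset.sum_neg_distrib]
    rw [← hM, ← hu]
    exact add_neg_cancel _
  by_contra hcon
  obtain ⟨φ, hφM, hφ⟩ := Submodule.exists_le_ker_of_notMem hcon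
  obtain ⟨f, hf⟩ := exists_trace_form φ
  have hcyc : ∀ j x, (f * ((g j).val * x * ((g j)⁻¹).val)).trace = ((((g j)⁻¹).val * f * (g j).val) * x).trace := by
    intro j x
    rw [← mul_assoc, Matrix.trace_mul_comm, mul_assoc, mul_assoc]
  have hfp : ∀ j, ((g j)⁻¹).val * f * (g j).val ∈ pp (t j) := by
    intro j
    apply mem_pp_of_trace
    intro u hu
    have h1 : L (Pi.single j ⟨u, hu⟩) = (g j).val * u * ((g j)⁻¹).val := by
      change ∑ i, (g i).val * ((Pi.single j (⟨u, hu⟩ : uu (t j)) : ∀ i, uu (t i)) i).1 * ((g i)⁻¹).val = _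
      rw [Finset.sum_eq_single j]
      · simp
      · intro i _ hij
        rw [Pi.single_eq_of_ne hij]; simp
      · simp
    rw [← hcyc, ← h1, ← hf]
    exact hφ ⟨_, rfl⟩
  have hpoly : ∀ p : Polynomial ℂ, ∀ j, ((g j)⁻¹).val * Polynomial.aeval f p * (g j).val ∈ pp (t j) := by
    intro p j
    have hpow : ∀ m : ℕ, ((g j)⁻¹).val * f ^ m * (g j).val = (((g j)⁻¹).val * f * (g j).val) ^ m := by
      intro m
      induction m with
      | zero => simp
      | succ m ih =>
        rw [pow_succ, pow_succ, ← ih]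
        calc _ = ((g j)⁻¹).val * f ^ m * ((g j).val * ((g j)⁻¹).val) * f * (g j).val := by
              rw [hgi, mul_one]; simp only [mul_assoc]
          _ = _ := by simp only [mul_assoc]
    rw [Polynomial.aeval_eq_sum_range, Finset.mul_sum, Finset.sum_mul]
    refine Submodule.sum_mem _ fun i _ => ?_
    rw [mul_smul_comm, smul_mul_assoc, hpow]
    exact Submodule.smul_mem _ _ (pp_pow (hfp j) i)
  obtain ⟨c, hc⟩ := scalar_add_nilpotent f fun p hp => hid _ hp (hpoly p)
  apply hφM
  rw [hf, hM, Finset.mul_sum, Matrix.trace_sum]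
  have hj : ∀ j, (f * ((g j).val * N j * ((g j)⁻¹).val)).trace = c * ∑ a, ξ j (t j a) := by
    intro j
    rw [hcyc]
    set F := ((g j)⁻¹).val * f * (g j).val with hF
    have hFc : IsNilpotent (F - c • (1 : Matrix (Fin n) (Fin n) ℂ)) := by
      obtain ⟨m, hm⟩ := hc
      refine ⟨m, ?_⟩
      have h1 : F - c • (1 : Matrix (Fin n) (Fin n) ℂ) = ((g j)⁻¹).val * (f - c • (1 : Matrix (Fin n) (Fin n) ℂ)) * (g j).val := by
        rw [mul_sub, sub_mul, mul_smul_comm, smul_mul_assoc, mul_one, hig]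
      have h2 := Units.conj_pow' (g j) (f - c • (1 : Matrix (Fin n) (Fin n) ℂ)) m
      rw [h1, h2, hm]; simp
    rw [← nilp_block_trace (t j) (ξ j) F (hfp j) c hFc]
    have h3 : N j = diagonal (fun a => ξ j (t j a)) + (N j - diagonal (fun a => ξ j (t j a))) := by abel
    rw [h3, mul_add, Matrix.trace_add, trace_uu (pp_mul_uu (hfp j) (hN j)), add_zero]
    simp [Matrix.trace, Matrix.mul_diagonal]
  simp only [hj]
  rw [← Finset.mul_sum, htr, mul_zero]

lemma charpoly_pp {n : ℕ} (t : Fin n → ℕ) (ξ : ℕ → ℂ) (N : Matrix (Fin n) (Fin n) ℂ)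
    (hN : N - diagonal (fun a => ξ (t a)) ∈ uu t) :
    N.charpoly = ∏ k ∈ Finset.univ.image t,
      (Polynomial.X - Polynomial.C (ξ k)) ^ Fintype.card {a // t a = k} := by
  have hNp : Matrix.BlockTriangular N t := by
    have h1 : N ∈ pp t := by
      have := add_mem (uu_le_pp hN) (diagonal_mem_pp (t := t) (fun a => ξ (t a)))
      simpa using this
    intro a b h
    exact h1 a b h
  rw [hNp.charpoly]
  refine Finset.prod_congr rfl fun k _ => ?_
  have : N.toSquareBlock t k = diagonal (fun _ => ξ k) := by
    ext a b
    have ha := a.2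
    have hb := b.2
    have h2 := hN a b (by omega)
    rw [Matrix.sub_apply, sub_eq_zero] at h2
    rw [Matrix.toSquareBlock_def, Matrix.of_apply, h2, Matrix.diagonal_apply, Matrix.diagonal_apply]
    simp only [Subtype.ext_iff, ha]
  rw [this, Matrix.charpoly_diagonal]
  simp

lemma generic_numeric {q n : ℕ} (Y : Fin q → Matrix (Fin n) (Fin n) ℂ) (hgen : GenericAddRoots Y)
    (t : Fin q → Fin n → ℕ) (ξ : Fin q → ℕ → ℂ)
    (hch : ∀ j, (Y j).charpoly = ∏ k ∈ Finset.univ.image (t j),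
      (Polynomial.X - Polynomial.C (ξ j k)) ^ Fintype.card {a // t j a = k}) :
    ∀ κ, 1 ≤ κ → κ ≤ n - 1 → ∀ A : Fin q → ℕ → ℕ,
      (∀ j k, A j k ≤ Fintype.card {a // t j a = k}) →
      (∀ j, ∑ k ∈ Finset.univ.image (t j), A j k = κ) →
      ∑ j, ∑ k ∈ Finset.univ.image (t j), A j k * ξ j k ≠ 0 := by
  intro κ h1 h2 A hA hs
  have := hgen κ h1 h2 (fun j => ∑ k ∈ Finset.univ.image (t j), A j k • {ξ j k}) (fun j => ⟨?_, ?_⟩)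
  · intro h
    apply this
    rw [← h]
    refine Finset.sum_congr rfl fun j _ => ?_
    change Multiset.sumAddMonoidHom _ = _
    rw [map_sum]
    refine Finset.sum_congr rfl fun k _ => ?_
    rw [map_nsmul]
    simp
  · rw [hch, Polynomial.roots_prod _ _ (Finset.prod_ne_zero_iff.2 fun k _ =>
      pow_ne_zero _ (Polynomial.X_sub_C_ne_zero _))]
    simp only [Polynomial.roots_pow, Polynomial.roots_X_sub_C]
    exact Finset.sum_le_sum fun k _ => nsmul_le_nsmul_left zero_le (hA j k)
  · simp only [Multiset.card_sum, Multiset.card_nsmul, Multiset.card_singleton, mul_one, hs]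

lemma charpoly_restrict_dvd {n : ℕ} (f : Module.End ℂ (Fin n → ℂ)) (V : Submodule ℂ (Fin n → ℂ))
    (hV : ∀ x ∈ V, f x ∈ V) : (f.restrict hV).charpoly ∣ f.charpoly := by
  obtain ⟨W, hW⟩ := V.exists_isCompl
  let bV := Module.finBasis ℂ V
  let bW := Module.finBasis ℂ W
  let b := (bV.prod bW).map (Submodule.prodEquivOfIsCompl V W hW)
  have hbl : ∀ i, b (Sum.inl i) = (bV i : Fin n → ℂ) := by
    intro i; simp [b]
  have hrep : ∀ (v : V) , b.repr (v : Fin n → ℂ) = (bV.prod bW).repr (v, 0) := by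
    intro v
    simp [b, Module.Basis.map_repr]
  have hM : LinearMap.toMatrix b b f = fromBlocks (LinearMap.toMatrix bV bV (f.restrict hV))
      ((LinearMap.toMatrix b b f).toBlocks₁₂) 0 ((LinearMap.toMatrix b b f).toBlocks₂₂) := by
    rw [← Matrix.fromBlocks_toBlocks (LinearMap.toMatrix b b f)]
    congr 1
    · ext i j
      rw [Matrix.toBlocks₁₁, Matrix.of_apply, LinearMap.toMatrix_apply, LinearMap.toMatrix_apply, hbl]
      have := hrep ((f.restrict hV) (bV j))
      rw [LinearMap.restrict_apply] at this ⊢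
      rw [this]
      simp
    · ext i j
      rw [Matrix.toBlocks₂₁, Matrix.of_apply, LinearMap.toMatrix_apply, hbl]
      have := hrep ((f.restrict hV) (bV j))
      rw [LinearMap.restrict_apply] at this
      rw [this]
      simp
  rw [← LinearMap.charpoly_toMatrix f b, hM, Matrix.charpoly_fromBlocks_zero₂₁, LinearMap.charpoly_toMatrix]
  exact dvd_mul_right _ _

lemma irreducible_of_generic {q n : ℕ} (A : Fin q → Matrix (Fin n) (Fin n) ℂ)
    (hgen : GenericAddRoots A) (hsum : ∑ j, A j = 0) : IrreducibleTuple A := by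
  intro V hV
  have hV' : ∀ j, ∀ x ∈ V, (Matrix.mulVecLin (A j)) x ∈ V := fun j x hx =>
    hV j (Submodule.mem_map_of_mem hx)
  by_contra hcon
  push Not at hcon
  have h0 : Module.finrank ℂ V ≠ 0 := fun h => hcon.1 (Submodule.finrank_eq_zero.1 h)
  have hn : Module.finrank ℂ V ≠ n := fun h => hcon.2
    (Submodule.eq_top_of_finrank_eq (by rw [h]; simp))
  have hle : Module.finrank ℂ V ≤ n := by
    simpa using Submodule.finrank_le V
  refine hgen (Module.finrank ℂ V) (by omega) (by omega)
    (fun j => ((Matrix.mulVecLin (A j)).restrict (hV' j)).charpoly.roots) (fun j => ⟨?_, ?_⟩) ?_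
  · apply Polynomial.roots.le_of_dvd (Matrix.charpoly_monic _).ne_zero
    have := charpoly_restrict_dvd _ V (hV' j)
    have h2 : (Matrix.mulVecLin (A j)).charpoly = (A j).charpoly := by
      rw [← LinearMap.charpoly_toMatrix _ (Pi.basisFun ℂ (Fin n)), LinearMap.toMatrix_eq_toMatrix',
        ← Matrix.toLin'_apply', LinearMap.toMatrix'_toLin']
    rwa [h2] at this
  · rw [Polynomial.splits_iff_card_roots.1 (IsAlgClosed.splits _), LinearMap.charpoly_natDegree]
  · have h3 : ∀ j, (((Matrix.mulVecLin (A j)).restrict (hV' j)).charpoly.roots).sum =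
        LinearMap.trace ℂ V ((Matrix.mulVecLin (A j)).restrict (hV' j)) := by
      intro j
      rw [Module.End.trace_eq_sum_roots_charpoly_of_splits (IsAlgClosed.splits _)]
    simp only [h3]
    rw [← map_sum]
    have : ∑ j, ((Matrix.mulVecLin (A j)).restrict (hV' j)) = 0 := by
      ext x i
      have h4 := congrArg (fun M : Matrix (Fin n) (Fin n) ℂ => (M *ᵥ (x : Fin n → ℂ)) i) hsum
      simp only [Matrix.sum_mulVec, Finset.sum_apply, Matrix.zero_mulVec, Pi.zero_apply] at h4
      simpa [LinearMap.sum_apply] using h4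
    rw [this, map_zero]

section topo
open Topology Filter

lemma quad_open {E F : Type*} [NormedAddCommGroup E] [NormedSpace ℂ E] [FiniteDimensional ℂ E]
    [NormedAddCommGroup F] [NormedSpace ℂ F] [FiniteDimensional ℂ F]
    (L : E →ₗ[ℂ] F) (hL : Function.Surjective L) (b : E →ₗ[ℂ] E →ₗ[ℂ] F) (U : Set E) (hU : U ∈ 𝓝 (0 : E)) :
    ∀ᶠ y in 𝓝 (0 : F), ∃ x ∈ U, L x + b x x = y := by
  have : CompleteSpace E := FiniteDimensional.complete ℂ E
  have : CompleteSpace F := FiniteDimensional.complete ℂ F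
  let L' : E →L[ℂ] F := LinearMap.toContinuousLinearMap L
  let b' : E →L[ℂ] E →L[ℂ] F := b.toContinuousBilinearMap
  have h1 : HasStrictFDerivAt (fun x : E => L' x + b' x x) L' 0 := by
    have h2 := b'.hasStrictFDerivAt_of_bilinear (hasStrictFDerivAt_id (𝕜 := ℂ) (0 : E))
      (hasStrictFDerivAt_id (𝕜 := ℂ) (0 : E))
    have h3 := (L'.hasStrictFDerivAt (x := 0)).add h2
    refine h3.congr_fderiv ?_
    ext x
    simp
  have h4 := h1.map_nhds_eq_of_surj (LinearMap.range_eq_top.2 hL)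
  have h5 : L' 0 + b' 0 0 = 0 := by simp
  rw [h5] at h4
  have h6 : (fun x : E => L' x + b' x x) '' U ∈ 𝓝 (0 : F) := by
    rw [← h4]; exact image_mem_map hU
  filter_upwards [h6] with y hy
  obtain ⟨x, hx, hxy⟩ := hy
  exact ⟨x, hx, hxy⟩

attribute [local instance] Matrix.normedAddCommGroup Matrix.normedSpace

lemma unit_nhds {n : ℕ} : ∀ᶠ P in 𝓝 (0 : Matrix (Fin n) (Fin n) ℂ), IsUnit (1 + P) := by
  have hc : Continuous (fun P : Matrix (Fin n) (Fin n) ℂ => (1 + P).det) :=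
    Continuous.matrix_det (continuous_const.add continuous_id)
  have := hc.continuousAt (x := 0) |>.eventually_ne (y := 0) (by simp)
  filter_upwards [this] with P hP
  exact (Matrix.isUnit_iff_isUnit_det _).2 (isUnit_iff_ne_zero.2 hP)

lemma conj_of_intertwine {n : ℕ} {X X' S : Matrix (Fin n) (Fin n) ℂ} (hS : IsUnit S)
    (h : S * X = X' * S) : MatConj X X' := by
  obtain ⟨s, rfl⟩ := hS
  refine ⟨s, ?_⟩
  rw [h, mul_assoc, Units.mul_inv, mul_one]

lemma comm_mem_uu {n : ℕ} {t : Fin n → ℕ} {ξ : ℕ → ℂ} {X P : Matrix (Fin n) (Fin n) ℂ}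
    (hX : X - diagonal (fun a => ξ (t a)) ∈ uu t) (hP : P ∈ pp t) : P * X - X * P ∈ uu t := by
  have h1 : P * X - X * P = (P * (X - diagonal (fun a => ξ (t a))) - (X - diagonal (fun a => ξ (t a))) * P) +
      (P * diagonal (fun a => ξ (t a)) - diagonal (fun a => ξ (t a)) * P) := by noncomm_ring
  rw [h1]
  refine add_mem (sub_mem (pp_mul_uu hP hX) (uu_mul_pp hX hP)) ?_
  intro a b h
  rw [Matrix.sub_apply, Matrix.mul_diagonal, Matrix.diagonal_mul]
  rcases h.lt_or_eq with h | h
  · rw [hP a b h]; ring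
  · rw [h]; ring

/-- The map `P ↦ P X - X P` from `pp t` to `uu t`. -/
def TT {n : ℕ} (t : Fin n → ℕ) (ξ : ℕ → ℂ) (X : Matrix (Fin n) (Fin n) ℂ)
    (hX : X - diagonal (fun a => ξ (t a)) ∈ uu t) : pp t →ₗ[ℂ] uu t where
  toFun P := ⟨P.1 * X - X * P.1, comm_mem_uu hX P.2⟩
  map_add' P Q := by apply Subtype.ext; simp; noncomm_ring
  map_smul' c P := by apply Subtype.ext; simp [smul_sub]

lemma TT_surj {n : ℕ} (t : Fin n → ℕ) (ξ : ℕ → ℂ) (X : Matrix (Fin n) (Fin n) ℂ)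
    (hX : X - diagonal (fun a => ξ (t a)) ∈ uu t)
    (hgood : ∀ Z : Matrix (Fin n) (Fin n) ℂ, X * Z - Z * X ∈ uu t → Z ∈ pp t) :
    Function.Surjective (TT t ξ X hX) := by
  rintro ⟨w, hw⟩
  by_contra hcon
  have hcon' : w ∉ (LinearMap.range (TT t ξ X hX)).map (uu t).subtype := by
    rintro ⟨_, ⟨P, rfl⟩, hP⟩
    exact hcon ⟨P, Subtype.ext hP⟩
  obtain ⟨φ, hφw, hφ⟩ := Submodule.exists_le_ker_of_notMem hcon'
  obtain ⟨f, hf⟩ := exists_trace_form φ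
  have h1 : X * f - f * X ∈ uu t := by
    intro a b hab
    have hs : Matrix.single b a (1 : ℂ) ∈ pp t := fun c d hcd => by
      rw [Matrix.single_apply, if_neg]
      rintro ⟨rfl, rfl⟩; omega
    have h2 : φ (Matrix.single b a (1 : ℂ) * X - X * Matrix.single b a (1 : ℂ)) = 0 :=
      hφ ⟨_, ⟨⟨_, hs⟩, rfl⟩, rfl⟩
    rw [hf, mul_sub, Matrix.trace_sub, ← mul_assoc, Matrix.trace_mul_comm, ← mul_assoc, ← mul_assoc, ← Matrix.trace_sub,
      ← sub_mul, Matrix.trace_mul_single] at h2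
    simpa using h2
  apply hφw
  rw [hf]
  exact trace_uu (pp_mul_uu (hgood f h1) hw)

lemma local_orbit {n : ℕ} (t : Fin n → ℕ) (ξ : ℕ → ℂ) (X : Matrix (Fin n) (Fin n) ℂ)
    (hX : X - diagonal (fun a => ξ (t a)) ∈ uu t) (hs : Function.Surjective (TT t ξ X hX)) :
    ∀ᶠ v in 𝓝 (0 : uu t), MatConj X (X + v.1) := by
  let L : (pp t × uu t) →ₗ[ℂ] (uu t × uu t) :=
    ((TT t ξ X hX).comp (LinearMap.fst ℂ _ _) - LinearMap.snd ℂ _ _).prod (LinearMap.snd ℂ _ _)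
  let b : (pp t × uu t) →ₗ[ℂ] (pp t × uu t) →ₗ[ℂ] (uu t × uu t) :=
    LinearMap.mk₂ ℂ (fun x y => (⟨-(x.2.1 * y.1.1), neg_mem (uu_mul_pp x.2.2 y.1.2)⟩, 0))
      (fun x x' y => by ext1 <;> [(apply Subtype.ext; simp; noncomm_ring); simp])
      (fun c x y => by ext1 <;> [(apply Subtype.ext; simp); simp])
      (fun x y y' => by ext1 <;> [(apply Subtype.ext; simp; noncomm_ring); simp])
      (fun c x y => by ext1 <;> [(apply Subtype.ext; simp); simp])
  have hL : Function.Surjective L := by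
    rintro ⟨a, c⟩
    obtain ⟨P, hP⟩ := hs (a + c)
    refine ⟨(P, c), ?_⟩
    simp [L, hP]
  have hU : {x : pp t × uu t | IsUnit (1 + x.1.1)} ∈ 𝓝 (0 : pp t × uu t) := by
    have hc : Continuous (fun x : pp t × uu t => x.1.1) := continuous_subtype_val.comp continuous_fst
    exact (hc.tendsto 0).eventually (by simpa using unit_nhds)
  have h := quad_open L hL b _ hU
  have hc : Continuous (fun v : uu t => ((0 : uu t), v)) := by fun_prop
  have h2 := (hc.tendsto 0).eventually h
  filter_upwards [h2] with v hv
  obtain ⟨⟨P, v'⟩, hu, he⟩ := hv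
  have e1 : (TT t ξ X hX P - v') + ⟨-(v'.1 * P.1), neg_mem (uu_mul_pp v'.2 P.2)⟩ = 0 :=
    congrArg Prod.fst he
  have e2 : v' + 0 = v := congrArg Prod.snd he
  rw [add_zero] at e2
  subst e2
  have e3 : (P.1 * X - X * P.1 - v'.1) + -(v'.1 * P.1) = 0 := congrArg Subtype.val e1
  refine conj_of_intertwine (S := 1 + P.1) hu ?_
  rw [← sub_eq_zero, ← e3]
  noncomm_ring

lemma MatConj.symm {n : ℕ} {X Y : Matrix (Fin n) (Fin n) ℂ} (h : MatConj X Y) : MatConj Y X := by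
  obtain ⟨S, rfl⟩ := h
  exact ⟨S⁻¹, by simp [mul_assoc]⟩

lemma MatConj.trans {n : ℕ} {X Y Z : Matrix (Fin n) (Fin n) ℂ} (h : MatConj X Y) (h' : MatConj Y Z) :
    MatConj X Z := by
  obtain ⟨S, rfl⟩ := h
  obtain ⟨T, rfl⟩ := h'
  exact ⟨T * S, by simp [mul_assoc]⟩

lemma closure_orbit {n : ℕ} (t : Fin n → ℕ) (ξ : ℕ → ℂ) (N : Matrix (Fin n) (Fin n) ℂ)
    (hN : N - diagonal (fun a => ξ (t a)) ∈ uu t)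
    (hgood : ∀ Z : Matrix (Fin n) (Fin n) ℂ, N * Z - Z * N ∈ uu t → Z ∈ pp t)
    (u : Matrix (Fin n) (Fin n) ℂ) (hu : u ∈ uu t) :
    N + u ∈ closure {A | MatConj N A} := by
  have hX : ∀ s : ℂ, (N + s • u) - diagonal (fun a => ξ (t a)) ∈ uu t := by
    intro s
    rw [add_sub_right_comm]
    exact add_mem hN (Submodule.smul_mem _ _ hu)
  obtain ⟨R, hR⟩ := (TT t ξ N hN).exists_rightInverse_of_surjective
    (LinearMap.range_eq_top.2 (TT_surj t ξ N hN hgood))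
  let T1 : pp t →ₗ[ℂ] uu t :=
    { toFun := fun P => ⟨P.1 * u - u * P.1, sub_mem (pp_mul_uu P.2 hu) (uu_mul_pp hu P.2)⟩
      map_add' := fun P Q => by apply Subtype.ext; simp; noncomm_ring
      map_smul' := fun c P => by apply Subtype.ext; simp [smul_sub] }
  let K : Module.End ℂ (uu t) := T1.comp R
  let Bad : Set ℂ := (fun z => -z⁻¹) '' (spectrum ℂ K)
  have hBad : Bad.Finite := (Module.End.finite_spectrum K).image _
  have hsurj : ∀ s : ℂ, s ∉ Bad ∨ s = 0 → Function.Surjective (TT t ξ _ (hX s)) := by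
    intro s hs
    have hunit : IsUnit (1 + s • K) := by
      rcases eq_or_ne s 0 with rfl | h0
      · simp
      have hs : s ∉ Bad := hs.resolve_right h0
      have h1 : -s⁻¹ ∉ spectrum ℂ K := fun h => hs ⟨_, h, by simp⟩
      rw [spectrum.notMem_iff] at h1
      have h2 : 1 + s • K = (-s) • (algebraMap ℂ (Module.End ℂ (uu t)) (-s⁻¹) - K) := by
        ext w : 1
        simp only [LinearMap.add_apply, LinearMap.smul_apply, LinearMap.sub_apply, Module.End.one_apply,
          Module.algebraMap_end_apply]
        rw [_root_.smul_sub, smul_smul]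
        simp [h0]
      rw [h2]
      exact h1.smul (Units.mk0 (-s) (neg_ne_zero.2 h0))
    have h3 : (TT t ξ _ (hX s)).comp R = 1 + s • K := by
      ext w : 1
      have h4 := LinearMap.congr_fun hR w
      have h5 : TT t ξ N hN (R w) = w := h4
      apply Subtype.ext
      have h6 : (R w).1 * N - N * (R w).1 = w.1 := congrArg Subtype.val h5
      change (R w).1 * (N + s • u) - (N + s • u) * (R w).1 = w.1 + s • ((R w).1 * u - u * (R w).1)
      rw [← h6, mul_add, add_mul, mul_smul_comm, smul_mul_assoc, smul_sub]
      abel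
    intro w
    obtain ⟨w', hw'⟩ := ((Module.End.isUnit_iff _).1 hunit).2 w
    exact ⟨R w', by rw [← hw', ← h3]; rfl⟩
  let C : Set ℂ := (Bad \ {0})ᶜ
  have hCc : (Bad \ {0}).Countable := (hBad.subset Set.sdiff_subset).countable
  have hC : IsPreconnected C :=
    (hCc.isConnected_compl_of_one_lt_rank (by rw [Complex.rank_real_complex]; norm_num)).isPreconnected
  have hCs : ∀ s ∈ C, s ∉ Bad ∨ s = 0 := by
    intro s hs
    by_contra h
    push Not at h
    exact hs ⟨h.1, h.2⟩
  have hconj : ∀ s ∈ C, MatConj N (N + s • u) := by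
    intro s hs
    have h0 : (0 : ℂ) ∈ C := fun h => h.2 rfl
    have := hC.induction₂' (fun x y => MatConj (N + x • u) (N + y • u)) (fun x hx => ?_)
      (fun x y z _ _ _ h h' => h.trans h') h0 hs
    · simpa using this
    · apply mem_nhdsWithin_of_mem_nhds
      have h7 := local_orbit t ξ _ (hX x) (hsurj x (hCs x hx))
      have hc : Continuous (fun y : ℂ => (y - x) • (⟨u, hu⟩ : uu t)) := by fun_prop
      have h8 := (hc.tendsto x).eventually (by simpa using h7)
      filter_upwards [h8] with y hy
      have : N + x • u + (y - x) • u = N + y • u := by rw [sub_smul]; abel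
      rw [← this]
      exact ⟨hy, MatConj.symm hy⟩
  have hdense : Dense C := hCc.dense_compl ℂ
  have h9 : (1 : ℂ) ∈ closure C := hdense 1
  have hcont : Continuous (fun s : ℂ => N + s • u) := by fun_prop
  have h10 := image_closure_subset_closure_image hcont ⟨1, h9, rfl⟩
  simp only [one_smul] at h10
  refine closure_mono ?_ h10
  rintro _ ⟨s, hs, rfl⟩
  exact hconj s hs

end topo

section topo2
open Topology Filter
attribute [local instance] Matrix.normedAddCommGroup Matrix.normedSpace

lemma schur_scalar {q n : ℕ} (A : Fin q → Matrix (Fin n) (Fin n) ℂ) (hirr : IrreducibleTuple A)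
    (f : Matrix (Fin n) (Fin n) ℂ) (hf : ∀ j, A j * f = f * A j) :
    ∃ c : ℂ, f = c • (1 : Matrix (Fin n) (Fin n) ℂ) := by
  rcases Nat.eq_zero_or_pos n with hn0 | hn0
  · subst hn0; exact ⟨0, Subsingleton.elim _ _⟩
  have hne : Nonempty (Fin n) := ⟨⟨0, hn0⟩⟩
  obtain ⟨c, hc⟩ := Module.End.exists_eigenvalue (Matrix.mulVecLin f)
  refine ⟨c, ?_⟩
  have hinv : ∀ j, (Module.End.eigenspace (Matrix.mulVecLin f) c).map (Matrix.mulVecLin (A j)) ≤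
      Module.End.eigenspace (Matrix.mulVecLin f) c := by
    intro j
    rintro _ ⟨x, hx, rfl⟩
    have hx' := Module.End.mem_eigenspace_iff.1 hx
    rw [Matrix.mulVecLin_apply] at hx'
    rw [Module.End.mem_eigenspace_iff, Matrix.mulVecLin_apply, Matrix.mulVecLin_apply, Matrix.mulVec_mulVec, ← hf,
      ← Matrix.mulVec_mulVec, hx', Matrix.mulVec_smul]
  rcases hirr (Module.End.eigenspace (Matrix.mulVecLin f) c) hinv with h | h
  · exact (hc h).elim
  · have h2 : ∀ x : Fin n → ℂ, f *ᵥ x = c • x := fun x => by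
      have : x ∈ Module.End.eigenspace (Matrix.mulVecLin f) c := by rw [h]; trivial
      exact Module.End.mem_eigenspace_iff.1 this
    apply Matrix.toLin'.injective
    ext1 i
    ext1
    simp [h2]

lemma comm_surj {q n : ℕ} (A : Fin q → Matrix (Fin n) (Fin n) ℂ) (hirr : IrreducibleTuple A)
    (M : Matrix (Fin n) (Fin n) ℂ) : ∃ (X : Fin q → Matrix (Fin n) (Fin n) ℂ) (c : ℂ),
      ∑ j, (X j * A j - A j * X j) + c • (1 : Matrix (Fin n) (Fin n) ℂ) = M := by
  let L : ((Fin q → Matrix (Fin n) (Fin n) ℂ) × ℂ) →ₗ[ℂ] Matrix (Fin n) (Fin n) ℂ :=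
    { toFun := fun x => ∑ j, (x.1 j * A j - A j * x.1 j) + x.2 • (1 : Matrix (Fin n) (Fin n) ℂ)
      map_add' := fun x y => by
        simp only [Prod.fst_add, Prod.snd_add, Pi.add_apply, add_mul, mul_add, add_smul,
          Finset.sum_sub_distrib, Finset.sum_add_distrib]
        abel
      map_smul' := fun c x => by
        simp [Finset.smul_sum, smul_sub, smul_smul] }
  suffices h : M ∈ LinearMap.range L by
    obtain ⟨x, hx⟩ := h
    exact ⟨x.1, x.2, hx⟩
  by_contra hcon
  obtain ⟨φ, hφM, hφ⟩ := Submodule.exists_le_ker_of_notMem hcon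
  obtain ⟨f, hf⟩ := exists_trace_form φ
  have h1 : ∀ j, A j * f = f * A j := by
    intro j
    have h2 : ∀ Z : Matrix (Fin n) (Fin n) ℂ, ((A j * f - f * A j) * Z).trace = 0 := by
      intro Z
      have h3 : L (Pi.single j Z, 0) = Z * A j - A j * Z := by
        change ∑ i, ((Pi.single j Z : Fin q → Matrix (Fin n) (Fin n) ℂ) i * A i - A i * (Pi.single j Z : Fin q → Matrix (Fin n) (Fin n) ℂ) i) + (0 : ℂ) • (1 : Matrix (Fin n) (Fin n) ℂ) = _
        rw [zero_smul, add_zero, Finset.sum_eq_single j]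
        · simp
        · intro i _ hij
          rw [Pi.single_eq_of_ne hij]; simp
        · simp
      have h4 : φ (Z * A j - A j * Z) = 0 := by rw [← h3]; exact hφ ⟨_, rfl⟩
      rw [hf, mul_sub, Matrix.trace_sub, ← mul_assoc, Matrix.trace_mul_comm, ← mul_assoc, ← mul_assoc,
        ← Matrix.trace_sub, ← sub_mul] at h4
      exact h4
    rw [← sub_eq_zero]
    ext a b
    have := h2 (Matrix.single b a 1)
    rw [Matrix.trace_mul_single] at this
    simpa using this
  obtain ⟨c, rfl⟩ := schur_scalar A hirr f h1
  have h5 : L (0, 1) = 1 := by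
    change ∑ i, ((0 : Matrix (Fin n) (Fin n) ℂ) * A i - A i * 0) + (1 : ℂ) • (1 : Matrix (Fin n) (Fin n) ℂ) = 1
    simp
  have h6 : φ 1 = 0 := by rw [← h5]; exact hφ ⟨_, rfl⟩
  rw [hf, mul_one, Matrix.trace_smul, Matrix.trace_one, smul_eq_mul, mul_eq_zero] at h6
  apply hφM
  rw [hf]
  rcases h6 with h6 | h6
  · rw [h6]; simp
  · have hn : n = 0 := by simpa using h6
    subst hn
    simp [Matrix.trace]

lemma deform {q n : ℕ} (A : Fin q → Matrix (Fin n) (Fin n) ℂ) (hirr : IrreducibleTuple A)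
    (hsum : ∑ j, A j = 0) :
    ∀ᶠ α in 𝓝 (0 : Fin q → Matrix (Fin n) (Fin n) ℂ), ∑ j, (A j + α j).trace = 0 →
      ∃ B : Fin q → Matrix (Fin n) (Fin n) ℂ, (∀ j, MatConj (A j + α j) (B j)) ∧ ∑ j, B j = 0 := by
  let L : (((Fin q → Matrix (Fin n) (Fin n) ℂ) × (Fin q → Matrix (Fin n) (Fin n) ℂ)) × (ℂ × (Fin q → Matrix (Fin n) (Fin n) ℂ))) →ₗ[ℂ] ((Fin q → Matrix (Fin n) (Fin n) ℂ) × (Matrix (Fin n) (Fin n) ℂ × (Fin q → Matrix (Fin n) (Fin n) ℂ))) :=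
    { toFun := fun x => (fun j => x.1.2 j + A j * x.1.1 j - x.2.2 j - x.1.1 j * A j,
        (∑ j, x.1.2 j + x.2.1 • (1 : Matrix (Fin n) (Fin n) ℂ), x.2.2))
      map_add' := fun x y => by
        refine Prod.ext (funext fun j => ?_) (Prod.ext ?_ rfl)
        · simp only [Prod.fst_add, Prod.snd_add, Pi.add_apply, add_mul, mul_add]; abel
        · simp only [Prod.fst_add, Prod.snd_add, Pi.add_apply, add_smul, Finset.sum_add_distrib]; abel
      map_smul' := fun c x => by
        refine Prod.ext (funext fun j => ?_) (Prod.ext ?_ rfl)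
        · simp [smul_sub, smul_add]
        · simp [Finset.smul_sum, smul_add, smul_smul] }
  let b : (((Fin q → Matrix (Fin n) (Fin n) ℂ) × (Fin q → Matrix (Fin n) (Fin n) ℂ)) × (ℂ × (Fin q → Matrix (Fin n) (Fin n) ℂ))) →ₗ[ℂ] (((Fin q → Matrix (Fin n) (Fin n) ℂ) × (Fin q → Matrix (Fin n) (Fin n) ℂ)) × (ℂ × (Fin q → Matrix (Fin n) (Fin n) ℂ))) →ₗ[ℂ] ((Fin q → Matrix (Fin n) (Fin n) ℂ) × (Matrix (Fin n) (Fin n) ℂ × (Fin q → Matrix (Fin n) (Fin n) ℂ))) :=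
    LinearMap.mk₂ ℂ (fun x y => (fun j => x.1.2 j * y.1.1 j - x.1.1 j * y.2.2 j, (0, 0)))
      (fun x x' y => by
        refine Prod.ext (funext fun j => ?_) (by simp)
        simp only [Prod.fst_add, Prod.snd_add, Pi.add_apply, add_mul]; abel)
      (fun c x y => by
        refine Prod.ext (funext fun j => ?_) (by simp)
        simp [smul_sub])
      (fun x y y' => by
        refine Prod.ext (funext fun j => ?_) (by simp)
        simp only [Prod.fst_add, Prod.snd_add, Pi.add_apply, mul_add]; abel)
      (fun c x y => by
        refine Prod.ext (funext fun j => ?_) (by simp)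
        simp [smul_sub])
  have hL : Function.Surjective L := by
    rintro ⟨γ, σ, α⟩
    obtain ⟨X, c, hX⟩ := comm_surj A hirr (σ - ∑ j, (γ j + α j))
    refine ⟨((X, fun j => γ j + α j + (X j * A j - A j * X j)), (c, α)), ?_⟩
    refine Prod.ext (funext fun j => ?_) (Prod.ext ?_ rfl)
    · change γ j + α j + (X j * A j - A j * X j) + A j * X j - α j - X j * A j = γ j
      abel
    · change ∑ j, (γ j + α j + (X j * A j - A j * X j)) + c • (1 : Matrix (Fin n) (Fin n) ℂ) = σ
      rw [Finset.sum_add_distrib, add_assoc, hX]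
      abel
  have hU : {x : ((Fin q → Matrix (Fin n) (Fin n) ℂ) × (Fin q → Matrix (Fin n) (Fin n) ℂ)) × (ℂ × (Fin q → Matrix (Fin n) (Fin n) ℂ)) | ∀ j, IsUnit (1 + x.1.1 j)} ∈ 𝓝 (0 : ((Fin q → Matrix (Fin n) (Fin n) ℂ) × (Fin q → Matrix (Fin n) (Fin n) ℂ)) × (ℂ × (Fin q → Matrix (Fin n) (Fin n) ℂ))) := by
    refine eventually_all.2 fun j => ?_
    have hc : Continuous (fun x : ((Fin q → Matrix (Fin n) (Fin n) ℂ) × (Fin q → Matrix (Fin n) (Fin n) ℂ)) × (ℂ × (Fin q → Matrix (Fin n) (Fin n) ℂ)) => x.1.1 j) :=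
      (continuous_apply j).comp (continuous_fst.comp continuous_fst)
    exact (hc.tendsto 0).eventually unit_nhds
  have h := quad_open L hL b _ hU
  have hc : Continuous (fun v : (Fin q → Matrix (Fin n) (Fin n) ℂ) => ((0 : (Fin q → Matrix (Fin n) (Fin n) ℂ)), ((0 : Matrix (Fin n) (Fin n) ℂ), v))) := by fun_prop
  have h2 := (hc.tendsto 0).eventually h
  filter_upwards [h2] with α hα htr
  obtain ⟨⟨⟨X, β⟩, ⟨c, α'⟩⟩, hu, he⟩ := hα
  have e1 : ∀ j, (β j + A j * X j - α' j - X j * A j) + (β j * X j - X j * α' j) = 0 := fun j =>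
    congrFun (congrArg Prod.fst he) j
  have e2 : (∑ j, β j + c • (1 : Matrix (Fin n) (Fin n) ℂ)) + 0 = 0 := congrArg (fun z => z.2.1) he
  have e3 : α' + 0 = α := congrArg (fun z => z.2.2) he
  rw [add_zero] at e2 e3
  subst e3
  have hconj : ∀ j, MatConj (A j + α' j) (A j + β j) := by
    intro j
    refine conj_of_intertwine (S := 1 + X j) (hu j) ?_
    rw [eq_comm, ← sub_eq_zero, ← e1 j]
    noncomm_ring
  refine ⟨fun j => A j + β j, hconj, ?_⟩
  have htr2 : ∀ j, (A j + β j).trace = (A j + α' j).trace := by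
    intro j
    obtain ⟨S, hS⟩ := hconj j
    rw [hS, Matrix.trace_mul_comm, ← mul_assoc, Units.inv_mul, one_mul]
  have h7 : (∑ j, (A j + β j)).trace = 0 := by
    rw [Matrix.trace_sum]; simp only [htr2]; exact htr
  rw [Finset.sum_add_distrib, hsum, zero_add] at h7 ⊢
  have h8 : ∑ j, β j = -(c • (1 : Matrix (Fin n) (Fin n) ℂ)) := eq_neg_of_add_eq_zero_left e2
  rw [h8] at h7 ⊢
  rw [Matrix.trace_neg, Matrix.trace_smul, Matrix.trace_one, neg_eq_zero, smul_eq_mul, mul_eq_zero] at h7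
  rcases h7 with h7 | h7
  · rw [h7]; simp
  · have hn : n = 0 := by simpa using h7
    subst hn
    exact Subsingleton.elim _ _

end topo2

section final
open Topology Filter
attribute [local instance] Matrix.normedAddCommGroup Matrix.normedSpace

lemma MatConj.charpoly_eq {n : ℕ} {X Y : Matrix (Fin n) (Fin n) ℂ} (h : MatConj X Y) :
    Y.charpoly = X.charpoly := by
  obtain ⟨S, rfl⟩ := h
  rw [Matrix.coe_units_inv]
  exact Matrix.charpoly_units_conj S X

lemma MatConj.trace_eq {n : ℕ} {X Y : Matrix (Fin n) (Fin n) ℂ} (h : MatConj X Y) :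
    Y.trace = X.trace := by
  obtain ⟨S, rfl⟩ := h
  rw [Matrix.trace_mul_comm, ← mul_assoc, Units.inv_mul, one_mul]

lemma GenericAddRoots.of_charpoly {q n : ℕ} {Y A : Fin q → Matrix (Fin n) (Fin n) ℂ}
    (h : GenericAddRoots Y) (hc : ∀ j, (A j).charpoly = (Y j).charpoly) : GenericAddRoots A := by
  intro κ h1 h2 Φ hΦ
  exact h κ h1 h2 Φ fun j => by rw [← hc j]; exact hΦ j

lemma main_aux (n q : ℕ) (Y : Fin q → Matrix (Fin n) (Fin n) ℂ) (htr : (∑ j, (Y j).trace) = 0)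
    (hgen : GenericAddRoots Y) (hr : 2 * n ≤ ∑ j, minRank (Y j)) :
    ∃ A : Fin q → Matrix (Fin n) (Fin n) ℂ,
      (∀ j, MatConj (Y j) (A j)) ∧ IrreducibleTuple A ∧ (∑ j, A j) = 0 := by
  choose S t ξ N hS hN hgood hcard using fun j => normal_form (Y j)
  obtain ⟨g, hg⟩ := exists_generic_matrices q n
  have hYN : ∀ j, MatConj (Y j) (N j) := fun j => ⟨S j, hS j⟩
  have hch : ∀ j, (Y j).charpoly = ∏ k ∈ Finset.univ.image (t j),
      (Polynomial.X - Polynomial.C (ξ j k)) ^ Fintype.card {a // t j a = k} := fun j => by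
    rw [← (hYN j).charpoly_eq]
    exact charpoly_pp (t j) (ξ j) (N j) (hN j)
  have htr' : ∑ j, ∑ a, ξ j (t j a) = 0 := by
    rw [← htr]
    refine Finset.sum_congr rfl fun j _ => ?_
    have h1 := trace_uu (hN j)
    rw [Matrix.trace_sub, Matrix.trace_diagonal, (hYN j).trace_eq] at h1
    exact (sub_eq_zero.1 h1).symm
  have hnum := generic_numeric Y hgen t ξ hch
  obtain ⟨u, hu, hsum⟩ := linear_step t g ξ N hN htr' fun e he hp =>
    no_idempotent t g hg ξ (fun j => minRank (Y j)) hcard hr htr' hnum e he hp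
  set A : Fin q → Matrix (Fin n) (Fin n) ℂ := fun j => (g j).val * (N j + u j) * ((g j)⁻¹).val with hA
  have hAch : ∀ j, (A j).charpoly = (Y j).charpoly := fun j => by
    have h1 : MatConj (N j + u j) (A j) := ⟨g j, rfl⟩
    rw [h1.charpoly_eq, hch j]
    refine charpoly_pp (t j) (ξ j) (N j + u j) ?_
    rw [add_sub_right_comm]
    exact add_mem (hN j) (hu j)
  have hirr : IrreducibleTuple A := irreducible_of_generic A (hgen.of_charpoly hAch) hsum
  have hcl : ∀ j, A j ∈ closure {B | MatConj (Y j) B} := fun j => by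
    have h1 := closure_orbit (t j) (ξ j) (N j) (hN j) (hgood j) (u j) (hu j)
    have hcont : Continuous (fun X : Matrix (Fin n) (Fin n) ℂ => (g j).val * X * ((g j)⁻¹).val) :=
      (continuous_const.matrix_mul continuous_id).matrix_mul continuous_const
    have h2 := image_closure_subset_closure_image hcont ⟨_, h1, rfl⟩
    refine closure_mono ?_ h2
    rintro _ ⟨X, hX, rfl⟩
    exact (hYN j).trans (hX.trans ⟨g j, rfl⟩)
  have hclA : A ∈ closure (Set.univ.pi fun j => {B | MatConj (Y j) B}) := by
    rw [closure_pi_set]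
    exact fun j _ => hcl j
  have hd := deform A hirr hsum
  have hsub : Tendsto (fun B : Fin q → Matrix (Fin n) (Fin n) ℂ => B - A) (𝓝 A) (𝓝 0) := by
    have hc : Continuous (fun B : Fin q → Matrix (Fin n) (Fin n) ℂ => B - A) :=
      continuous_id.sub continuous_const
    have := hc.tendsto A
    rwa [sub_self] at this
  obtain ⟨A', hA', hA'Y⟩ := ((mem_closure_iff_frequently.1 hclA).and_eventually
    (hsub.eventually hd)).exists.imp fun _ h => And.symm h
  have hA'Y : ∀ j, MatConj (Y j) (A' j) := fun j => hA'Y j trivial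
  have hadd : ∀ j, A j + (A' - A) j = A' j := fun j => by
    rw [Pi.sub_apply]; abel
  simp only [hadd] at hA'
  obtain ⟨B, hB, hBs⟩ := hA' (by
    rw [← htr]
    exact Finset.sum_congr rfl fun j _ => (hA'Y j).trace_eq)
  have hYB : ∀ j, MatConj (Y j) (B j) := fun j => (hA'Y j).trans (hB j)
  exact ⟨B, hYB, irreducible_of_generic B
    (hgen.of_charpoly fun j => (hYB j).charpoly_eq) hBs, hBs⟩

end final

/-- solution of the DSP for generic eigenvalues under `(ω_n)`, additive
version. If the conjugacy classes (given by representatives `Y j`) have generic eigenvalues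
and `r(c_1) + ⋯ + r(c_{p+1}) ≥ 2n`, then there is an irreducible tuple `A j ∈ c_j` with
`A 1 + ⋯ + A (p+1) = 0`. -/
theorem stmt2 (n p : ℕ)
    (Y : Fin (p + 1) → Matrix (Fin n) (Fin n) ℂ)
    (htr : (∑ j, (Y j).trace) = 0)
    (hgen : GenericAddRoots Y)
    (hr : 2 * n ≤ ∑ j, minRank (Y j)) :
    ∃ A : Fin (p + 1) → Matrix (Fin n) (Fin n) ℂ,
      (∀ j, MatConj (Y j) (A j)) ∧ IrreducibleTuple A ∧ (∑ j, A j) = 0 :=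
  main_aux n (p + 1) Y htr hgen hr
end

section
/- Let C₁,…,C_{p+1} ⊂ GL(n,ℂ) be conjugacy classes with generic eigenvalues satisfying d(C₁) + … + d(C_{p+1}) = 2n² − 2. If (M₁,…,M_{p+1}) and (M′₁,…,M′_{p+1}) are two irreducible (p+1)-tuples with M_j, M′_j ∈ C_j and M₁⋯M_{p+1} = I = M′₁⋯M′_{p+1}, then there exists S ∈ GL(n,ℂ) with M′_j = S M_j S^{−1} for every j. -/
open Matrix BigOperators

/-- Genericity of the eigenvalues (= roots of the characteristic polynomials, with
multiplicity): no products of sub-multisets of equal cardinality `κ`, `1 ≤ κ ≤ n-1`, equal `1`. -/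
def GenericMulRoots {q n : ℕ} (M : Fin q → Matrix (Fin n) (Fin n) ℂ) : Prop :=
  ∀ κ : ℕ, 1 ≤ κ → κ ≤ n - 1 →
    ∀ Φ : Fin q → Multiset ℂ,
      (∀ j, Φ j ≤ (M j).charpoly.roots ∧ Multiset.card (Φ j) = κ) →
      (∏ j, (Φ j).prod) ≠ 1


/-- A nonzero intertwiner out of an irreducible tuple is invertible. -/
lemma isUnit_of_intertwine {q n : ℕ} (M M' : Fin q → Matrix (Fin n) (Fin n) ℂ)
    (hirr : IrreducibleTuple M) (X : Matrix (Fin n) (Fin n) ℂ) (hX : X ≠ 0)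
    (h : ∀ j, M' j * X = X * M j) : IsUnit X := by
  rcases hirr (LinearMap.ker X.mulVecLin) (by
    intro j
    rw [Submodule.map_le_iff_le_comap]
    intro v hv
    simp only [LinearMap.mem_ker, Matrix.mulVecLin_apply, Submodule.mem_comap] at hv ⊢
    rw [Matrix.mulVec_mulVec, ← h j, ← Matrix.mulVec_mulVec, hv, Matrix.mulVec_zero]) with h0 | h0
  · rw [← Matrix.mulVec_injective_iff_isUnit]
    exact LinearMap.ker_eq_bot.mp h0
  · exfalso
    apply hX
    rw [LinearMap.ker_eq_top] at h0
    ext i j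
    have := congrFun (LinearMap.congr_fun h0 (Pi.single j 1)) i
    simpa using this

/-- The map sending X to B X minus X A. -/
noncomputable def interL {n : ℕ} (A B : Matrix (Fin n) (Fin n) ℂ) :
    Matrix (Fin n) (Fin n) ℂ →ₗ[ℂ] Matrix (Fin n) (Fin n) ℂ :=
  LinearMap.mulLeft ℂ B - LinearMap.mulRight ℂ A

lemma interL_apply {n : ℕ} (A B X : Matrix (Fin n) (Fin n) ℂ) :
    interL A B X = B * X - X * A := by
  simp [interL]

lemma finrank_range_interL {n : ℕ} (A B : Matrix (Fin n) (Fin n) ℂ) (h : MatConj A B) :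
    Module.finrank ℂ (LinearMap.range (interL A B)) = classDim A := by
  obtain ⟨S, rfl⟩ := h
  have e : Module.finrank ℂ (LinearMap.ker (interL A (S.val * A * (S⁻¹).val))) =
      Module.finrank ℂ (LinearMap.ker (interL A A)) := by
    have hle : ∀ (U : (Matrix (Fin n) (Fin n) ℂ)ˣ) (C D : Matrix (Fin n) (Fin n) ℂ),
        U.val * C = D * U.val →
        Module.finrank ℂ (LinearMap.ker (interL A C)) ≤
          Module.finrank ℂ (LinearMap.ker (interL A D)) := by
      intro U C D hU
      have hm : ∀ X ∈ LinearMap.ker (interL A C),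
          LinearMap.mulLeft ℂ U.val X ∈ LinearMap.ker (interL A D) := by
        intro X hX
        simp only [LinearMap.mem_ker, interL_apply, LinearMap.mulLeft_apply] at hX ⊢
        rw [← mul_assoc, ← hU, mul_assoc, mul_assoc, ← mul_sub, hX, mul_zero]
      apply LinearMap.finrank_le_finrank_of_injective
        (f := (LinearMap.mulLeft ℂ U.val).restrict hm)
      intro X Y hXY
      have := congrArg Subtype.val hXY
      simp only [LinearMap.coe_restrict_apply, LinearMap.mulLeft_apply] at this
      exact Subtype.ext (U.isUnit.mul_left_cancel this)
    apply le_antisymm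
    · apply hle S⁻¹
      simp [← mul_assoc]
    · apply hle S
      simp [mul_assoc]
  have h1 := LinearMap.finrank_range_add_finrank_ker (interL A (S.val * A * (S⁻¹).val))
  rw [e, Module.finrank_matrix] at h1
  simp only [Fintype.card_fin, Module.finrank_self, mul_one] at h1
  unfold classDim
  change _ = n ^ 2 - Module.finrank ℂ (LinearMap.ker (interL A A))
  rw [pow_two, ← h1]
  omega

/-- Scott's lemma in the form needed here. -/
lemma scott_s4 {q n : ℕ} (M M' : Fin q → Matrix (Fin n) (Fin n) ℂ)
    (hprod : (List.ofFn M).prod = 1) (hprod' : (List.ofFn M').prod = 1)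
    (hlt : ∑ j, Module.finrank ℂ (LinearMap.range (interL (M j) (M' j))) < 2 * n ^ 2) :
    (∃ X, X ≠ 0 ∧ ∀ j, M' j * X = X * M j) ∨ (∃ Y, Y ≠ 0 ∧ ∀ j, M j * Y = Y * M' j) := by
  set P : ℕ → Matrix (Fin n) (Fin n) ℂ := fun k => ((List.ofFn M').take k).prod with hP
  set Q : ℕ → Matrix (Fin n) (Fin n) ℂ := fun k => ((List.ofFn M).drop k).prod with hQ
  have P0 : P 0 = 1 := by simp [hP]
  have Q0 : Q 0 = 1 := by simp [hQ, hprod]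
  have Pq : P q = 1 := by
    simp only [hP]; rw [List.take_of_length_le (by simp), hprod']
  have Qq : Q q = 1 := by
    simp only [hQ]; rw [List.drop_of_length_le (by simp), List.prod_nil]
  have Ps : ∀ j : Fin q, P (j + 1) = P j * M' j := by
    intro j
    simp only [hP]
    rw [List.prod_take_succ _ _ (by simp)]
    simp
  have Qs : ∀ j : Fin q, Q j = M j * Q (j + 1) := by
    intro j
    simp only [hQ]
    rw [List.drop_eq_getElem_cons (by simp), List.prod_cons]
    simp
  let R := ∀ j : Fin q, LinearMap.range (interL (M j) (M' j))
  let B : Matrix (Fin n) (Fin n) ℂ →ₗ[ℂ] R :=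
    LinearMap.pi fun j => (interL (M j) (M' j)).rangeRestrict
  let D : R →ₗ[ℂ] Matrix (Fin n) (Fin n) ℂ :=
    ∑ j : Fin q, (LinearMap.mulLeft ℂ (P j)) ∘ₗ (LinearMap.mulRight ℂ (Q (j + 1))) ∘ₗ
      (LinearMap.range (interL (M j) (M' j))).subtype ∘ₗ LinearMap.proj j
  have hDap : ∀ w : R, D w = ∑ j : Fin q, P j * ((w j).val * Q (j + 1)) := by
    intro w
    simp only [D, LinearMap.sum_apply]
    rfl
  have hDB : ∀ X, D (B X) = 0 := by
    intro X
    rw [hDap]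
    have : ∀ j : Fin q, P j * (((B X) j).val * Q (j + 1)) =
        P (j + 1) * X * Q (j + 1) - P j * X * Q j := by
      intro j
      have : ((B X) j).val = M' j * X - X * M j := by
        rw [← interL_apply]; rfl
      rw [this, Ps, Qs]
      noncomm_ring
    rw [Finset.sum_congr rfl fun j _ => this j,
      Fin.sum_univ_eq_sum_range (fun j => P (j + 1) * X * Q (j + 1) - P j * X * Q j) q,
      Finset.sum_range_sub (fun j => P j * X * Q j), P0, Q0, Pq, Qq]
    simp
  by_cases hB : LinearMap.ker B = ⊥
  swap
  · left
    obtain ⟨X, hX, hX0⟩ := Submodule.exists_mem_ne_zero_of_ne_bot hB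
    refine ⟨X, hX0, fun j => ?_⟩
    have := congrArg Subtype.val (congrFun (LinearMap.mem_ker.mp hX) j)
    have h2 : interL (M j) (M' j) X = 0 := this
    rw [interL_apply] at h2
    exact sub_eq_zero.mp h2
  right
  have hDr : LinearMap.range D < ⊤ := by
    rw [lt_top_iff_ne_top]
    intro htop
    have h1 := LinearMap.finrank_range_add_finrank_ker D
    have h2 := LinearMap.finrank_range_add_finrank_ker B
    have h3 : Module.finrank ℂ (LinearMap.range B) ≤ Module.finrank ℂ (LinearMap.ker D) := by
      apply Submodule.finrank_mono
      rintro _ ⟨X, rfl⟩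
      exact hDB X
    have h4 : Module.finrank ℂ R =
        ∑ j, Module.finrank ℂ (LinearMap.range (interL (M j) (M' j))) :=
      Module.finrank_pi_fintype ℂ
    rw [htop, finrank_top] at h1
    rw [hB, finrank_bot] at h2
    rw [Module.finrank_matrix] at h1 h2
    simp only [Fintype.card_fin, Module.finrank_self, mul_one] at h1 h2
    rw [pow_two] at hlt
    omega
  obtain ⟨φ, hφ0, hφ⟩ := Submodule.exists_le_ker_of_lt_top _ hDr
  obtain ⟨Y, hY⟩ : ∃ Y : Matrix (Fin n) (Fin n) ℂ, ∀ X, φ X = (Y * X).trace := by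
    refine ⟨Matrix.of fun i j => φ (Matrix.single j i 1), fun X => ?_⟩
    conv_lhs => rw [Matrix.matrix_eq_sum_single X]
    simp only [map_sum, Matrix.trace, Matrix.diag, Matrix.mul_apply, Matrix.of_apply]
    rw [Finset.sum_comm]
    refine Finset.sum_congr rfl fun i _ => Finset.sum_congr rfl fun j _ => ?_
    have : Matrix.single j i (X j i) = X j i • Matrix.single j i (1 : ℂ) := by
      simp [Matrix.smul_single]
    rw [this, map_smul, smul_eq_mul, mul_comm]
  have hY0 : Y ≠ 0 := by
    rintro rfl
    apply hφ0
    ext X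
    simp [hY]
  have key : ∀ j : Fin q, Q (j + 1) * Y * P j * M' j = M j * (Q (j + 1) * Y * P j) := by
    intro j
    rw [← sub_eq_zero]
    apply (Matrix.ext_iff_trace_mul_right).mpr
    intro X
    have h1 : φ (D (Pi.single j ⟨interL (M j) (M' j) X, X, rfl⟩)) = 0 :=
      hφ ⟨_, rfl⟩
    rw [hDap, Finset.sum_eq_single j (by
      intro b _ hb
      rw [Pi.single_eq_of_ne hb]; simp) (by simp), Pi.single_eq_same, hY] at h1
    simp only [interL_apply] at h1
    rw [zero_mul, Matrix.trace_zero, ← h1, sub_mul, Matrix.trace_sub]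
    have e1 : Y * (P j * ((M' j * X - X * M j) * Q (j + 1))) =
      (Y * P j * M' j * X) * Q (j + 1) - (Y * P j * X) * (M j * Q (j + 1)) := by
      noncomm_ring
    rw [e1, Matrix.trace_sub, Matrix.trace_mul_comm _ (Q (j + 1)),
      Matrix.trace_mul_comm _ (M j * Q (j + 1))]
    simp only [mul_assoc]
  have hZ : ∀ k : ℕ, k ≤ q → Q k * Y * P k = Y := by
    intro k
    induction k with
    | zero => intro _; simp [P0, Q0]
    | succ k ih =>
      intro hk
      have := key ⟨k, hk⟩
      have h2 := Ps ⟨k, hk⟩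
      have h3 := Qs ⟨k, hk⟩
      simp only at this h2 h3
      have h4 := ih (by omega)
      rw [h3] at h4
      rw [h2, ← mul_assoc, this]
      simpa only [mul_assoc] using h4
  refine ⟨Y, hY0, fun j => ?_⟩
  have h1 := hZ j j.2.le
  have h2 := hZ (j + 1) j.2
  calc M j * Y = M j * (Q (j + 1) * Y * P (j + 1)) := by rw [h2]
    _ = (Q j * Y * P j) * M' j := by rw [Ps, Qs]; simp only [mul_assoc]
    _ = Y * M' j := by rw [h1]

/-- rigidity: uniqueness up to conjugacy, multiplicative version. For
conjugacy classes with generic eigenvalues and `d₁ + ⋯ + d_{p+1} = 2n² - 2`, two irreducible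
solutions of `M 1 ⋯ M (p+1) = I` in the same classes are simultaneously conjugate. -/
theorem stmt4 (n p : ℕ)
    (M M' : Fin (p + 1) → Matrix (Fin n) (Fin n) ℂ)
    (hunit : ∀ j, IsUnit (M j))
    (hcls : ∀ j, MatConj (M j) (M' j))
    (hgen : GenericMulRoots M)
    (hd : (∑ j, classDim (M j)) = 2 * n ^ 2 - 2)
    (hirr : IrreducibleTuple M) (hirr' : IrreducibleTuple M')
    (hprod : (List.ofFn M).prod = 1) (hprod' : (List.ofFn M').prod = 1) :
    ∃ S : (Matrix (Fin n) (Fin n) ℂ)ˣ,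
      ∀ j, M' j = S.val * M j * (S⁻¹).val := by
  rcases Nat.eq_zero_or_pos n with rfl | hn
  · exact ⟨1, fun j => Subsingleton.elim _ _⟩
  have hn2 : 0 < n ^ 2 := by positivity
  have hlt : ∑ j, Module.finrank ℂ (LinearMap.range (interL (M j) (M' j))) < 2 * n ^ 2 := by
    rw [Finset.sum_congr rfl fun j _ => finrank_range_interL _ _ (hcls j), hd]
    omega
  rcases scott_s4 M M' hprod hprod' hlt with ⟨X, hX, h⟩ | ⟨Y, hY, h⟩
  · obtain ⟨S, rfl⟩ := isUnit_of_intertwine M M' hirr X hX h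
    refine ⟨S, fun j => ?_⟩
    rw [← h j, mul_assoc, Units.mul_inv, mul_one]
  · obtain ⟨S, rfl⟩ := isUnit_of_intertwine M' M hirr' Y hY h
    refine ⟨S⁻¹, fun j => ?_⟩
    rw [inv_inv, mul_assoc, h j, ← mul_assoc, Units.inv_mul, one_mul]
end

section
/- Let Λ = (Λ₁,…,Λ_{p+1}) be a (p+1)-tuple of multiplicity vectors of size n with associated quantities r_j and d_j, and suppose n₁ := r₁ + … + r_{p+1} − n satisfies 1 ≤ n₁ < n and n − n₁ ≤ n − r_j for every j. Let Ψ(Λ) be the tuple of multiplicity vectors of size n₁ whose j-th member is (m_{1,j} − (n − n₁), m_{2,j}, …, m_{i_j,j}) rearranged in nonincreasing order with zero entries deleted, with associated quantities d′_j computed for size n₁. Then 2n² − Σ_{j=1}^{p+1} d_j = 2n₁² − Σ_{j=1}^{p+1} d′_j; in particular the quantity 2n² − Σ_j d_j is invariant under Ψ. -/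
open Matrix BigOperators

/-- `r` of a multiplicity vector (as a multiset): `n` minus the largest multiplicity. -/
def mvR (n : ℕ) (S : Multiset ℕ) : ℕ := n - S.sup

/-- `d` of a multiplicity vector: `n² - Σ mₖ²` (dimension of the conjugacy class). -/
def mvD (n : ℕ) (S : Multiset ℕ) : ℕ := n ^ 2 - (S.map fun m => m ^ 2).sum

def rSum {q : ℕ} (n : ℕ) (Λ : Fin q → Multiset ℕ) : ℕ := ∑ j, mvR n (Λ j)

/-- The map `Ψ` on one multiplicity vector: replace the largest multiplicity `m₁` by
`m₁ - (n - n₁)`, deleting it if it becomes `0`. -/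
def psiMV (n n₁ : ℕ) (S : Multiset ℕ) : Multiset ℕ :=
  Multiset.filter (fun m => 0 < m) ((S.sup - (n - n₁)) ::ₘ S.erase S.sup)

theorem sup_mem_aux (S : Multiset ℕ) : S ≠ 0 → S.sup ∈ S := by
  induction S using Multiset.induction_on with
  | empty => simp
  | cons a s ih =>
    intro _
    by_cases hs : s = 0
    · subst hs; simp
    · have h := ih hs
      rw [Multiset.sup_cons]
      rcases le_total a s.sup with h' | h'
      · rw [sup_eq_right.mpr h']; exact Multiset.mem_cons_of_mem h
      · rw [sup_eq_left.mpr h']; exact Multiset.mem_cons_self a s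

theorem coe_sq_aux (S : Multiset ℕ) :
    (S.map fun m => (m : ℤ) ^ 2).sum = (S.map fun m : ℕ => (m : ℤ) ^ 2).sum := by
  simp

theorem filter_sq_aux (S : Multiset ℕ) :
    ((Multiset.filter (fun m => 0 < m) S).map fun m : ℕ => (m : ℤ) ^ 2).sum =
      (S.map fun m : ℕ => (m : ℤ) ^ 2).sum := by
  induction S using Multiset.induction_on with
  | empty => simp
  | cons a s ih =>
    rcases Nat.eq_zero_or_pos a with h | h
    · subst h; simp [ih]
    · rw [Multiset.filter_cons_of_pos (p := fun m => 0 < m) _ h]; simp [ih]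

/-- invariance of `2n² - Σ d_j` under the construction `Ψ`. -/
theorem stmt6 (n n₁ p : ℕ)
    (Λ : Fin (p + 1) → Multiset ℕ)
    (hpos : ∀ j, ∀ m ∈ Λ j, 0 < m)
    (hsum : ∀ j, (Λ j).sum = n)
    (hdef : rSum n Λ = n + n₁)
    (h1 : 1 ≤ n₁) (h2 : n₁ < n)
    (hβ : ∀ j, n - n₁ ≤ n - mvR n (Λ j)) :
    2 * (n : ℤ) ^ 2 - ∑ j, ((n : ℤ) ^ 2 - ((Λ j).map fun m => (m : ℤ) ^ 2).sum) =
      2 * (n₁ : ℤ) ^ 2 -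
        ∑ j, ((n₁ : ℤ) ^ 2 - ((psiMV n n₁ (Λ j)).map fun m => (m : ℤ) ^ 2).sum) := by
  have key : ∀ j, ((n : ℤ) ^ 2 - ((Λ j).map fun m => (m : ℤ) ^ 2).sum) =
      ((n₁ : ℤ) ^ 2 - ((psiMV n n₁ (Λ j)).map fun m => (m : ℤ) ^ 2).sum) +
        2 * ((n : ℤ) - n₁) * (mvR n (Λ j) : ℤ) := by
    intro j
    have hne : Λ j ≠ 0 := by
      intro h
      have := hsum j
      rw [h] at this
      simp at this
      omega
    have hmem := sup_mem_aux _ hne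
    have hle : (Λ j).sup ≤ n := (hsum j) ▸ Multiset.single_le_sum (by simp) _ hmem
    have hb := hβ j
    unfold psiMV
    rw [coe_sq_aux, coe_sq_aux, filter_sq_aux]
    unfold mvR at hb ⊢
    have e : ((Λ j).map fun m : ℕ => (m : ℤ) ^ 2).sum =
        ((Λ j).sup : ℤ) ^ 2 + (((Λ j).erase (Λ j).sup).map fun m : ℕ => (m : ℤ) ^ 2).sum := by
      conv_lhs => rw [← Multiset.cons_erase hmem]
      simp
    rw [e, Multiset.map_cons, Multiset.sum_cons, Nat.cast_sub (by omega), Nat.cast_sub h2.le,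
      Nat.cast_sub hle]
    ring
  have hd : (∑ j, (mvR n (Λ j) : ℤ)) = n + n₁ := by
    unfold rSum at hdef
    exact_mod_cast hdef
  rw [Finset.sum_congr rfl (fun j _ => key j), Finset.sum_add_distrib, ← Finset.mul_sum, hd]
  ring
end

section
/- Let k ≥ 1 and n = 3k + 1. For every choice of generic eigenvalues compatible with the triple of multiplicity vectors W_k : Λ₁ = Λ₂ = Λ₃ = (k+1, k, k), there exists an irreducible triple of diagonalizable matrices A₁, A₂, A₃ ∈ gl(n,ℂ) with A₁ + A₂ + A₃ = 0, where each A_j has three distinct eigenvalues with multiplicities k+1, k, k equal to the chosen generic eigenvalues. (This triple of multiplicity vectors is rigid: d₁ + d₂ + d₃ = 2n² − 2.) -/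
open Matrix BigOperators

/-- The multiset of multiplicities of the distinct values of `d : Fin n → ℂ`
(the multiplicity vector of the diagonal matrix with diagonal `d`). -/
noncomputable def evCounts {n : ℕ} (d : Fin n → ℂ) : Multiset ℕ := by
  classical exact (Finset.univ.image d).val.map fun σ => (Finset.univ.filter fun k => d k = σ).card

/-- Genericity of the eigenvalue families `d j` (eigenvalues listed with multiplicity):
no partial sums, with `κ` eigenvalues chosen from each family, `1 ≤ κ ≤ n-1`, vanish. -/
def GenericAddEV {q n : ℕ} (d : Fin q → Fin n → ℂ) : Prop :=
  ∀ κ : ℕ, 1 ≤ κ → κ ≤ n - 1 →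
    ∀ Φ : Fin q → Finset (Fin n), (∀ j, (Φ j).card = κ) →
      (∑ j, ∑ k ∈ Φ j, d j k) ≠ 0

open Module in
/-- `T` is diagonalizable with eigenvalue multiset `M` (stated through dimension bounds). -/
def DiagWith {V : Type} [AddCommGroup V] [Module ℂ V] (T : Module.End ℂ V) (M : Multiset ℂ) : Prop :=
  M.card = finrank ℂ V ∧ ∀ σ, M.count σ ≤ finrank ℂ (T.eigenspace σ)

open Module in
lemma DiagWith.exists_basis {V : Type} [AddCommGroup V] [Module ℂ V] [FiniteDimensional ℂ V]
    {T : Module.End ℂ V} {M : Multiset ℂ} (h : DiagWith T M) {ι : Type} [Fintype ι] (d : ι → ℂ)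
    (hd : Finset.univ.val.map d = M) :
    ∃ b : Basis ι ℂ V, ∀ i, T (b i) = d i • b i := by
  classical
  have hfam : ∀ σ, ∃ v : {i // d i = σ} → T.eigenspace σ, LinearIndependent ℂ v := by
    intro σ
    have hc : Fintype.card {i // d i = σ} ≤ Fintype.card (Fin (finrank ℂ (T.eigenspace σ))) := by
      have := h.2 σ
      rw [← hd, Multiset.count_map] at this
      rw [Fintype.card_fin, Fintype.card_subtype]
      refine le_trans (le_of_eq ?_) this
      rw [← Finset.filter_val, Finset.card_val]
      congr 1
      ext i
      simp [eq_comm]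
    obtain ⟨e⟩ := Function.Embedding.nonempty_of_card_le hc
    exact ⟨_, (finBasis ℂ (T.eigenspace σ)).linearIndependent.comp e e.injective⟩
  choose v hv using hfam
  have hli : LinearIndependent ℂ
      (fun ji : Σ σ : ℂ, {i // d i = σ} => ((v ji.1 ji.2 : T.eigenspace ji.1) : V)) := by
    refine linearIndependent_iUnion_finite
      (f := fun (σ : ℂ) (i : {i // d i = σ}) => ((v σ i : T.eigenspace σ) : V)) ?_ ?_
    · intro σ
      exact (hv σ).map' (T.eigenspace σ).subtype (Submodule.ker_subtype _)
    · intro σ t _ hσ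
      have hle : ∀ τ, Submodule.span ℂ (Set.range fun i : {i // d i = τ} =>
          ((v τ i : T.eigenspace τ) : V)) ≤ T.eigenspace τ := by
        intro τ
        rw [Submodule.span_le]
        rintro _ ⟨i, rfl⟩
        exact (v τ i).2
      exact (T.eigenspaces_iSupIndep.disjoint_biSup hσ).mono (hle σ)
        (iSup₂_mono fun τ _ => hle τ)
  have hli2 := hli.comp (fun i : ι => (⟨d i, ⟨i, rfl⟩⟩ : Σ σ : ℂ, {i // d i = σ})) (by
    intro i j hij
    simp only [Sigma.mk.injEq] at hij
    obtain ⟨h1, h2⟩ := hij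
    have : ∀ σ τ (x : {i // d i = σ}) (y : {i // d i = τ}), σ = τ → HEq x y → x.1 = y.1 := by
      rintro σ τ x y rfl h
      rw [eq_of_heq h]
    exact this _ _ _ _ h1 h2)
  have hcard : Fintype.card ι = finrank ℂ V := by
    rw [← h.1, ← hd]; simp
  refine ⟨basisOfLinearIndependentOfCardEqFinrank' _ hli2 hcard, fun i => ?_⟩
  rw [coe_basisOfLinearIndependentOfCardEqFinrank']
  exact Module.End.mem_eigenspace_iff.1 (v (d i) ⟨i, rfl⟩).2

open Module in
lemma DiagWith.finrank_range {V : Type} [AddCommGroup V] [Module ℂ V] [FiniteDimensional ℂ V]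
    {T : Module.End ℂ V} {m : ℕ} {N : Multiset ℂ} (h : DiagWith T (Multiset.replicate m 0 + N))
    (h0 : (0 : ℂ) ∉ N) : finrank ℂ (LinearMap.range T) = N.card := by
  classical
  apply le_antisymm
  · have h1 := h.1
    have h2 := h.2 0
    have h3 := LinearMap.finrank_range_add_finrank_ker T
    rw [Module.End.eigenspace_zero] at h2
    simp only [Multiset.card_add, Multiset.card_replicate, Multiset.count_add,
      Multiset.count_replicate_self] at h1 h2
    omega
  · obtain ⟨b, hb⟩ := h.exists_basis (ι := Fin m ⊕ N.ToType) (Sum.elim (fun _ => 0) (fun x => x.1))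
      (by
        rw [← Finset.univ_disjSum_univ, Finset.val_disjSum, Multiset.disjSum, Multiset.map_add,
          Multiset.map_map, Multiset.map_map]
        congr 1
        · simp
        · simp)
    have hx : ∀ x : N.ToType, x.1 ≠ 0 := fun x hx => h0 (hx ▸ Multiset.coe_mem)
    have hr : ∀ x : N.ToType, b (Sum.inr x) ∈ LinearMap.range T := by
      intro x
      refine ⟨(x.1)⁻¹ • b (Sum.inr x), ?_⟩
      rw [map_smul, hb, smul_smul]
      simp [hx x]
    have hli : LinearIndependent ℂ
        (fun x : N.ToType => (⟨b (Sum.inr x), hr x⟩ : LinearMap.range T)) := by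
      apply LinearIndependent.of_comp (LinearMap.range T).subtype
      exact b.linearIndependent.comp Sum.inr Sum.inr_injective
    have := hli.fintype_card_le_finrank
    rwa [Multiset.card_coe] at this

open Module in
/-- There are diagonalizable operators with eigenvalue multisets `M j` and sum `t`. -/
def Sol (M : Fin 3 → Multiset ℂ) (t : ℂ) : Prop :=
  ∃ (V : Type) (_ : AddCommGroup V) (_ : Module ℂ V) (_ : FiniteDimensional ℂ V)
    (T : Fin 3 → Module.End ℂ V), (∀ v, ∑ j, T j v = t • v) ∧ ∀ j, DiagWith (T j) (M j)

lemma Sol.shift {M : Fin 3 → Multiset ℂ} {t : ℂ} (h : Sol M t) (x : Fin 3 → ℂ) :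
    Sol (fun j => (M j).map (· + x j)) (t + ∑ j, x j) := by
  classical
  obtain ⟨V, i1, i2, i3, T, hT, hM⟩ := h
  refine ⟨V, i1, i2, i3, fun j => T j + x j • 1, ?_, fun j => ⟨?_, fun σ => ?_⟩⟩
  · intro v
    simp [Finset.sum_add_distrib, hT, add_smul, Finset.sum_smul]
  · rw [Multiset.card_map, (hM j).1]
  · have h1 : Multiset.count σ ((M j).map (· + x j)) = (M j).count (σ - x j) := by
      conv_lhs => rw [show σ = (σ - x j) + x j by ring]
      exact Multiset.count_map_eq_count' _ _ (add_left_injective (x j)) _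
    have h2 : (T j + x j • 1).eigenspace σ = (T j).eigenspace (σ - x j) := by
      ext v
      simp [sub_smul, eq_sub_iff_add_eq]
    rw [h1, h2]
    exact (hM j).2 _

open Module in
lemma Sol.reflect {N : Fin 3 → Multiset ℂ} {t : ℂ} (m m' : Fin 3 → ℕ) (n n' : ℕ)
    (h : Sol (fun j => Multiset.replicate (m j) 0 + N j) t) (ht : t ≠ 0)
    (hN0 : ∀ j, (0 : ℂ) ∉ N j) (hNt : ∀ j, t ∉ N j) (hn : ∀ j, m j + (N j).card = n)
    (hn' : ∀ j, m' j + (N j).card = n') (hnn : n + n' = ∑ j, (N j).card) :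
    Sol (fun j => Multiset.replicate (m' j) 0 + (N j).map (· - t)) (-t) := by
  classical
  obtain ⟨V, i1, i2, i3, T, hT, hM⟩ := h
  have hr : ∀ j, finrank ℂ (LinearMap.range (T j)) = (N j).card :=
    fun j => (hM j).finrank_range (hN0 j)
  have hV : finrank ℂ V = n := by
    have := (hM 0).1
    rw [← this, ← hn 0]; simp
  let W := ∀ j, LinearMap.range (T j)
  let π : W →ₗ[ℂ] V := ∑ j, (LinearMap.range (T j)).subtype ∘ₗ LinearMap.proj j
  have hπ : ∀ w : W, π w = ∑ j, (w j : V) := by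
    intro w
    simp [π]
    rfl
  have hsurj : LinearMap.range π = ⊤ := by
    rw [LinearMap.range_eq_top]
    intro v
    refine ⟨fun j => ⟨T j (t⁻¹ • v), LinearMap.mem_range_self _ _⟩, ?_⟩
    rw [hπ]
    simp only
    rw [hT, smul_smul, mul_inv_cancel₀ ht, one_smul]
  have hker : finrank ℂ (LinearMap.ker π) = n' := by
    have h1 := LinearMap.finrank_range_add_finrank_ker π
    rw [hsurj, finrank_top, hV] at h1
    have h2 : finrank ℂ W = ∑ j, (N j).card := by
      rw [Module.finrank_pi_fintype]
      exact Finset.sum_congr rfl fun j _ => hr j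
    omega
  let F0 : ∀ j, LinearMap.range (T j) →ₗ[ℂ] W := fun j =>
    LinearMap.pi (fun i => (T i).rangeRestrict ∘ₗ (LinearMap.range (T j)).subtype)
      - t • LinearMap.single ℂ (fun i => LinearMap.range (T i)) j
  have hF0 : ∀ j u i, ((F0 j u i : LinearMap.range (T i)) : V)
      = T i u - t • (if i = j then (u : V) else 0) := by
    intro j u i
    by_cases hij : i = j
    · subst hij; simp [F0]
    · simp [F0, hij]
  have hF0k : ∀ j u, F0 j u ∈ LinearMap.ker π := by
    intro j u
    rw [LinearMap.mem_ker, hπ]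
    simp only [hF0]
    rw [Finset.sum_sub_distrib, hT, ← Finset.smul_sum]
    simp
  let F : ∀ j, LinearMap.range (T j) →ₗ[ℂ] LinearMap.ker π := fun j =>
    (F0 j).codRestrict _ (hF0k j)
  have hF : ∀ j u i, (((F j u : W) i : LinearMap.range (T i)) : V)
      = T i u - t • (if i = j then (u : V) else 0) := fun j u i => hF0 j u i
  let S : Fin 3 → Module.End ℂ (LinearMap.ker π) := fun j =>
    F j ∘ₗ LinearMap.proj j ∘ₗ (LinearMap.ker π).subtype
  have hS : ∀ j w, S j w = F j ((w : W) j) := fun j w => rfl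
  refine ⟨LinearMap.ker π, inferInstance, inferInstance, inferInstance, S, ?_, ?_⟩
  · intro w
    apply Subtype.ext
    funext i
    apply Subtype.ext
    have hw : ∑ j, ((w : W) j : V) = 0 := by rw [← hπ]; exact w.2
    have e1 : (((∑ j, S j w : LinearMap.ker π) : W) i : V)
        = ∑ j, (((S j w : LinearMap.ker π) : W) i : V) :=
      map_sum ((LinearMap.range (T i)).subtype ∘ₗ
        (LinearMap.proj i : W →ₗ[ℂ] LinearMap.range (T i)) ∘ₗ (LinearMap.ker π).subtype) (fun j => S j w) Finset.univ
    rw [e1]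
    simp only [hS, hF]
    rw [Finset.sum_sub_distrib, ← map_sum, hw, ← Finset.smul_sum]
    simp
    rfl
  · intro j
    refine ⟨?_, fun σ => ?_⟩
    · rw [hker, ← hn' j]; simp
    · rw [Multiset.count_add]
      have hc : Multiset.count σ ((N j).map (· - t)) = (N j).count (σ + t) := by
        conv_lhs => rw [show σ = (σ + t) - t by ring]
        exact Multiset.count_map_eq_count' _ _ (sub_left_injective (b := t)) _
      rw [hc]
      by_cases hσ : σ = 0
      · subst hσ
        rw [zero_add, Multiset.count_eq_zero_of_notMem (hNt j), Multiset.count_replicate_self,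
          Module.End.eigenspace_zero]
        have h1 := LinearMap.finrank_range_add_finrank_ker (S j)
        have h2 : finrank ℂ (LinearMap.range (S j)) ≤ (N j).card := by
          rw [← hr j]
          refine le_trans (Submodule.finrank_mono (LinearMap.range_comp_le_range _ _)) ?_
          exact LinearMap.finrank_range_le _
        have := hn' j
        omega
      · rw [Multiset.count_replicate, if_neg (Ne.symm hσ), zero_add]
        by_cases hσt : σ + t = 0
        · rw [hσt, Multiset.count_eq_zero_of_notMem (hN0 j)]; exact Nat.zero_le _
        refine le_trans (le_trans ?_ ((hM j).2 (σ + t))) ?_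
        · rw [Multiset.count_add]; omega
        · have hmem : ∀ u : (T j).eigenspace (σ + t), (u : V) ∈ LinearMap.range (T j) := by
            intro u
            refine ⟨(σ + t)⁻¹ • (u : V), ?_⟩
            rw [map_smul, Module.End.mem_eigenspace_iff.1 u.2, smul_smul, inv_mul_cancel₀ hσt,
              one_smul]
          let I : (T j).eigenspace (σ + t) →ₗ[ℂ] LinearMap.range (T j) :=
            Submodule.inclusion (fun u hu => hmem ⟨u, hu⟩)
          have hI : ∀ u, ((I u : LinearMap.range (T j)) : V) = u := fun u => rfl
          have hIj : ∀ u, ((F j (I u) : W) j) = σ • I u := by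
            intro u
            apply Subtype.ext
            rw [hF, hI, Module.End.mem_eigenspace_iff.1 u.2]
            simp only [if_true, Submodule.coe_smul, hI]
            rw [add_smul, add_sub_cancel_right]
          have hmem2 : ∀ u, F j (I u) ∈ (S j).eigenspace σ := by
            intro u
            rw [Module.End.mem_eigenspace_iff, hS, hIj, map_smul]
          let G : (T j).eigenspace (σ + t) →ₗ[ℂ] (S j).eigenspace σ :=
            (F j ∘ₗ I).codRestrict _ hmem2
          apply LinearMap.finrank_le_finrank_of_injective (f := G)
          refine (injective_iff_map_eq_zero G).2 ?_
          intro u hu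
          have h1 : F j (I u) = 0 := congrArg Subtype.val hu
          have h2 := hIj u
          rw [h1] at h2
          have h3 : σ • I u = 0 := h2.symm
          have h4 : I u = 0 := (smul_eq_zero.1 h3).resolve_left hσ
          apply Subtype.ext
          rw [← hI, h4]; rfl

/-- The genericity conditions that are needed in the induction. -/
structure GenH (k : ℕ) (a b c : Fin 3 → ℂ) (D : ℂ) : Prop where
  hD : D = ∑ j, a j + ∑ j, b j + ∑ j, c j
  hD0 : D ≠ 0
  hs : ∑ j, a j = - (k : ℂ) * D
  hba : ∀ j, ∀ m : ℕ, m ≤ k → b j - a j - m * D ≠ 0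
  hca : ∀ j, ∀ m : ℕ, m ≤ k → c j - a j - m * D ≠ 0
  hbc : 1 ≤ k → ∀ j, b j - c j ≠ 0
  hac : 1 ≤ k → ∀ j, ∑ i, c i + a j - c j ≠ 0
  hsc : ∀ m : ℕ, m < k → ∑ j, a j + ∑ j, c j + m * D ≠ 0
  hsb : ∀ m : ℕ, m < k → ∑ j, a j + ∑ j, b j + m * D ≠ 0
  hbcu : ∀ j, ∀ m : ℕ, m < k → b j - c j + ∑ j, a j + ∑ j, c j + m * D ≠ 0

lemma GenH.step {k : ℕ} {a b c : Fin 3 → ℂ} {D : ℂ} (h : GenH (k + 1) a b c D) :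
    GenH k (fun j => a j + D / 3) (fun j => 2 * a j - b j - ∑ i, a i + D / 3)
      (fun j => a j - b j + c j - ∑ i, a i - ∑ i, c i + D / 3) D := by
  obtain ⟨hD, hD0, hs, hba, hca, hbc, hac, hsc, hsb, hbcu⟩ := h
  have hsA : ∑ j, (a j + D / 3) = ∑ j, a j + D := by
    simp [Finset.sum_add_distrib]; ring
  have hsB : ∑ j, (2 * a j - b j - ∑ i, a i + D / 3) = - ∑ j, a j - ∑ j, b j + D := by
    simp [Finset.sum_add_distrib, Finset.sum_sub_distrib, ← Finset.mul_sum]; ring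
  have hsC : ∑ j, (a j - b j + c j - ∑ i, a i - ∑ i, c i + D / 3)
      = - ∑ j, c j - ∑ j, a j := by
    simp [Finset.sum_add_distrib, Finset.sum_sub_distrib]
    linear_combination hD
  generalize hα : ∑ j, a j = α at *
  generalize hβ : ∑ j, b j = β at *
  generalize hγ : ∑ j, c j = γ at *
  push_cast at hs
  constructor
  · rw [hsA, hsB, hsC]; linear_combination -hD
  · exact hD0
  · rw [hsA]; linear_combination hs
  · intro j m hm e
    obtain ⟨r, rfl⟩ := Nat.exists_eq_add_of_le hm
    apply hba j (r + 1) (by omega)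
    push_cast at *
    linear_combination -e - hs
  · intro j m hm e
    apply hbcu j m (by omega)
    linear_combination -e
  · intro _ j e
    apply hac (by omega) j
    linear_combination e
  · intro _ j e
    rw [hsC] at e
    apply hbc (by omega) j
    linear_combination e
  · intro m hm e
    rw [hsA, hsC] at e
    apply hsb m (by omega)
    linear_combination e - hD
  · intro m hm e
    rw [hsA, hsB] at e
    apply hsc (m + 1) (by omega)
    push_cast
    linear_combination e - hD
  · intro j m hm e
    rw [hsA, hsC] at e
    apply hca j (m + 1) (by omega)
    push_cast
    linear_combination -e

lemma exists_sol (k : ℕ) : ∀ (a b c : Fin 3 → ℂ) (D : ℂ), GenH k a b c D →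
    Sol (fun j => Multiset.replicate (k + 1) (a j) + Multiset.replicate k (b j)
      + Multiset.replicate k (c j)) 0 := by
  induction k with
  | zero =>
    intro a b c D h
    refine ⟨ℂ, inferInstance, inferInstance, inferInstance, fun j => a j • 1, ?_, fun j => ⟨?_, ?_⟩⟩
    · intro v
      have := h.hs
      simp only [Nat.cast_zero, neg_zero, zero_mul] at this
      simp only [LinearMap.smul_apply, Module.End.one_apply]
      rw [← Finset.sum_smul, this]
    · simp
    · intro σ
      simp only [zero_add, Multiset.replicate_one, Multiset.replicate_zero, add_zero]
      rw [Multiset.count_singleton]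
      split_ifs with hσ
      · subst hσ
        have : (a j • (1 : Module.End ℂ ℂ)).eigenspace (a j) = ⊤ := by
          ext v; simp
        rw [this, finrank_top]; simp
      · exact Nat.zero_le _
  | succ k ih =>
    intro a b c D h
    have h1 := ih _ _ _ _ h.step
    obtain ⟨hD, hD0, hs, hba, hca, hbc, hac, hsc, hsb, hbcu⟩ := h
    have hs0 : ∑ j, a j ≠ 0 := by
      rw [hs]
      exact mul_ne_zero (neg_ne_zero.2 (Nat.cast_ne_zero.2 (by omega))) hD0
    have hsum : ∑ j, (-(a j + D / 3 - b j + c j - ∑ i, a i - ∑ i, c i))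
        = ∑ i, a i + ∑ i, c i := by
      simp [Finset.sum_add_distrib, Finset.sum_sub_distrib]
      linear_combination -hD
    have hsum2 : ∑ j, (c j - a j + ∑ i, a i) = ∑ j, c j + 2 * ∑ i, a i := by
      simp [Finset.sum_add_distrib, Finset.sum_sub_distrib]
      ring
    have h2 := h1.shift (fun j => -(a j + D / 3 - b j + c j - ∑ i, a i - ∑ i, c i))
    rw [hsum, zero_add] at h2
    generalize hα : ∑ j, a j = α at *
    generalize hβ : ∑ j, b j = β at *
    generalize hγ : ∑ j, c j = γ at *
    have h3 : Sol (fun j => Multiset.replicate k 0 +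
        (Multiset.replicate (k + 1) (b j - c j + α + γ) +
          Multiset.replicate k (γ + a j - c j))) (α + γ) := by
      convert h2 using 2 with j
      simp only [Multiset.map_add, Multiset.map_replicate]
      rw [add_comm]
      congr 3 <;> ring
    have e0 := hsc 0 (by omega)
    have h4 := h3.reflect (fun _ => k) (fun _ => k + 1) (3 * k + 1) (3 * k + 2)
      (by simpa using e0)
      (by
        intro j hj
        rcases Multiset.mem_add.1 hj with hj | hj
        · apply hbcu j 0 (by omega)
          simpa using (Multiset.eq_of_mem_replicate hj).symm
        · apply hac (by omega) j
          simpa using (Multiset.eq_of_mem_replicate hj).symm)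
      (by
        intro j hj
        rcases Multiset.mem_add.1 hj with hj | hj
        · apply hbc (by omega) j
          linear_combination -(Multiset.eq_of_mem_replicate hj)
        · apply hca j (k + 1) (by omega)
          linear_combination (Multiset.eq_of_mem_replicate hj) - hs)
      (by intro j; simp; ring) (by intro j; simp; ring)
      (by simp; ring)
    have h5 := h4.shift (fun j => c j - a j + α)
    rw [hsum2] at h5
    have h6 : Sol (fun j => Multiset.replicate k 0 +
        (Multiset.replicate (k + 1) (b j - a j + α) +
          Multiset.replicate (k + 1) (c j - a j + α))) α := by
      convert h5 using 2 with j
      · simp only [Multiset.map_add, Multiset.map_replicate]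
        rw [show b j - c j + α + γ - (α + γ) + (c j - a j + α) = b j - a j + α by ring,
          show γ + a j - c j - (α + γ) + (c j - a j + α) = 0 by ring, zero_add]
        abel
      · ring
    have h7 := h6.reflect (fun _ => k) (fun _ => k + 2) (3 * k + 2) (3 * k + 4) hs0
      (by
        intro j hj
        rcases Multiset.mem_add.1 hj with hj | hj
        · apply hba j (k + 1) (by omega)
          linear_combination -(Multiset.eq_of_mem_replicate hj) - hs
        · apply hca j (k + 1) (by omega)
          linear_combination -(Multiset.eq_of_mem_replicate hj) - hs)
      (by
        intro j hj
        rcases Multiset.mem_add.1 hj with hj | hj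
        · apply hba j 0 (by omega)
          push_cast
          linear_combination -(Multiset.eq_of_mem_replicate hj)
        · apply hca j 0 (by omega)
          push_cast
          linear_combination -(Multiset.eq_of_mem_replicate hj))
      (by intro j; simp; ring) (by intro j; simp; ring)
      (by simp; ring)
    have h8 := h7.shift a
    convert h8 using 2 with j
    · simp only [Multiset.map_add, Multiset.map_replicate, ← add_assoc]
      congr 3 <;> ring
    · rw [hα]; ring

lemma evCounts_split {n k : ℕ} {d : Fin n → ℂ}
    (h : evCounts d = ({k + 1, k, k} : Multiset ℕ)) :
    ∃ a b c : ℂ, a ≠ b ∧ a ≠ c ∧ b ≠ c ∧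
      Finset.univ.val.map d = Multiset.replicate (k + 1) a + Multiset.replicate k b
        + Multiset.replicate k c := by
  classical
  unfold evCounts at h
  set s := (Finset.univ.image d).val with hs
  have hnd : s.Nodup := (Finset.univ.image d).nodup
  have hmem : ∀ i, d i ∈ s := fun i => Finset.mem_image_of_mem d (Finset.mem_univ i)
  rw [Multiset.insert_eq_cons, Multiset.insert_eq_cons] at h
  obtain ⟨a, ha, hca, h⟩ := (Multiset.map_eq_cons _ _ _ _).2 h
  obtain ⟨b, hb, hcb, h⟩ := (Multiset.map_eq_cons _ _ _ _).2 h
  obtain ⟨c, hc, hcc⟩ := Multiset.map_eq_singleton.1 h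
  have e1 : s.erase a = b ::ₘ {c} := by rw [← hc, Multiset.cons_erase hb]
  have e2 : s = a ::ₘ b ::ₘ {c} := by rw [← e1, Multiset.cons_erase ha]
  rw [e2] at hnd hmem
  simp only [Multiset.nodup_cons, Multiset.mem_cons, Multiset.mem_singleton, not_or] at hnd hmem
  obtain ⟨⟨hab, hac⟩, hbc, -⟩ := hnd
  refine ⟨a, b, c, hab, hac, hbc, ?_⟩
  have hcount : ∀ σ, Multiset.count σ (Finset.univ.val.map d)
      = (Finset.univ.filter fun i => d i = σ).card := by
    intro σ
    rw [Multiset.count_map, ← Finset.filter_val, Finset.card_val]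
    congr 1
    ext i
    simp [eq_comm]
  ext σ
  simp only [Multiset.count_add, Multiset.count_replicate]
  rw [hcount]
  by_cases h1 : a = σ
  · subst h1
    simp [Ne.symm hab, Ne.symm hac, hca]
  by_cases h2 : b = σ
  · subst h2
    simp [Ne.symm hbc, hab, hcb]
  by_cases h3 : c = σ
  · subst h3
    simp [hbc, hac, hcc]
  simp only [h1, h2, h3, if_false, add_zero, Finset.card_eq_zero]
  ext i
  simp only [Finset.mem_filter, Finset.mem_univ, true_and, Finset.notMem_empty, iff_false]
  rintro rfl
  rcases hmem i with h | h | h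
  · exact h1 h.symm
  · exact h2 h.symm
  · exact h3 h.symm

lemma exists_le_map_eq {α β : Type} (f : α → β) (u : Multiset β) :
    ∀ s : Multiset α, u ≤ s.map f → ∃ v, v ≤ s ∧ v.map f = u := by
  induction u using Multiset.induction with
  | empty => exact fun s _ => ⟨0, Multiset.zero_le _, rfl⟩
  | cons x u ih =>
    intro s h
    obtain ⟨i, hi, rfl⟩ := Multiset.mem_map.1 (Multiset.mem_of_le h (Multiset.mem_cons_self x u))
    obtain ⟨s, rfl⟩ := Multiset.exists_cons_of_mem hi
    rw [Multiset.map_cons, Multiset.cons_le_cons_iff] at h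
    obtain ⟨v, hv, rfl⟩ := ih s h
    exact ⟨i ::ₘ v, Multiset.cons_le_cons _ hv, Multiset.map_cons _ _ _⟩

lemma exists_subset_sum {n k : ℕ} {d : Fin n → ℂ} {a b c : ℂ}
    (h : Finset.univ.val.map d = Multiset.replicate (k + 1) a + Multiset.replicate k b
        + Multiset.replicate k c) {x y z : ℕ} (hx : x ≤ k + 1) (hy : y ≤ k) (hz : z ≤ k) :
    ∃ Φ : Finset (Fin n), Φ.card = x + y + z ∧ ∑ i ∈ Φ, d i = x * a + y * b + z * c := by
  have hle : Multiset.replicate x a + Multiset.replicate y b + Multiset.replicate z c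
      ≤ Finset.univ.val.map d := by
    rw [h]
    exact add_le_add (add_le_add (Multiset.replicate_mono _ hx) (Multiset.replicate_mono _ hy))
      (Multiset.replicate_mono _ hz)
  obtain ⟨u, hu, hu2⟩ : ∃ u, u ≤ (Finset.univ : Finset (Fin n)).val ∧ u.map d =
      Multiset.replicate x a + Multiset.replicate y b + Multiset.replicate z c := exists_le_map_eq d _ _ hle
  refine ⟨⟨u, Multiset.nodup_of_le hu Finset.univ.nodup⟩, ?_, ?_⟩
  · have := congrArg Multiset.card hu2
    simpa using this
  · have := congrArg Multiset.sum hu2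
    rw [Finset.sum]
    simpa using this

open Module in
/-- Genericity forces irreducibility. -/
lemma irreducible_of_generic_s8 {n : ℕ} {d : Fin 3 → Fin n → ℂ} (hgen : GenericAddEV d)
    {A : Fin 3 → Matrix (Fin n) (Fin n) ℂ} (hA : ∑ j, A j = 0)
    (hb : ∀ j, ∃ b : Basis (Fin n) ℂ (Fin n → ℂ), ∀ i, Matrix.mulVecLin (A j) (b i) = d j i • b i) :
    IrreducibleTuple A := by
  classical
  intro V hV
  by_contra hne
  rw [not_or] at hne
  let Q := (Fin n → ℂ) ⧸ V
  let S : Fin 3 → Module.End ℂ Q := fun j =>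
    V.mapQ V (Matrix.mulVecLin (A j)) (Submodule.map_le_iff_le_comap.1 (hV j))
  have hS : ∑ j, S j = 0 := by
    have : ∀ v : Fin n → ℂ, (∑ j, S j) (V.mkQ v) = V.mkQ ((∑ j, A j) *ᵥ v) := by
      intro v
      rw [LinearMap.sum_apply, Matrix.sum_mulVec, map_sum]
      rfl
    rw [hA] at this
    apply LinearMap.ext
    intro q
    obtain ⟨v, rfl⟩ := V.mkQ_surjective q
    rw [this, Matrix.zero_mulVec, map_zero, LinearMap.zero_apply]
  have hdim : finrank ℂ Q + finrank ℂ V = n := by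
    rw [Submodule.finrank_quotient_add_finrank]; simp
  have hV1 : finrank ℂ V ≠ 0 := fun h => hne.1 (Submodule.finrank_eq_zero.1 h)
  have hQ1 : finrank ℂ Q ≠ 0 := by
    intro h
    apply hne.2
    apply Submodule.eq_top_of_finrank_eq
    simp; omega
  have key : ∀ j, ∃ Φ : Finset (Fin n), Φ.card = finrank ℂ Q ∧
      LinearMap.trace ℂ Q (S j) = ∑ i ∈ Φ, d j i := by
    intro j
    obtain ⟨b, hb⟩ := hb j
    obtain ⟨κ, e, he, hsp, hli⟩ := exists_linearIndependent' ℂ (fun i => V.mkQ (b i))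
    have htop : Submodule.span ℂ (Set.range fun i => V.mkQ (b i)) = ⊤ := by
      have : (Set.range fun i => V.mkQ (b i)) = V.mkQ '' Set.range b := by
        rw [← Set.range_comp]; rfl
      rw [this, Submodule.span_image, b.span_eq, Submodule.map_top, Submodule.range_mkQ]
    rw [htop] at hsp
    have : Finite κ := Finite.of_injective e he
    have : Fintype κ := Fintype.ofFinite κ
    let B : Basis κ ℂ Q := Basis.mk hli hsp.ge
    have hB : ∀ i, S j (B i) = d j (e i) • B i := by
      intro i
      simp only [B, Basis.mk_apply, Function.comp]
      rw [← map_smul, ← hb]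
      rfl
    refine ⟨Finset.univ.map ⟨e, he⟩, ?_, ?_⟩
    · rw [Finset.card_map, finrank_eq_card_basis B, Finset.card_univ]
    · rw [LinearMap.trace_eq_matrix_trace ℂ B, Matrix.trace, Finset.sum_map]
      apply Finset.sum_congr rfl
      intro i _
      rw [Matrix.diag_apply, LinearMap.toMatrix_apply, hB]
      simp
  choose Φ hΦ hΦ2 using key
  apply hgen (finrank ℂ Q) (by omega) (by omega) Φ hΦ
  simp only [← hΦ2]
  rw [← map_sum, hS, map_zero]

/-- existence of the rigid series `W_k`, `n = 3k+1`, PMV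
`(k+1,k,k), (k+1,k,k), (k+1,k,k)`. Here `d j` lists the eigenvalues of the `j`-th matrix
with multiplicity; `evCounts (d j) = {k+1, k, k}` says each matrix has three distinct
eigenvalues of multiplicities `k+1, k, k`. -/
theorem stmt8 (k : ℕ) (hk : 1 ≤ k) (n : ℕ) (hn : n = 3 * k + 1)
    (d : Fin 3 → Fin n → ℂ)
    (hmv : ∀ j, evCounts (d j) = ({k + 1, k, k} : Multiset ℕ))
    (hsum : (∑ j, ∑ i, d j i) = 0)
    (hgen : GenericAddEV d) :
    ∃ A : Fin 3 → Matrix (Fin n) (Fin n) ℂ,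
      (∑ j, A j) = 0 ∧ IrreducibleTuple A ∧
      ∀ j, MatConj (Matrix.diagonal (d j)) (A j) := by
  classical
  choose a b c hab hac hbc hM using fun j => evCounts_split (hmv j)
  -- genericity in terms of multiplicities
  have hg : ∀ (x y z : Fin 3 → ℕ) (κ : ℕ), 1 ≤ κ → κ ≤ 3 * k → (∀ j, x j ≤ k + 1) → (∀ j, y j ≤ k) →
      (∀ j, z j ≤ k) → (∀ j, x j + y j + z j = κ) →
      ∑ j, (x j * a j + y j * b j + z j * c j) ≠ 0 := by
    intro x y z κ h1 h2 hx hy hz hκ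
    choose Φ hΦ hΦ2 using fun j => exists_subset_sum (hM j) (hx j) (hy j) (hz j)
    have := hgen κ h1 (by omega) Φ (fun j => (hΦ j).trans (hκ j))
    simpa only [hΦ2] using this
  have hs0 : (k + 1) * ∑ j, a j + k * ∑ j, b j + k * ∑ j, c j = 0 := by
    have : ∀ j, ∑ i, d j i = (k + 1) * a j + k * b j + k * c j := by
      intro j
      rw [Finset.sum, hM j]
      simp
      ring
    simp only [this] at hsum
    rw [Finset.mul_sum, Finset.mul_sum, Finset.mul_sum, ← Finset.sum_add_distrib,
      ← Finset.sum_add_distrib]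
    exact hsum
  have hGen : GenH k a b c (∑ j, a j + ∑ j, b j + ∑ j, c j) := by
    constructor
    · rfl
    · have := hg (fun _ => 1) (fun _ => 1) (fun _ => 1) 3 (by omega) (by omega) (fun _ => by omega)
        (fun _ => by omega) (fun _ => by omega) (fun _ => by omega)
      simpa [Finset.sum_add_distrib] using this
    · linear_combination hs0
    · intro j m hm e
      rcases Nat.eq_zero_or_pos m with rfl | hm0
      · apply hab j; push_cast at e; linear_combination -e
      refine hg (fun i => m + if i = j then 1 else 0) (fun i => m - if i = j then 1 else 0)
        (fun _ => m) (3 * m) (by omega) (by omega) ?_ ?_ ?_ ?_ ?_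
      iterate 4
        intro i
        try dsimp only
        first | omega | (split_ifs <;> omega)
      have : ∀ i, (((m - if i = j then 1 else 0 : ℕ)) : ℂ) = m - if i = j then 1 else 0 := by
        intro i; split_ifs
        · rw [Nat.cast_sub (by omega)]; simp
        · simp
      simp only [this]
      push_cast
      simp only [add_mul, sub_mul, ite_mul, one_mul, zero_mul, Finset.sum_add_distrib,
        Finset.sum_sub_distrib, Finset.sum_ite_eq', Finset.mem_univ, if_true, ← Finset.mul_sum]
      linear_combination -e
    · intro j m hm e
      rcases Nat.eq_zero_or_pos m with rfl | hm0
      · apply hac j; push_cast at e; linear_combination -e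
      refine hg (fun i => m + if i = j then 1 else 0) (fun _ => m)
        (fun i => m - if i = j then 1 else 0) (3 * m) (by omega) (by omega) ?_ ?_ ?_ ?_ ?_
      iterate 4
        intro i
        try dsimp only
        first | omega | (split_ifs <;> omega)
      have : ∀ i, (((m - if i = j then 1 else 0 : ℕ)) : ℂ) = m - if i = j then 1 else 0 := by
        intro i; split_ifs
        · rw [Nat.cast_sub (by omega)]; simp
        · simp
      simp only [this]
      push_cast
      simp only [add_mul, sub_mul, ite_mul, one_mul, zero_mul, Finset.sum_add_distrib,
        Finset.sum_sub_distrib, Finset.sum_ite_eq', Finset.mem_univ, if_true, ← Finset.mul_sum]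
      linear_combination -e
    · intro _ j
      exact sub_ne_zero.2 (hbc j)
    · intro _ j e
      refine hg (fun i => if i = j then 1 else 0) (fun _ => 0)
        (fun i => 1 - if i = j then 1 else 0) 1 (by omega) (by omega) ?_ ?_ ?_ ?_ ?_
      iterate 4
        intro i
        try dsimp only
        first | omega | (split_ifs <;> omega)
      have : ∀ i, (((1 - if i = j then 1 else 0 : ℕ)) : ℂ) = 1 - if i = j then 1 else 0 := by
        intro i; split_ifs <;> simp
      simp only [this]
      push_cast
      simp only [add_mul, sub_mul, ite_mul, one_mul, zero_mul, Finset.sum_add_distrib,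
        Finset.sum_sub_distrib, Finset.sum_ite_eq', Finset.mem_univ, if_true, ← Finset.mul_sum,
        Finset.sum_const_zero]
      linear_combination e
    · intro m hm e
      refine hg (fun i => m + 1) (fun _ => m)
        (fun i => m + 1) (3 * m + 2) (by omega) (by omega) ?_ ?_ ?_ ?_ ?_
      iterate 4
        intro i
        try dsimp only
        omega
      simp only [Finset.sum_add_distrib, ← Finset.mul_sum]
      push_cast
      linear_combination e
    · intro m hm e
      refine hg (fun i => m + 1) (fun _ => m + 1)
        (fun i => m) (3 * m + 2) (by omega) (by omega) ?_ ?_ ?_ ?_ ?_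
      iterate 4
        intro i
        try dsimp only
        omega
      simp only [Finset.sum_add_distrib, ← Finset.mul_sum]
      push_cast
      linear_combination e
    · intro j m hm e
      refine hg (fun i => m + 1) (fun i => m + if i = j then 1 else 0)
        (fun i => m + 1 - if i = j then 1 else 0) (3 * m + 2) (by omega) (by omega) ?_ ?_ ?_ ?_ ?_
      iterate 4
        intro i
        try dsimp only
        first | omega | (split_ifs <;> omega)
      have : ∀ i, (((m + 1 - if i = j then 1 else 0 : ℕ)) : ℂ) = m + 1 - if i = j then 1 else 0 := by
        intro i; split_ifs <;> simp
      simp only [this]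
      push_cast
      simp only [add_mul, sub_mul, ite_mul, one_mul, zero_mul, Finset.sum_add_distrib,
        Finset.sum_sub_distrib, Finset.sum_ite_eq', Finset.mem_univ, if_true, ← Finset.mul_sum]
      linear_combination e
  obtain ⟨V, i1, i2, i3, T, hT, hD⟩ := exists_sol k a b c _ hGen
  choose B hB using fun j => (hD j).exists_basis (d j) (hM j)
  have hT0 : ∑ j, T j = 0 := by
    ext v
    simpa using hT v
  let A : Fin 3 → Matrix (Fin n) (Fin n) ℂ := fun j => LinearMap.toMatrix (B 0) (B 0) (T j)
  have hA : ∑ j, A j = 0 := by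
    simp only [A]
    rw [← map_sum, hT0, map_zero]
  have hdiag : ∀ j, LinearMap.toMatrix (B j) (B j) (T j) = Matrix.diagonal (d j) := by
    intro j
    ext p q
    rw [LinearMap.toMatrix_apply, hB, Matrix.diagonal_apply]
    simp only [map_smul, Module.Basis.repr_self, Finsupp.smul_single, smul_eq_mul, mul_one,
      Finsupp.single_apply]
    by_cases hpq : p = q
    · subst hpq; simp
    · simp [hpq, Ne.symm hpq]
  refine ⟨A, hA, irreducible_of_generic_s8 hgen hA ?_, ?_⟩
  · intro j
    refine ⟨(B j).map (B 0).equivFun, fun i => ?_⟩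
    simp only [A, Module.Basis.map_apply, Matrix.mulVecLin_apply, Module.Basis.equivFun_apply]
    rw [LinearMap.toMatrix_mulVec_repr, hB]
    simp
  · intro j
    refine ⟨⟨(B 0).toMatrix (B j), (B j).toMatrix (B 0), Module.Basis.toMatrix_mul_toMatrix_flip _ _,
      Module.Basis.toMatrix_mul_toMatrix_flip _ _⟩, ?_⟩
    change A j = (B 0).toMatrix (B j) * Matrix.diagonal (d j) * (B j).toMatrix (B 0)
    rw [← hdiag, basis_toMatrix_mul_linearMap_toMatrix_mul_basis_toMatrix]
end
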